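/- For every integer j ≥ 0, the space S_{j,1}(Γ₂[2]) of Siegel cusp forms of degree 2 and weight (j,1) on the principal congruence subgroup Γ₂[2] of level 2 is zero. -/

import Mathlib

noncomputable section

open Matrix Complex Filter Topology

/-- The standard symplectic form matrix of size 4. -/
def J4 : Matrix (Fin 4) (Fin 4) ℤ := !![0,0,1,0; 0,0,0,1; -1,0,0,0; 0,-1,0,0]

/-- The Siegel modular group `Γ₂ = Sp(4,ℤ)`, as a set of 4×4 integer matrices. -/
def Sp4Z : Set (Matrix (Fin 4) (Fin 4) ℤ) := {γ | γᵀ * J4 * γ = J4}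

/-- The principal congruence subgroup `Γ₂[2]` of level 2. -/
def Sp4Z2 : Set (Matrix (Fin 4) (Fin 4) ℤ) :=
  {γ | γ ∈ Sp4Z ∧ ∀ i j, ((γ i j : ZMod 2) = if i = j then 1 else 0)}

/-- The Siegel upper half space of degree 2: symmetric 2×2 complex matrices with
positive definite imaginary part (encoded as functions `Fin 2 → Fin 2 → ℂ`). -/
def H2 : Set (Fin 2 → Fin 2 → ℂ) :=
  {τ | (Matrix.of τ).IsSymm ∧ (Matrix.of fun i j => (τ i j).im).PosDef}

/-- The four 2×2 blocks of a 4×4 integer matrix, as complex matrices. -/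
def blk (γ : Matrix (Fin 4) (Fin 4) ℤ) (r s : Fin 2) : Matrix (Fin 2) (Fin 2) ℂ :=
  Matrix.of fun i j =>
    ((γ ⟨2 * (r : ℕ) + (i : ℕ), by have h1 := r.isLt; have h2 := i.isLt; omega⟩
        ⟨2 * (s : ℕ) + (j : ℕ), by have h1 := s.isLt; have h2 := j.isLt; omega⟩ : ℤ) : ℂ)

/-- The factor `cτ + d`. -/
def den (γ : Matrix (Fin 4) (Fin 4) ℤ) (τ : Fin 2 → Fin 2 → ℂ) : Matrix (Fin 2) (Fin 2) ℂ :=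
  blk γ 1 0 * Matrix.of τ + blk γ 1 1

/-- The action `γ·τ = (aτ+b)(cτ+d)⁻¹` of `Sp(4)` on the Siegel upper half space. -/
def moeb (γ : Matrix (Fin 4) (Fin 4) ℤ) (τ : Fin 2 → Fin 2 → ℂ) : Fin 2 → Fin 2 → ℂ :=
  fun i j => ((blk γ 0 0 * Matrix.of τ + blk γ 0 1) * (den γ τ)⁻¹) i j

/-- Matrix coefficients of the `j`-th symmetric power of the standard representation of
`GL(2,ℂ)`, in the basis `x₁^(j-i) x₂^i`. -/
def symCoeff (j : ℕ) (m : Matrix (Fin 2) (Fin 2) ℂ) (l i : Fin (j + 1)) : ℂ :=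
  (((Polynomial.C (m 0 0) + Polynomial.C (m 1 0) * Polynomial.X) ^ (j - (l : ℕ)) *
    (Polynomial.C (m 0 1) + Polynomial.C (m 1 1) * Polynomial.X) ^ (l : ℕ)).coeff i)

/-- The `j`-th symmetric power `Sym^j(m)` acting on coordinate vectors. -/
def symAct (j : ℕ) (m : Matrix (Fin 2) (Fin 2) ℂ) (v : Fin (j + 1) → ℂ) : Fin (j + 1) → ℂ :=
  fun i => ∑ l, symCoeff j m l i * v l

lemma symAct_add (j : ℕ) (m : Matrix (Fin 2) (Fin 2) ℂ) (v w : Fin (j + 1) → ℂ) :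
    symAct j m (v + w) = symAct j m v + symAct j m w := by
  funext i
  simp [symAct, mul_add, Finset.sum_add_distrib]

lemma symAct_smul (j : ℕ) (m : Matrix (Fin 2) (Fin 2) ℂ) (a : ℂ) (v : Fin (j + 1) → ℂ) :
    symAct j m (a • v) = a • symAct j m v := by
  funext i
  simp only [symAct, Pi.smul_apply, smul_eq_mul, Finset.mul_sum]
  exact Finset.sum_congr rfl fun l _ => by ring

lemma symAct_zero (j : ℕ) (m : Matrix (Fin 2) (Fin 2) ℂ) : symAct j m 0 = 0 := by
  funext i; simp [symAct]

/-- The weight `(j,k)` automorphy action `Sym^j(m) ⊗ det(m)^k`. -/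
def wt (j : ℕ) (k : ℤ) (m : Matrix (Fin 2) (Fin 2) ℂ) (v : Fin (j + 1) → ℂ) :
    Fin (j + 1) → ℂ :=
  (m.det ^ k) • symAct j m v

lemma wt_add (j : ℕ) (k : ℤ) (m : Matrix (Fin 2) (Fin 2) ℂ) (v w : Fin (j + 1) → ℂ) :
    wt j k m (v + w) = wt j k m v + wt j k m w := by
  simp [wt, symAct_add, smul_add]

lemma wt_smul (j : ℕ) (k : ℤ) (m : Matrix (Fin 2) (Fin 2) ℂ) (a : ℂ) (v : Fin (j + 1) → ℂ) :
    wt j k m (a • v) = a • wt j k m v := by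
  rw [wt, wt, symAct_smul, smul_comm]

lemma wt_zero (j : ℕ) (k : ℤ) (m : Matrix (Fin 2) (Fin 2) ℂ) : wt j k m 0 = 0 := by
  simp [wt, symAct_zero]

/-- The slash operation `(F|γ)(τ) = Sym^j(cτ+d)⁻¹ det(cτ+d)⁻ᵏ F(γ·τ)`. -/
def slashS (j : ℕ) (k : ℤ) (γ : Matrix (Fin 4) (Fin 4) ℤ)
    (F : (Fin 2 → Fin 2 → ℂ) → (Fin (j + 1) → ℂ)) (τ : Fin 2 → Fin 2 → ℂ) :
    Fin (j + 1) → ℂ :=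
  ((den γ τ).det ^ (-k)) • symAct j ((den γ τ)⁻¹) (F (moeb γ τ))

lemma slashS_add (j : ℕ) (k : ℤ) (γ : Matrix (Fin 4) (Fin 4) ℤ)
    (F G : (Fin 2 → Fin 2 → ℂ) → (Fin (j + 1) → ℂ)) (τ : Fin 2 → Fin 2 → ℂ) :
    slashS j k γ (F + G) τ = slashS j k γ F τ + slashS j k γ G τ := by
  simp [slashS, symAct_add, smul_add]

lemma slashS_smul (j : ℕ) (k : ℤ) (γ : Matrix (Fin 4) (Fin 4) ℤ) (a : ℂ)
    (F : (Fin 2 → Fin 2 → ℂ) → (Fin (j + 1) → ℂ)) (τ : Fin 2 → Fin 2 → ℂ) :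
    slashS j k γ (a • F) τ = a • slashS j k γ F τ := by
  simp only [slashS, Pi.smul_apply, symAct_smul]
  rw [smul_comm]

lemma slashS_zero (j : ℕ) (k : ℤ) (γ : Matrix (Fin 4) (Fin 4) ℤ) (τ : Fin 2 → Fin 2 → ℂ) :
    slashS j k γ (0 : (Fin 2 → Fin 2 → ℂ) → (Fin (j + 1) → ℂ)) τ = 0 := by
  simp [slashS, symAct_zero]

/-- The diagonal point `diag(τ₁,τ₂)` of the Siegel upper half space. -/
def diagH (τ₁ τ₂ : ℂ) : Fin 2 → Fin 2 → ℂ :=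
  fun i j => if i = j then (if i = 0 then τ₁ else τ₂) else 0

/-- `F` is a Siegel cusp form of degree 2 and weight `(j,k)` on `Γ`, with character `χ`:
holomorphic on `ℍ₂`, transforming by `F(γ·τ) = χ(γ) Sym^j(cτ+d) det(cτ+d)^k F(τ)` for `γ ∈ Γ`,
with `(F|γ)(diag(τ₁,it)) → 0` as `t → ∞` for every `γ ∈ Γ₂`, and (normalization) vanishing
off `ℍ₂`. -/
def IsSiegelCuspForm (j : ℕ) (k : ℤ) (Γ : Set (Matrix (Fin 4) (Fin 4) ℤ))
    (χ : Matrix (Fin 4) (Fin 4) ℤ → ℂ)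
    (F : (Fin 2 → Fin 2 → ℂ) → (Fin (j + 1) → ℂ)) : Prop :=
  DifferentiableOn ℂ F H2 ∧
  (∀ γ ∈ Γ, ∀ τ ∈ H2, F (moeb γ τ) = χ γ • wt j k (den γ τ) (F τ)) ∧
  (∀ γ ∈ Sp4Z, ∀ τ₁ : ℂ, 0 < τ₁.im →
    Tendsto (fun t : ℝ => slashS j k γ F (diagH τ₁ (t * Complex.I))) atTop (𝓝 0)) ∧
  (∀ τ, τ ∉ H2 → F τ = 0)

/-- The space `S_{j,k}(Γ, χ)` of Siegel cusp forms of degree 2 and weight `(j,k)` on `Γ`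
with character `χ`, as a complex vector space. -/
def SiegelCusp (j : ℕ) (k : ℤ) (Γ : Set (Matrix (Fin 4) (Fin 4) ℤ))
    (χ : Matrix (Fin 4) (Fin 4) ℤ → ℂ) :
    Submodule ℂ ((Fin 2 → Fin 2 → ℂ) → (Fin (j + 1) → ℂ)) where
  carrier := {F | IsSiegelCuspForm j k Γ χ F}
  add_mem' := by
    rintro F G hF hG
    refine ⟨hF.1.add hG.1, ?_, ?_, ?_⟩
    · intro γ hγ τ hτ
      show F (moeb γ τ) + G (moeb γ τ) = χ γ • wt j k (den γ τ) (F τ + G τ)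
      rw [wt_add, smul_add, hF.2.1 γ hγ τ hτ, hG.2.1 γ hγ τ hτ]
    · intro γ hγ τ₁ hτ
      have h := (hF.2.2.1 γ hγ τ₁ hτ).add (hG.2.2.1 γ hγ τ₁ hτ)
      rw [add_zero] at h
      exact h.congr fun t => (slashS_add j k γ F G _).symm
    · intro τ hτ
      show F τ + G τ = 0
      rw [hF.2.2.2 τ hτ, hG.2.2.2 τ hτ, add_zero]
  zero_mem' := by
    refine ⟨?_, ?_, ?_, ?_⟩
    · exact differentiableOn_const 0
    · intro γ hγ τ hτ
      show (0 : Fin (j + 1) → ℂ) = χ γ • wt j k (den γ τ) 0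
      rw [wt_zero, smul_zero]
    · intro γ hγ τ₁ hτ
      have : (fun t : ℝ => slashS j k γ (0 : (Fin 2 → Fin 2 → ℂ) → (Fin (j + 1) → ℂ))
          (diagH τ₁ (t * Complex.I))) = fun _ => 0 := by
        funext t; exact slashS_zero j k γ _
      rw [this]
      exact tendsto_const_nhds
    · intro τ _; rfl
  smul_mem' := by
    rintro a F hF
    refine ⟨hF.1.const_smul a, ?_, ?_, ?_⟩
    · intro γ hγ τ hτ
      show a • F (moeb γ τ) = χ γ • wt j k (den γ τ) (a • F τ)
      rw [hF.2.1 γ hγ τ hτ, wt_smul, smul_comm]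
    · intro γ hγ τ₁ hτ
      have h := (hF.2.2.1 γ hγ τ₁ hτ).const_smul a
      rw [smul_zero] at h
      exact h.congr fun t => (slashS_smul j k γ a F _).symm
    · intro τ hτ
      show a • F τ = 0
      rw [hF.2.2.2 τ hτ, smul_zero]

/-- `ε` is (on `Γ₂`) the unique nontrivial homomorphism `Γ₂ → {±1}`. -/
def IsEps (ε : Matrix (Fin 4) (Fin 4) ℤ → ℂ) : Prop :=
  (∀ γ ∈ Sp4Z, ε γ = 1 ∨ ε γ = -1) ∧
  (∀ γ ∈ Sp4Z, ∀ δ ∈ Sp4Z, ε (γ * δ) = ε γ * ε δ) ∧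
  (∃ γ ∈ Sp4Z, ε γ ≠ 1)

namespace SS

lemma hdc {𝕜 : Type*} [NontriviallyNormedField 𝕜] {E : Type*} [NormedAddCommGroup E] [NormedSpace 𝕜 E]
    {f g : 𝕜 → E} {f' g' : E} {x : 𝕜} (h : HasDerivAt f f' x) (hf : ∀ r, g r = f r) (hd : g' = f') :
    HasDerivAt g g' x := by
  obtain rfl : g = f := funext hf
  rw [hd]; exact h

/-! ### The polynomial attached to a vector -/
def hat {j : ℕ} (a b : ℕ) (v : Fin (j+1) → ℂ) (s t : ℂ) : ℂ :=
  ∑ i : Fin (j+1), v i * (((j - (i:ℕ)).descFactorial a : ℂ) * ((i:ℕ).descFactorial b : ℂ)) *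
    (s ^ (j - (i:ℕ) - a) * t ^ ((i:ℕ) - b))

lemma pow_desc (n a : ℕ) (s : ℂ) : HasDerivAt (fun s : ℂ => (n.descFactorial a : ℂ) * s ^ (n - a))
    ((n.descFactorial (a+1) : ℂ) * s ^ (n - (a+1))) s := by
  have := (hasDerivAt_pow (n - a) s).const_mul (n.descFactorial a : ℂ)
  refine hdc this (fun _ => rfl) ?_
  rw [Nat.descFactorial_succ, Nat.sub_sub]; push_cast; ring

lemma hat_hasDerivAt {j : ℕ} (a b : ℕ) {v : ℝ → Fin (j+1) → ℂ} {v' : Fin (j+1) → ℂ}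
    {s t : ℝ → ℂ} {s' t' : ℂ} {x : ℝ}
    (hv : ∀ i, HasDerivAt (fun r => v r i) (v' i) x) (hs : HasDerivAt s s' x)
    (ht : HasDerivAt t t' x) :
    HasDerivAt (fun r => hat a b (v r) (s r) (t r))
      (hat a b v' (s x) (t x) + s' * hat (a+1) b (v x) (s x) (t x)
        + t' * hat a (b+1) (v x) (s x) (t x)) x := by
  unfold hat
  rw [Finset.mul_sum, Finset.mul_sum, ← Finset.sum_add_distrib, ← Finset.sum_add_distrib]
  refine HasDerivAt.fun_sum fun i _ => ?_
  have h1 := (pow_desc (j - i) a (s x)).comp x hs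
  have h2 := (pow_desc i b (t x)).comp x ht
  have := (hv i).mul (h1.mul h2)
  refine hdc this (fun r => ?_) ?_
  · simp only [Function.comp, Pi.mul_apply]; ring
  · simp only [Function.comp, Pi.mul_apply]; ring

lemma hat_add {j : ℕ} (a b : ℕ) (v w : Fin (j+1) → ℂ) (s t : ℂ) :
    hat a b (v + w) s t = hat a b v s t + hat a b w s t := by
  simp [hat, add_mul, Finset.sum_add_distrib]

lemma hat_smul {j : ℕ} (a b : ℕ) (c : ℂ) (v : Fin (j+1) → ℂ) (s t : ℂ) :
    hat a b (c • v) s t = c * hat a b v s t := by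
  simp [hat, Finset.mul_sum, mul_assoc]

lemma hat_zero {j : ℕ} (a b : ℕ) (s t : ℂ) :
    hat a b (0 : Fin (j+1) → ℂ) s t = 0 := by simp [hat]

lemma hat_cont {j : ℕ} (a b : ℕ) (v : Fin (j+1) → ℂ) :
    Continuous fun p : ℂ × ℂ => hat a b v p.1 p.2 := by unfold hat; fun_prop

lemma hat_inj {j : ℕ} {v w : Fin (j+1) → ℂ} (h : ∀ s t, hat 0 0 v s t = hat 0 0 w s t) : v = w := by
  have key : ∀ u : Fin (j+1) → ℂ, (∀ t, hat 0 0 u 1 t = 0) → u = 0 := by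
    intro u hu
    have : (∑ i : Fin (j+1), Polynomial.monomial (i:ℕ) (u i)) = 0 := by
      refine Polynomial.funext fun t => ?_
      simpa [hat, Polynomial.eval_finsetSum, Polynomial.eval_monomial] using hu t
    funext i
    have h2 := congrArg (fun p => Polynomial.coeff p i) this
    simpa [Polynomial.finsetSum_coeff, Polynomial.coeff_monomial, Fin.val_inj] using h2
  have := key (v + (-1:ℂ) • w) fun t => by rw [hat_add, hat_smul, h]; ring
  have h3 : v - w = 0 := by rw [← this]; simp [sub_eq_add_neg]
  exact sub_eq_zero.1 h3

lemma homog (n l : ℕ) (hl : l ≤ n) (a b c d s t : ℂ) :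
    ∑ i : Fin (n+1), (((Polynomial.C a + Polynomial.C b * Polynomial.X) ^ (n - l) *
    (Polynomial.C c + Polynomial.C d * Polynomial.X) ^ l).coeff i) * (s ^ (n - (i:ℕ)) * t ^ (i:ℕ))
    = (a * s + b * t) ^ (n - l) * (c * s + d * t) ^ l := by
  set P := ((Polynomial.C a + Polynomial.C b * Polynomial.X) ^ (n - l) *
    (Polynomial.C c + Polynomial.C d * Polynomial.X) ^ l) with hP
  have hdeg : P.natDegree < n + 1 := by
    have e : ∀ a b : ℂ, (Polynomial.C a + Polynomial.C b * Polynomial.X).natDegree ≤ 1 := by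
      intro a b; compute_degree
    have := Polynomial.natDegree_mul_le (p := (Polynomial.C a + Polynomial.C b * Polynomial.X) ^ (n - l))
      (q := (Polynomial.C c + Polynomial.C d * Polynomial.X) ^ l)
    have h1 := Polynomial.natDegree_pow_le_of_le (n - l) (e a b)
    have h2 := Polynomial.natDegree_pow_le_of_le l (e c d)
    rw [hP]; omega
  have key : ∀ s ∈ ({0}ᶜ : Set ℂ), ∑ i : Fin (n+1), P.coeff i * (s ^ (n - (i:ℕ)) * t ^ (i:ℕ))
    = (a * s + b * t) ^ (n - l) * (c * s + d * t) ^ l := by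
    intro s hs
    have hs : s ≠ 0 := hs
    have h1 : P.eval (t / s) * s ^ n = (a * s + b * t) ^ (n - l) * (c * s + d * t) ^ l := by
      have : s ^ n = s ^ (n - l) * s ^ l := by rw [← pow_add]; congr 1; omega
      rw [hP, Polynomial.eval_mul, Polynomial.eval_pow, Polynomial.eval_pow, this,
        mul_mul_mul_comm, ← mul_pow, ← mul_pow]
      simp only [Polynomial.eval_add, Polynomial.eval_C, Polynomial.eval_mul, Polynomial.eval_X]
      congr 2 <;> field_simp
    rw [← h1, Polynomial.eval_eq_sum_range' hdeg, Finset.sum_range, Finset.sum_mul]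
    refine Finset.sum_congr rfl fun i _ => ?_
    have : s ^ n = s ^ (n - (i:ℕ)) * s ^ (i:ℕ) := by rw [← pow_add]; congr 1; omega
    rw [this, div_pow]; field_simp
  have := Continuous.ext_on (dense_compl_singleton (0:ℂ)) (f := fun s => ∑ i : Fin (n+1), P.coeff i *
    (s ^ (n - (i:ℕ)) * t ^ (i:ℕ))) (g := fun s => (a * s + b * t) ^ (n - l) * (c * s + d * t) ^ l)
    (by fun_prop) (by fun_prop) key
  exact congrFun this s

lemma hat_symAct {j : ℕ} (m : Matrix (Fin 2) (Fin 2) ℂ) (v : Fin (j+1) → ℂ) (s t : ℂ) :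
    hat 0 0 (symAct j m v) s t = hat 0 0 v (m 0 0 * s + m 1 0 * t) (m 0 1 * s + m 1 1 * t) := by
  have : ∀ (v : Fin (j+1) → ℂ) (s t : ℂ), hat 0 0 v s t = ∑ i, v i * (s ^ (j - (i:ℕ)) * t ^ (i:ℕ)) := by
    intro v s t; simp [hat]
  rw [this, this]
  simp only [symAct, Finset.sum_mul]
  rw [Finset.sum_comm]
  refine Finset.sum_congr rfl fun l _ => ?_
  rw [← homog j l (by omega), Finset.mul_sum]
  exact Finset.sum_congr rfl fun i _ => by rw [symCoeff]; ring

lemma hat_deriv_s {j : ℕ} (a b : ℕ) (v : Fin (j+1) → ℂ) (p q p' q' : ℂ) :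
    HasDerivAt (fun r : ℝ => hat a b v (p + r * p') (q + r * q'))
      (p' * hat (a+1) b v p q + q' * hat a (b+1) v p q) 0 := by
  have h : ∀ p p' : ℂ, HasDerivAt (fun r : ℝ => p + r * p') p' 0 := fun p p' => by
    simpa using ((Complex.ofRealCLM.hasDerivAt (x := (0:ℝ))).mul_const p').const_add p
  have := hat_hasDerivAt a b (v := fun _ => v) (v' := 0) (fun i => hasDerivAt_const _ _) (h p p') (h q q')
  simpa [hat_zero] using this

/-- chain rule -/
lemma hat_symAct_s {j : ℕ} (m : Matrix (Fin 2) (Fin 2) ℂ) (v : Fin (j+1) → ℂ) (s t : ℂ) :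
    hat 1 0 (symAct j m v) s t =
      m 0 0 * hat 1 0 v (m 0 0 * s + m 1 0 * t) (m 0 1 * s + m 1 1 * t) +
      m 0 1 * hat 0 1 v (m 0 0 * s + m 1 0 * t) (m 0 1 * s + m 1 1 * t) := by
  have h1 := hat_deriv_s 0 0 (symAct j m v) s t 1 0
  have h2 := hat_deriv_s 0 0 v (m 0 0 * s + m 1 0 * t) (m 0 1 * s + m 1 1 * t) (m 0 0) (m 0 1)
  have h3 := h1.unique (h2.congr_of_eventuallyEq (Eventually.of_forall fun r => by
    simp only [hat_symAct]; congr 1 <;> ring))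
  simpa using h3

lemma hat_symAct_t {j : ℕ} (m : Matrix (Fin 2) (Fin 2) ℂ) (v : Fin (j+1) → ℂ) (s t : ℂ) :
    hat 0 1 (symAct j m v) s t =
      m 1 0 * hat 1 0 v (m 0 0 * s + m 1 0 * t) (m 0 1 * s + m 1 1 * t) +
      m 1 1 * hat 0 1 v (m 0 0 * s + m 1 0 * t) (m 0 1 * s + m 1 1 * t) := by
  have h1 := hat_deriv_s 0 0 (symAct j m v) s t 0 1
  have h2 := hat_deriv_s 0 0 v (m 0 0 * s + m 1 0 * t) (m 0 1 * s + m 1 1 * t) (m 1 0) (m 1 1)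
  have h3 := h1.unique (h2.congr_of_eventuallyEq (Eventually.of_forall fun r => by
    simp only [hat_symAct]; congr 1 <;> ring))
  simpa using h3

lemma symAct_mul {j : ℕ} (m n : Matrix (Fin 2) (Fin 2) ℂ) (v : Fin (j+1) → ℂ) :
    symAct j (m * n) v = symAct j m (symAct j n v) := by
  refine hat_inj fun s t => ?_
  simp only [hat_symAct, Matrix.mul_apply, Fin.sum_univ_two]
  congr 1 <;> ring

lemma symAct_one {j : ℕ} (v : Fin (j+1) → ℂ) : symAct j 1 v = v := by
  refine hat_inj fun s t => ?_
  simp [hat_symAct]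

end SS

namespace SS

abbrev M2 := Matrix (Fin 2) (Fin 2) ℂ
abbrev G : Type := ↥(Matrix.symplecticGroup (Fin 2) ℝ)

def cm (m : Matrix (Fin 2) (Fin 2) ℝ) : M2 := m.map ofRealHom
def ga (g : G) : M2 := cm g.1.toBlocks₁₁
def gb (g : G) : M2 := cm g.1.toBlocks₁₂
def gc (g : G) : M2 := cm g.1.toBlocks₂₁
def gd (g : G) : M2 := cm g.1.toBlocks₂₂

lemma cm_mul (a b : Matrix (Fin 2) (Fin 2) ℝ) : cm (a * b) = cm a * cm b := Matrix.map_mul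
lemma cm_add (a b : Matrix (Fin 2) (Fin 2) ℝ) : cm (a + b) = cm a + cm b :=
  Matrix.map_add _ (by simp) _ _
lemma cm_sub (a b : Matrix (Fin 2) (Fin 2) ℝ) : cm (a - b) = cm a - cm b :=
  Matrix.map_sub _ (by simp) _ _
lemma cm_one : cm 1 = 1 := by simp [cm]
lemma cm_T (a : Matrix (Fin 2) (Fin 2) ℝ) : cm aᵀ = (cm a)ᵀ := rfl
lemma cm_H (a : Matrix (Fin 2) (Fin 2) ℝ) : (cm a)ᴴ = (cm a)ᵀ := by
  ext i k; simp [cm, Matrix.conjTranspose_apply]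

lemma blocks (g : G) : g.1 = fromBlocks g.1.toBlocks₁₁ g.1.toBlocks₁₂ g.1.toBlocks₂₁ g.1.toBlocks₂₂ :=
  (fromBlocks_toBlocks _).symm

lemma rel (g : G) : (ga g)ᵀ * gc g = (gc g)ᵀ * ga g ∧ (gb g)ᵀ * gd g = (gd g)ᵀ * gb g ∧
    (ga g)ᵀ * gd g - (gc g)ᵀ * gb g = 1 := by
  have h := g.2
  rw [blocks g, SymplecticGroup.fromBlocks_mem_iff] at h
  obtain ⟨h1, h2, h3⟩ := h
  refine ⟨?_, ?_, ?_⟩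
  · simpa [cm_mul, cm_T, ga, gb, gc, gd] using congrArg cm h1
  · simpa [cm_mul, cm_T, ga, gb, gc, gd] using congrArg cm h2
  · simpa [cm_mul, cm_T, cm_sub, cm_one, ga, gb, gc, gd] using congrArg cm h3

lemma mul_blocks (g h : G) : ga (g*h) = ga g * ga h + gb g * gc h ∧ gb (g*h) = ga g * gb h + gb g * gd h ∧
    gc (g*h) = gc g * ga h + gd g * gc h ∧ gd (g*h) = gc g * gb h + gd g * gd h := by
  have : (g*h).1 = g.1 * h.1 := rfl
  rw [blocks g, blocks h, fromBlocks_multiply] at this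
  simp only [ga, gb, gc, gd, this, toBlocks_fromBlocks₁₁, toBlocks_fromBlocks₁₂, toBlocks_fromBlocks₂₁,
    toBlocks_fromBlocks₂₂, cm_add, cm_mul, true_and]

def num (g : G) (τ : M2) : M2 := ga g * τ + gb g
def dn (g : G) (τ : M2) : M2 := gc g * τ + gd g
def act (g : G) (τ : M2) : M2 := num g τ * (dn g τ)⁻¹

def HH : Set M2 := {τ | τᵀ = τ ∧ ∀ v : Fin 2 → ℂ, v ≠ 0 → 0 < (star v ⬝ᵥ τ *ᵥ v).im}

lemma herm (g : G) (τ : M2) : (dn g τ)ᴴ * num g τ - (num g τ)ᴴ * dn g τ = τ - τᴴ := by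
  obtain ⟨h1, h2, h3⟩ := rel g
  have h4 : (gd g)ᵀ * ga g - (gb g)ᵀ * gc g = 1 := by simpa using congrArg Matrix.transpose h3
  have e : ∀ x : M2, ∀ a : Matrix (Fin 2) (Fin 2) ℝ, ((cm a) * x)ᴴ = xᴴ * (cm a)ᵀ := by
    intro x a; rw [conjTranspose_mul, cm_H]
  have ea : (ga g)ᴴ = (ga g)ᵀ := cm_H _
  have eb : (gb g)ᴴ = (gb g)ᵀ := cm_H _
  have ec : (gc g)ᴴ = (gc g)ᵀ := cm_H _
  have ed : (gd g)ᴴ = (gd g)ᵀ := cm_H _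
  simp only [num, dn, conjTranspose_add, conjTranspose_mul, ea, eb, ec, ed]
  calc _ = τᴴ * ((gc g)ᵀ * ga g - (ga g)ᵀ * gc g) * τ + ((gd g)ᵀ * gb g - (gb g)ᵀ * gd g)
      + ((gd g)ᵀ * ga g - (gb g)ᵀ * gc g) * τ - τᴴ * ((ga g)ᵀ * gd g - (gc g)ᵀ * gb g) := by noncomm_ring
    _ = _ := by rw [h1, h2, h3, h4]; simp

lemma im_form (g : G) {τ : M2} (u : Fin 2 → ℂ) :
    (star (dn g τ *ᵥ u) ⬝ᵥ num g τ *ᵥ u).im = (star u ⬝ᵥ τ *ᵥ u).im := by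
  have h := congrArg (fun m : M2 => star u ⬝ᵥ m *ᵥ u) (herm g τ)
  have c1 : ∀ a b : M2, star (a *ᵥ u) ⬝ᵥ b *ᵥ u = star u ⬝ᵥ (aᴴ * b) *ᵥ u := by
    intro a b
    rw [star_mulVec, ← mulVec_mulVec, dotProduct_mulVec, dotProduct_mulVec (star u), vecMul_vecMul,
      dotProduct_mulVec, vecMul_vecMul]
  have c2 : ∀ a : M2, star u ⬝ᵥ aᴴ *ᵥ u = star (star u ⬝ᵥ a *ᵥ u) := by
    intro a
    rw [star_dotProduct, star_mulVec, ← dotProduct_mulVec, conjTranspose_conjTranspose]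
  simp only [sub_mulVec, dotProduct_sub] at h
  have e2 : (num g τ)ᴴ * dn g τ = ((dn g τ)ᴴ * num g τ)ᴴ := by
    rw [conjTranspose_mul, conjTranspose_conjTranspose]
  rw [e2, c2, c2] at h
  rw [c1]
  have := congrArg Complex.im h
  simp only [Complex.sub_im, Complex.star_def, Complex.conj_im] at this; linarith

lemma dn_ne (g : G) {τ : M2} (hτ : τ ∈ HH) : (dn g τ).det ≠ 0 := by
  intro h
  obtain ⟨u, hu, h0⟩ := exists_mulVec_eq_zero_iff.2 h
  have := hτ.2 u hu
  rw [← im_form g, h0] at this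
  simp at this

lemma num_sym (g : G) {τ : M2} (hτ : τᵀ = τ) : (num g τ)ᵀ * dn g τ = (dn g τ)ᵀ * num g τ := by
  obtain ⟨h1, h2, h3⟩ := rel g
  have h4 : (gd g)ᵀ * ga g - (gb g)ᵀ * gc g = 1 := by simpa using congrArg Matrix.transpose h3
  simp only [num, dn, transpose_add, transpose_mul, hτ]
  rw [← sub_eq_zero]
  calc _ = τ * ((ga g)ᵀ * gc g - (gc g)ᵀ * ga g) * τ + ((gb g)ᵀ * gd g - (gd g)ᵀ * gb g)
      - ((gd g)ᵀ * ga g - (gb g)ᵀ * gc g) * τ + τ * ((ga g)ᵀ * gd g - (gc g)ᵀ * gb g) := by noncomm_ring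
    _ = 0 := by rw [h1, h2, h3, h4]; simp

lemma act_dn (g : G) {τ : M2} (hτ : τ ∈ HH) : act g τ * dn g τ = num g τ := by
  rw [act, Matrix.mul_assoc, nonsing_inv_mul _ (dn_ne g hτ).isUnit, Matrix.mul_one]

lemma act_mem (g : G) {τ : M2} (hτ : τ ∈ HH) : act g τ ∈ HH := by
  have hu := (dn_ne g hτ).isUnit
  refine ⟨?_, fun v hv => ?_⟩
  · have h1 := num_sym g hτ.1
    have h2 : (dn g τ)ᵀ * (act g τ)ᵀ * dn g τ = (dn g τ)ᵀ * act g τ * dn g τ := by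
      rw [← transpose_mul, act_dn g hτ, h1, Matrix.mul_assoc, act_dn g hτ]
    have hu' : IsUnit (dn g τ)ᵀ.det := by rwa [det_transpose]
    have h3 := congrArg (fun m => (dn g τ)ᵀ⁻¹ * (m * (dn g τ)⁻¹)) h2
    simpa only [Matrix.mul_assoc, mul_nonsing_inv _ hu, Matrix.mul_one,
      ← Matrix.mul_assoc (dn g τ)ᵀ⁻¹, nonsing_inv_mul _ hu', Matrix.one_mul] using h3
  · set u := (dn g τ)⁻¹ *ᵥ v with hu'
    have hv' : v = dn g τ *ᵥ u := by rw [hu', mulVec_mulVec, mul_nonsing_inv _ hu, one_mulVec]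
    have hu0 : u ≠ 0 := by rintro h; rw [h, mulVec_zero] at hv'; exact hv hv'
    have : act g τ *ᵥ v = num g τ *ᵥ u := by rw [act, hu', mulVec_mulVec]
    rw [this, hv', im_form]
    exact hτ.2 u hu0

lemma num_mul (g h : G) {τ : M2} (hτ : τ ∈ HH) :
    num (g * h) τ = num g (act h τ) * dn h τ ∧ dn (g * h) τ = dn g (act h τ) * dn h τ := by
  obtain ⟨h1, h2, h3, h4⟩ := mul_blocks g h
  constructor
  · rw [num, num, h1, h2, add_mul _ _ (dn h τ), Matrix.mul_assoc _ (act h τ), act_dn h hτ, num, dn]; noncomm_ring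
  · rw [dn, dn.eq_def g, h3, h4, add_mul _ _ (dn h τ), Matrix.mul_assoc _ (act h τ), act_dn h hτ, num, dn]; noncomm_ring

lemma act_mul (g h : G) {τ : M2} (hτ : τ ∈ HH) : act (g * h) τ = act g (act h τ) := by
  obtain ⟨h1, h2⟩ := num_mul g h hτ
  rw [act, h1, h2, Matrix.mul_inv_rev, Matrix.mul_assoc, ← Matrix.mul_assoc (dn h τ),
    mul_nonsing_inv _ (dn_ne h hτ).isUnit, Matrix.one_mul, ← act.eq_def g]

variable {j : ℕ}
open Classical in
/-- slash operator of weight `(j,1)` -/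
def sl (g : G) (H : M2 → Fin (j+1) → ℂ) (τ : M2) : Fin (j+1) → ℂ :=
  if τ ∈ HH then ((dn g τ).det)⁻¹ • symAct j (dn g τ)⁻¹ (H (act g τ)) else 0

lemma sl_of (g : G) (H : M2 → Fin (j+1) → ℂ) {τ : M2} (hτ : τ ∈ HH) :
    sl g H τ = ((dn g τ).det)⁻¹ • symAct j (dn g τ)⁻¹ (H (act g τ)) := if_pos hτ

lemma sl_mul (g h : G) (H : M2 → Fin (j+1) → ℂ) : sl h (sl g H) = sl (g * h) H := by
  funext τ
  by_cases hτ : τ ∈ HH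
  · rw [sl_of _ _ hτ, sl_of _ _ hτ, sl_of _ _ (act_mem h hτ), act_mul g h hτ, (num_mul g h hτ).2,
      symAct_smul, smul_smul, ← symAct_mul, det_mul, mul_inv, Matrix.mul_inv_rev, mul_comm]
  · simp [sl, hτ]

lemma one_blocks : ga 1 = 1 ∧ gb 1 = 0 ∧ gc 1 = 0 ∧ gd 1 = 1 := by
  refine ⟨?_, ?_, ?_, ?_⟩ <;> ext i k <;>
    simp [ga, gb, gc, gd, cm, toBlocks₁₁, toBlocks₁₂, toBlocks₂₁, toBlocks₂₂, Matrix.one_apply, apply_ite]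

lemma sl_one (H : M2 → Fin (j+1) → ℂ) (h0 : ∀ τ, τ ∉ HH → H τ = 0) : sl 1 H = H := by
  funext τ
  by_cases hτ : τ ∈ HH
  · obtain ⟨h1, h2, h3, h4⟩ := one_blocks
    rw [sl_of _ _ hτ, act, num, dn, h1, h2, h3, h4]; simp [symAct_one]
  · simp [sl, hτ, h0]

lemma hat_sl (g : G) (H : M2 → Fin (j+1) → ℂ) {τ : M2} (hτ : τ ∈ HH) (s t : ℂ) :
    hat 0 0 (sl g H τ) s t = ((dn g τ).det)⁻¹ * hat 0 0 (H (act g τ))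
      ((dn g τ)⁻¹ 0 0 * s + (dn g τ)⁻¹ 1 0 * t) ((dn g τ)⁻¹ 0 1 * s + (dn g τ)⁻¹ 1 1 * t) := by
  rw [sl_of _ _ hτ, hat_smul, hat_symAct]

/-! ### coordinates -/
def mat (a z b : ℂ) : M2 := !![a, z; z, b]

lemma mat_mem {a z b : ℂ} : mat a z b ∈ HH ↔ 0 < a.im ∧ z.im ^ 2 < a.im * b.im := by
  have form : ∀ v : Fin 2 → ℂ, (star v ⬝ᵥ mat a z b *ᵥ v).im = a.im * ‖v 0‖^2 + b.im * ‖v 1‖^2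
      + z.im * (2 * ((v 0).re * (v 1).re + (v 0).im * (v 1).im)) := by
    intro v
    simp [mat, dotProduct, mulVec, Fin.sum_univ_two, Complex.sq_norm, Complex.normSq_apply]
    ring
  constructor
  · rintro ⟨-, h⟩
    have h1 := h ![1, 0] (by intro h; simpa using congrFun h 0)
    rw [form] at h1; simp at h1
    refine ⟨h1, ?_⟩
    have h2 := h ![-(z.im : ℂ), (a.im : ℂ)] (by intro h; simpa [h1.ne'] using congrFun h 1)
    rw [form] at h2
    simp at h2
    nlinarith
  · rintro ⟨h1, h2⟩
    refine ⟨by ext i k; fin_cases i <;> fin_cases k <;> rfl, fun v hv => ?_⟩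
    rw [form]
    have hn : ∀ w : ℂ, ‖w‖^2 = w.re^2 + w.im^2 := fun w => by
      rw [Complex.sq_norm, Complex.normSq_apply]; ring
    rw [hn, hn]
    have key : a.im * (a.im * ((v 0).re^2 + (v 0).im^2) + b.im * ((v 1).re^2 + (v 1).im^2)
      + z.im * (2 * ((v 0).re * (v 1).re + (v 0).im * (v 1).im)))
      = (a.im * (v 0).re + z.im * (v 1).re)^2 + (a.im * (v 0).im + z.im * (v 1).im)^2
        + (a.im * b.im - z.im^2) * ((v 1).re^2 + (v 1).im^2) := by ring
    refine pos_of_mul_pos_right (a := a.im) (key ▸ ?_) h1.le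
    have hd : 0 < a.im * b.im - z.im^2 := by linarith
    by_cases hv1 : v 1 = 0
    · have hv0 : v 0 ≠ 0 := fun h => hv (by funext i; fin_cases i <;> simp [h, hv1])
      have : 0 < ‖v 0‖^2 := by positivity
      rw [hn] at this
      rw [hv1]; simp only [Complex.zero_re, Complex.zero_im]
      have : 0 < a.im^2 * ((v 0).re^2 + (v 0).im^2) := by positivity
      nlinarith
    · have : 0 < ‖v 1‖^2 := by positivity
      rw [hn] at this
      have := mul_pos hd this
      positivity

lemma HH_mat {τ : M2} (h : τᵀ = τ) : τ = mat (τ 0 0) (τ 0 1) (τ 1 1) := by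
  have := congrFun (congrFun h 0) 1
  ext i k; fin_cases i <;> fin_cases k <;> simp [mat]; simpa using this

end SS

namespace SS
variable {j : ℕ}

abbrev GZ : Type := ↥(Matrix.symplecticGroup (Fin 2) ℤ)

def ι : GZ →* G where
  toFun γ := ⟨γ.1.map (Int.castRingHom ℝ), SymplecticGroup.map_mem γ.2 (Int.castRingHom ℝ)⟩
  map_one' := by ext i k; simp [Matrix.one_apply, apply_ite]
  map_mul' a b := by apply Subtype.ext; exact Matrix.map_mul

def cz (m : Matrix (Fin 2) (Fin 2) ℤ) : M2 := m.map (Int.castRingHom ℂ)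
def mkZ (A B C D : Matrix (Fin 2) (Fin 2) ℤ) (h : Aᵀ * C = Cᵀ * A ∧ Bᵀ * D = Dᵀ * B ∧ Aᵀ * D - Cᵀ * B = 1) :
  GZ := ⟨fromBlocks A B C D, SymplecticGroup.fromBlocks_mem_iff.2 h⟩

lemma ι_blocks (γ : GZ) : ga (ι γ) = cz γ.1.toBlocks₁₁ ∧ gb (ι γ) = cz γ.1.toBlocks₁₂ ∧
    gc (ι γ) = cz γ.1.toBlocks₂₁ ∧ gd (ι γ) = cz γ.1.toBlocks₂₂ := by
  refine ⟨?_, ?_, ?_, ?_⟩ <;> ext i k <;>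
    simp [ga, gb, gc, gd, cm, cz, ι, toBlocks₁₁, toBlocks₁₂, toBlocks₂₁, toBlocks₂₂]

lemma mkZ_dn (A B C D : Matrix (Fin 2) (Fin 2) ℤ) (h) (τ : M2) :
    num (ι (mkZ A B C D h)) τ = cz A * τ + cz B ∧ dn (ι (mkZ A B C D h)) τ = cz C * τ + cz D := by
  obtain ⟨h1, h2, h3, h4⟩ := ι_blocks (mkZ A B C D h)
  rw [num, dn, h1, h2, h3, h4]; simp [mkZ]

def Lev (γ : GZ) : Prop := γ.1.map (Int.castRingHom (ZMod 2)) = 1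

lemma mkZ_lev (A B C D : Matrix (Fin 2) (Fin 2) ℤ) (h) (hA : A.map (Int.castRingHom (ZMod 2)) = 1)
    (hB : B.map (Int.castRingHom (ZMod 2)) = 0) (hC : C.map (Int.castRingHom (ZMod 2)) = 0)
    (hD : D.map (Int.castRingHom (ZMod 2)) = 1) : Lev (mkZ A B C D h) := by
  simp only [Lev, mkZ, fromBlocks_map, hA, hB, hC, hD, fromBlocks_one]

def M4 (γ : GZ) : Matrix (Fin 4) (Fin 4) ℤ := Matrix.reindex finSumFinEquiv finSumFinEquiv γ.1

lemma M4_blk (γ : GZ) : blk (M4 γ) 0 0 = ga (ι γ) ∧ blk (M4 γ) 0 1 = gb (ι γ) ∧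
    blk (M4 γ) 1 0 = gc (ι γ) ∧ blk (M4 γ) 1 1 = gd (ι γ) := by
  obtain ⟨h1, h2, h3, h4⟩ := ι_blocks γ
  rw [h1, h2, h3, h4]
  refine ⟨?_, ?_, ?_, ?_⟩ <;> ext i k <;> fin_cases i <;> fin_cases k <;> rfl

lemma M4_mem (γ : GZ) : M4 γ ∈ Sp4Z := by
  have h := SymplecticGroup.mem_iff'.1 γ.2
  have hJ : J4 = - Matrix.reindex finSumFinEquiv finSumFinEquiv (J (Fin 2) ℤ) := by
    ext i k; fin_cases i <;> fin_cases k <;> rfl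
  show (M4 γ)ᵀ * J4 * M4 γ = J4
  rw [hJ, M4, Matrix.mul_neg, Matrix.neg_mul, neg_inj]
  nth_rewrite 2 [← h]
  simp only [Matrix.reindex_apply, Matrix.transpose_submatrix, Matrix.submatrix_mul_equiv]

lemma M4_lev {γ : GZ} (h : Lev γ) : M4 γ ∈ Sp4Z2 := by
  refine ⟨M4_mem γ, fun i k => ?_⟩
  have := congrFun (congrFun h (finSumFinEquiv.symm i)) (finSumFinEquiv.symm k)
  simpa [M4, Matrix.one_apply] using this

lemma H2_iff (τ : M2) : τ ∈ H2 ↔ τ ∈ HH := by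
  have h2 : τᵀ = τ → ((Matrix.of fun i k => (τ i k).im : Matrix (Fin 2) (Fin 2) ℝ).PosDef ↔
      0 < (τ 0 0).im ∧ (τ 0 1).im ^ 2 < (τ 0 0).im * (τ 1 1).im) := by
    intro hs
    have h01 : τ 1 0 = τ 0 1 := congrFun (congrFun hs 0) 1
    constructor
    · intro h
      have h1 := h.dotProduct_mulVec_pos (x := ![1, 0]) (by intro h; simpa using congrFun h 0)
      have h2 := h.det_pos
      simp [dotProduct, mulVec, Fin.sum_univ_two] at h1
      simp [det_fin_two, h01] at h2
      exact ⟨h1, by nlinarith⟩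
    · rintro ⟨h1, h2⟩
      refine Matrix.PosDef.of_dotProduct_mulVec_pos ?_ fun v hv => ?_
      · ext i k; fin_cases i <;> fin_cases k <;> simp [h01]
      · have := (mat_mem.2 ⟨h1, h2⟩).2 (fun i => (v i : ℂ)) (by
          intro h; exact hv (by funext i; simpa using congrFun h i))
        simp [mat, dotProduct, mulVec, Fin.sum_univ_two] at this
        simp [dotProduct, mulVec, Fin.sum_univ_two, h01]
        linarith
  constructor
  · rintro ⟨h, h'⟩
    have h : τᵀ = τ := h
    rw [HH_mat h]; exact mat_mem.2 ((h2 h).1 h')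
  · rintro h
    refine ⟨h.1, (h2 h.1).2 (mat_mem.1 ?_)⟩
    rw [← HH_mat h.1]; exact h

lemma sl_slashS (γ : GZ) (F : M2 → Fin (j+1) → ℂ) {τ : M2} (hτ : τ ∈ HH) :
    sl (ι γ) F τ = slashS j 1 (M4 γ) F τ := by
  obtain ⟨h1, h2, h3, h4⟩ := M4_blk γ
  have e1 : den (M4 γ) τ = dn (ι γ) τ := by
      show blk (M4 γ) 1 0 * τ + blk (M4 γ) 1 1 = _
      rw [h3, h4]; rfl
  have e2 : moeb (M4 γ) τ = act (ι γ) τ := by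
    show (blk (M4 γ) 0 0 * τ + blk (M4 γ) 0 1) * (den (M4 γ) τ)⁻¹ = _
    rw [e1, h1, h2]; rfl
  show _ = ((den (M4 γ) τ).det ^ (-1 : ℤ)) • symAct j ((den (M4 γ) τ)⁻¹) (F (moeb (M4 γ) τ))
  rw [sl_of _ _ hτ, e1, e2, _root_.zpow_neg_one]

lemma F_lev {F : M2 → Fin (j+1) → ℂ} (hF : IsSiegelCuspForm j 1 Sp4Z2 (fun _ => 1) F) {γ : GZ}
    (h : Lev γ) : sl (ι γ) F = F := by
  funext τ
  by_cases hτ : τ ∈ HH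
  · obtain ⟨h1, h2, h3, h4⟩ := M4_blk γ
    have e1 : den (M4 γ) τ = dn (ι γ) τ := by
      show blk (M4 γ) 1 0 * τ + blk (M4 γ) 1 1 = _
      rw [h3, h4]; rfl
    have e2 : moeb (M4 γ) τ = act (ι γ) τ := by
      show (blk (M4 γ) 0 0 * τ + blk (M4 γ) 0 1) * (den (M4 γ) τ)⁻¹ = _
      rw [e1, h1, h2]; rfl
    have := hF.2.1 _ (M4_lev h) τ ((H2_iff τ).2 hτ)
    rw [e1, e2, one_smul, wt, zpow_one] at this
    rw [sl_of _ _ hτ, this, symAct_smul, ← symAct_mul, smul_smul, inv_mul_cancel₀ (dn_ne _ hτ),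
      nonsing_inv_mul _ (dn_ne _ hτ).isUnit, symAct_one, one_smul]
  · rw [hF.2.2.2 τ (fun h => hτ ((H2_iff τ).1 h))]; simp [sl, hτ]

def U3 : Set (Fin 3 → ℂ) := {w | mat (w 0) (w 1) (w 2) ∈ HH}
def mt (w : Fin 3 → ℂ) : M2 := mat (w 0) (w 1) (w 2)

lemma U3_open : IsOpen U3 := by
  have : U3 = {w : Fin 3 → ℂ | 0 < (w 0).im} ∩ {w | (w 1).im ^ 2 < (w 0).im * (w 2).im} := by
    ext w; exact mat_mem
  rw [this]
  exact (isOpen_lt (by fun_prop) (by fun_prop)).inter (isOpen_lt (by fun_prop) (by fun_prop))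

/-- The package of facts used later -/
structure Fam (𝓕 : Set (M2 → Fin (j+1) → ℂ)) : Prop where
  fin : 𝓕.Finite
  sl_mem : ∀ H ∈ 𝓕, ∀ γ : GZ, sl (ι γ) H ∈ 𝓕
  zero : ∀ H ∈ 𝓕, ∀ τ, τ ∉ HH → H τ = 0
  lev : ∀ H ∈ 𝓕, ∀ γ : GZ, Lev γ → sl (ι γ) H = H
  hol : ∀ H ∈ 𝓕, ∀ i, DifferentiableOn ℂ (fun w => H (mt w) i) U3
  cusp : ∀ H ∈ 𝓕, ∀ τ₁ : ℂ, 0 < τ₁.im → ∀ i,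
    Tendsto (fun t : ℝ => H (mat τ₁ 0 (t * I)) i) atTop (𝓝 0)

lemma diff_symCoeff {W : Set (Fin 3 → ℂ)} {m : (Fin 3 → ℂ) → M2}
    (hm : ∀ i k, DifferentiableOn ℂ (fun w => m w i k) W) (l i : Fin (j+1)) :
    DifferentiableOn ℂ (fun w => symCoeff j (m w) l i) W := by
  have pw : ∀ (a b : (Fin 3 → ℂ) → ℂ), DifferentiableOn ℂ a W → DifferentiableOn ℂ b W → ∀ n k : ℕ,
      DifferentiableOn ℂ (fun w => ((Polynomial.C (a w) + Polynomial.C (b w) * Polynomial.X) ^ n).coeff k) W := by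
    intro a b ha hb n
    induction n with
    | zero => intro k; simp only [pow_zero]; fun_prop
    | succ n ih =>
      intro k
      simp only [pow_succ, mul_add, ← mul_assoc, Polynomial.coeff_add, Polynomial.coeff_mul_C]
      refine ((ih k).mul ha).add ?_
      cases k with
      | zero => simp only [Polynomial.mul_coeff_zero, Polynomial.coeff_X_zero, mul_zero]; fun_prop
      | succ k => simp only [Polynomial.coeff_mul_X, Polynomial.coeff_mul_C]; exact (ih _).mul hb
  simp only [symCoeff, Polynomial.coeff_mul]
  refine DifferentiableOn.fun_sum fun x _ => ?_
  exact (pw _ _ (hm _ _) (hm _ _) _ _).mul (pw _ _ (hm _ _) (hm _ _) _ _)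

lemma fam_of {F : M2 → Fin (j+1) → ℂ} (hF : IsSiegelCuspForm j 1 Sp4Z2 (fun _ => 1) F) :
    Fam (Set.range fun γ : GZ => sl (ι γ) F) where
  fin := by
    let key : GZ → Matrix (Fin 2 ⊕ Fin 2) (Fin 2 ⊕ Fin 2) (ZMod 2) := fun γ => γ.1.map (Int.castRingHom (ZMod 2))
    have hk : ∀ a b, key (a * b) = key a * key b := fun a b => Matrix.map_mul
    have : ∀ a b, key a = key b → sl (ι a) F = sl (ι b) F := by
      intro a b h
      have h1 : Lev (a * b⁻¹) := by
        show key _ = 1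
        have e1 : key 1 = 1 := by ext i k; simp [key, Matrix.one_apply, apply_ite]
        rw [hk, h, ← hk, mul_inv_cancel, e1]
      conv_rhs => rw [← F_lev hF h1, sl_mul, ← map_mul, inv_mul_cancel_right]
    choose! r hr using fun x : Matrix (Fin 2 ⊕ Fin 2) (Fin 2 ⊕ Fin 2) (ZMod 2) =>
      (fun h => h : (∃ γ, key γ = x) → ∃ γ, key γ = x)
    refine (Set.finite_range fun x => sl (ι (r x)) F).subset ?_
    rintro _ ⟨γ, rfl⟩
    exact ⟨key γ, this _ _ (hr _ ⟨γ, rfl⟩)⟩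
  sl_mem := by
    rintro _ ⟨γ, rfl⟩ δ
    exact ⟨γ * δ, by simp only [sl_mul, map_mul]⟩
  zero := by
    rintro _ ⟨γ, rfl⟩ τ hτ
    simp [sl, hτ]
  lev := by
    rintro _ ⟨γ, rfl⟩ δ hδ
    have : Lev (γ * δ * γ⁻¹) := by
      have hk : ∀ a b : GZ, (a*b).1.map (Int.castRingHom (ZMod 2)) =
        a.1.map (Int.castRingHom (ZMod 2)) * b.1.map (Int.castRingHom (ZMod 2)) := fun a b => Matrix.map_mul
      unfold Lev at hδ ⊢
      rw [hk, hk, hδ, mul_one, ← hk, mul_inv_cancel]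
      ext i k; simp [Matrix.one_apply, apply_ite]
    simp only
    rw [sl_mul]
    conv_rhs => rw [← F_lev hF this, sl_mul, ← map_mul, inv_mul_cancel_right, map_mul]
  hol := by
    rintro _ ⟨γ, rfl⟩ i
    have e : ∀ w ∈ U3, sl (ι γ) F (mt w) i = ((dn (ι γ) (mt w)).det)⁻¹ *
        ∑ l, symCoeff j (dn (ι γ) (mt w))⁻¹ l i * F (act (ι γ) (mt w)) l := by
      intro w hw; have hw' : mt w ∈ HH := hw
      rw [sl_of _ _ hw']; rfl
    refine DifferentiableOn.congr ?_ e
    have hmt : ∀ i k, DifferentiableOn ℂ (fun w => mt w i k) U3 := by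
      intro i k; fin_cases i <;> fin_cases k <;> simp [mt, mat] <;> fun_prop
    have hd : ∀ i k, DifferentiableOn ℂ (fun w => dn (ι γ) (mt w) i k) U3 := by
      intro i k
      simp only [dn, Matrix.add_apply, Matrix.mul_apply, Fin.sum_univ_two]
      exact (((hmt _ _).const_mul _).add ((hmt _ _).const_mul _)).add_const _
    have hdet : DifferentiableOn ℂ (fun w => ((dn (ι γ) (mt w)).det)⁻¹) U3 := by
      refine DifferentiableOn.inv ?_ fun w hw => dn_ne _ hw
      simp only [det_fin_two]
      exact ((hd _ _).mul (hd _ _)).sub ((hd _ _).mul (hd _ _))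
    have hinv : ∀ i k, DifferentiableOn ℂ (fun w => (dn (ι γ) (mt w))⁻¹ i k) U3 := by
      intro i k
      simp only [Matrix.inv_def, Matrix.smul_apply, Ring.inverse_eq_inv', smul_eq_mul]
      refine hdet.mul ?_
      simp only [adjugate_fin_two]
      fin_cases i <;> fin_cases k <;> simp <;> first | exact hd _ _ | exact (hd _ _).neg
    have hact : DifferentiableOn ℂ (fun w => act (ι γ) (mt w)) U3 := by
      refine differentiableOn_pi.2 fun i => differentiableOn_pi.2 fun k => ?_
      simp only [act, num, Matrix.mul_apply, Fin.sum_univ_two, Matrix.add_apply]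
      refine DifferentiableOn.add (DifferentiableOn.mul ?_ (hinv _ _)) (DifferentiableOn.mul ?_ (hinv _ _)) <;>
      exact (((hmt _ _).const_mul _).add ((hmt _ _).const_mul _)).add_const _
    have hFc : DifferentiableOn ℂ (fun w => F (act (ι γ) (mt w))) U3 :=
      hF.1.comp hact fun w hw => (H2_iff _).2 (act_mem _ hw)
    refine hdet.mul (DifferentiableOn.fun_sum fun l _ => ?_)
    exact (diff_symCoeff hinv l i).mul (differentiableOn_pi.1 hFc l)
  cusp := by
    rintro _ ⟨γ, rfl⟩ τ₁ h1 i
    have := (tendsto_pi_nhds.1 (hF.2.2.1 (M4 γ) (M4_mem γ) τ₁ h1)) i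
    refine this.congr' ?_
    filter_upwards [eventually_gt_atTop 0] with t ht
    have hm : mat τ₁ 0 (t * I) ∈ HH := mat_mem.2 ⟨h1, by simp; positivity⟩
    have : diagH τ₁ (t * I) = mat τ₁ 0 (t * I) := by
      funext i k; fin_cases i <;> fin_cases k <;> simp [diagH, mat]
    rw [sl_slashS _ _ hm, this]

end SS

namespace SS
open MeasureTheory UnitAddTorus

abbrev Tor := UnitAddTorus (Fin 3)
def tm : Measure Tor := Measure.pi fun _ => AddCircle.haarAddCircle
instance : IsProbabilityMeasure tm := by unfold tm; infer_instance
instance : tm.IsAddLeftInvariant := by unfold tm; infer_instance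
lemma coef_tm (f : Tor → ℂ) (n : Fin 3 → ℤ) : mFourierCoeff f n = ∫ t, mFourier (-n) t • f t ∂tm := rfl

def pr (x : Fin 3 → ℝ) : Tor := fun i => (x i : UnitAddCircle)
lemma pr_oq : IsOpenQuotientMap pr := IsOpenQuotientMap.piMap fun _ => QuotientAddGroup.isOpenQuotientMap_mk
def rep (t : Tor) : Fin 3 → ℝ := fun i => (AddCircle.equivIco 1 0 (t i)).1
lemma pr_rep (t : Tor) : pr (rep t) = t := by
  funext i
  exact (AddCircle.equivIco 1 0).symm_apply_apply (t i)

def Per {X : Type*} (p : (Fin 3 → ℝ) → X) : Prop := ∀ (x : Fin 3 → ℝ) (k : Fin 3 → ℤ), p (x + fun i => (k i : ℝ)) = p x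

lemma Per.lift {X : Type*} {p : (Fin 3 → ℝ) → X} (hp : Per p) (x : Fin 3 → ℝ) : p (rep (pr x)) = p x := by
  have h : ∀ i, ∃ k : ℤ, rep (pr x) i = x i + k := by
    intro i
    have := congrFun (pr_rep (pr x)) i
    obtain ⟨k, hk⟩ := (QuotientAddGroup.eq.1 this.symm)
    exact ⟨k, by simp at hk; linarith⟩
  choose k hk using h
  rw [← hp x k]; congr 1; funext i; exact hk i

lemma Per.cont {X Y : Type*} [TopologicalSpace Y] [TopologicalSpace X] {p : Y → (Fin 3 → ℝ) → X} (hp : ∀ y, Per (p y))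
    (hc : Continuous fun q : Y × (Fin 3 → ℝ) => p q.1 q.2) : Continuous fun q : Y × Tor => p q.1 (rep q.2) := by
  rw [← (IsOpenQuotientMap.id.prodMap pr_oq).continuous_comp_iff]
  refine hc.congr fun q => ?_
  exact ((hp _).lift q.2).symm

lemma Per.cont1 {X : Type*} [TopologicalSpace X] {p : (Fin 3 → ℝ) → X} (hp : Per p)
    (hc : Continuous p) : Continuous fun t : Tor => p (rep t) := by
  rw [← pr_oq.continuous_comp_iff]
  exact hc.congr fun q => (hp.lift q).symm

lemma Per.shift {p : (Fin 3 → ℝ) → ℂ} (hp : Per p) (a : Fin 3 → ℝ) :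
    ∫ t, p (rep t + a) ∂tm = ∫ t, p (rep t) ∂tm := by
  rw [← integral_add_right_eq_self (fun t => p (rep t)) (pr a)]
  congr 1; funext t
  have : t + pr a = pr (rep t + a) := by
    conv_lhs => rw [← pr_rep t]
    rfl
  rw [this, hp.lift]

def Cn : Set (Fin 3 → ℝ) := {y | 0 < y 0 ∧ y 1 ^ 2 < y 0 * y 2}
def wp (y x : Fin 3 → ℝ) : Fin 3 → ℂ := fun i => 2 * x i + y i * I
lemma U3_iff {w : Fin 3 → ℂ} : w ∈ U3 ↔ (fun i => (w i).im) ∈ Cn := mat_mem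
lemma wp_mem {y x : Fin 3 → ℝ} : wp y x ∈ U3 ↔ y ∈ Cn := by
  rw [U3_iff]; simp [wp]

lemma Cn_conv {y z : Fin 3 → ℝ} (hy : y ∈ Cn) (hz : z ∈ Cn) {s : ℝ} (h0 : 0 ≤ s) (h1 : s ≤ 1) :
    (fun i => y i + s * (z i - y i)) ∈ Cn := by
  obtain ⟨a1, a2⟩ := hy
  obtain ⟨b1, b2⟩ := hz
  have key : 2 * (y 1 * z 1) ≤ y 0 * z 2 + z 0 * y 2 := by
    have c1 : 0 < y 2 := by by_contra h; nlinarith [sq_nonneg (y 1)]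
    have c2 : 0 < z 2 := by by_contra h; nlinarith [sq_nonneg (z 1)]
    have : (2 * (y 1 * z 1)) ^ 2 ≤ (y 0 * z 2 + z 0 * y 2) ^ 2 := by
      have : y 1 ^ 2 * z 1 ^ 2 ≤ (y 0 * y 2) * (z 0 * z 2) := by gcongr
      nlinarith [sq_nonneg (y 0 * z 2 - z 0 * y 2)]
    exact le_of_sq_le_sq this (by positivity) |>.trans le_rfl
  rcases h0.eq_or_lt with rfl | h0
  · exact ⟨by simpa using a1, by simpa using a2⟩
  refine ⟨by nlinarith, ?_⟩
  show (y 1 + s * (z 1 - y 1)) ^ 2 < (y 0 + s * (z 0 - y 0)) * (y 2 + s * (z 2 - y 2))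
  have e1 := mul_lt_mul_of_pos_left b2 (mul_pos h0 h0)
  have e2 := mul_le_mul_of_nonneg_left a2.le (mul_nonneg (sub_nonneg.2 h1) (sub_nonneg.2 h1))
  have e3 := mul_le_mul_of_nonneg_left key (mul_nonneg h0.le (sub_nonneg.2 h1))
  nlinarith

def PerU (h : (Fin 3 → ℂ) → ℂ) : Prop := ∀ w ∈ U3, ∀ k : Fin 3 → ℤ, h (w + fun i => 2 * (k i : ℂ)) = h w

lemma wp_per {h : (Fin 3 → ℂ) → ℂ} (hp : PerU h) {y : Fin 3 → ℝ} (hy : y ∈ Cn) : Per fun x => h (wp y x) := by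
  intro x k
  show h _ = h _
  rw [← hp (wp y x) (wp_mem.2 hy) k]; congr 1; funext i; simp [wp]; ring

lemma wp_cont {h : (Fin 3 → ℂ) → ℂ} (hh : ContinuousOn h U3) {Y : Type*} [TopologicalSpace Y] {y x : Y → Fin 3 → ℝ}
    (hy : Continuous y) (hx : Continuous x) (hm : ∀ s, y s ∈ Cn) : Continuous fun s => h (wp (y s) (x s)) := by
  refine hh.comp_continuous ?_ fun s => wp_mem.2 (hm s)
  unfold wp; fun_prop

lemma cauchy {h : (Fin 3 → ℂ) → ℂ} (hh : DifferentiableOn ℂ h U3) (hp : PerU h) {y z : Fin 3 → ℝ}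
    (hy : y ∈ Cn) (hz : z ∈ Cn) : ∫ t, h (wp y (rep t)) ∂tm = ∫ t, h (wp z (rep t)) ∂tm := by
  -- clamp the parameter
  let cl : ℝ → ℝ := fun s => max 0 (min 1 s)
  have clc : Continuous cl := by fun_prop
  let ys : ℝ → Fin 3 → ℝ := fun s i => y i + cl s * (z i - y i)
  have ysm : ∀ s, ys s ∈ Cn := fun s => Cn_conv hy hz (le_max_left _ _) (max_le zero_le_one (min_le_left _ _))
  have ysc : Continuous ys := by fun_prop
  let K : ℝ → ℝ → Tor → ℂ := fun u s t => h (wp (ys s) (rep t + fun i => u / 2 * (z i - y i)))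
  have Kper : ∀ q : ℝ × ℝ, Per fun x => h (wp (ys q.2) (x + fun i => q.1 / 2 * (z i - y i))) := by
    intro q x k
    have := wp_per hp (ysm q.2) (x + fun i => q.1 / 2 * (z i - y i)) k
    simp only at this ⊢; rw [← this, add_right_comm]
  have Kc : Continuous fun q : (ℝ × ℝ) × Tor => K q.1.1 q.1.2 q.2 := by
    refine Per.cont Kper (wp_cont hh.continuousOn (ysc.comp (by fun_prop)) (by fun_prop) fun q => ysm _)
  have Kint : ∀ u s, ∫ t, K u s t ∂tm = ∫ t, h (wp (ys s) (rep t)) ∂tm := fun u s =>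
    (wp_per hp (ysm s)).shift _
  have rect : ∀ t, (∫ u in (0:ℝ)..1, K u 0 t) - (∫ u in (0:ℝ)..1, K u 1 t) + I • (∫ s in (0:ℝ)..1, K 1 s t)
      - I • (∫ s in (0:ℝ)..1, K 0 s t) = 0 := by
    intro t
    have := Complex.integral_boundary_rect_eq_zero_of_differentiableOn
      (fun ζ => h (fun i => 2 * rep t i + y i * I + ζ * (z i - y i))) 0 (1 + I) (by
        refine hh.comp (by fun_prop) ?_
        rintro ζ ⟨-, h2⟩
        simp only [zero_im, add_im, one_im, I_im, zero_add, Set.uIcc_of_le zero_le_one] at h2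
        refine U3_iff.2 ?_
        convert Cn_conv hy hz h2.1 h2.2 using 2
        simp)
    simp only [zero_re, zero_im, add_re, add_im, one_re, one_im, I_re, I_im, add_zero, zero_add] at this
    rw [← this]
    have e : ∀ (u s : ℝ) (hs : s ∈ Set.Icc (0:ℝ) 1), K u s t = h (fun i => 2 * rep t i + y i * I + (u + s * I) * (z i - y i)) := by
      intro u s hs
      have : cl s = s := by simp [cl, hs.1, hs.2]
      simp only [K, ys, this]; congr 1; funext i; simp [wp]; ring
    have m0 : (0:ℝ) ∈ Set.Icc (0:ℝ) 1 := by simp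
    have m1 : (1:ℝ) ∈ Set.Icc (0:ℝ) 1 := by simp
    congr 1
    · congr 1
      · congr 1
        · exact intervalIntegral.integral_congr fun u _ => e u 0 m0
        · exact intervalIntegral.integral_congr fun u _ => e u 1 m1
      · congr 1
        refine intervalIntegral.integral_congr fun s hs => ?_
        rw [Set.uIcc_of_le zero_le_one] at hs
        exact e 1 s hs
    · congr 1
      refine intervalIntegral.integral_congr fun s hs => ?_
      rw [Set.uIcc_of_le zero_le_one] at hs
      exact e 0 s hs
  have fub : ∀ (L : ℝ → Tor → ℂ), Continuous (fun q : ℝ × Tor => L q.1 q.2) →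
      ∫ t, (∫ u in (0:ℝ)..1, L u t) ∂tm = ∫ u in (0:ℝ)..1, (∫ t, L u t ∂tm) := by
    intro L hL
    simp only [intervalIntegral.integral_of_le zero_le_one]
    refine integral_integral_swap ?_
    have : Integrable (fun q : Tor × ℝ => L q.2 q.1) (tm.prod (volume.restrict (Set.Icc (0:ℝ) 1))) := by
      have h1 : ContinuousOn (fun q : Tor × ℝ => L q.2 q.1) (Set.univ ×ˢ Set.Icc (0:ℝ) 1) := 
        (hL.comp (continuous_snd.prodMk continuous_fst)).continuousOn
      have := h1.integrableOn_compact (μ := tm.prod volume) (isCompact_univ.prod isCompact_Icc)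
      rwa [IntegrableOn, ← Measure.prod_restrict, Measure.restrict_univ] at this
    exact this.mono_measure (Measure.prod_mono le_rfl (Measure.restrict_mono Set.Ioc_subset_Icc_self le_rfl))
  have ci : ∀ (L : ℝ → Tor → ℂ), Continuous (fun q : ℝ × Tor => L q.1 q.2) →
      Integrable (fun t => ∫ u in (0:ℝ)..1, L u t) tm := by
    intro L hL
    refine Continuous.integrable_of_hasCompactSupport ?_ (HasCompactSupport.of_compactSpace _)
    exact intervalIntegral.continuous_parametric_intervalIntegral_of_continuous' (by
      exact hL.comp (continuous_snd.prodMk continuous_fst)) _ _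
  have c1 : ∀ s, Continuous fun q : ℝ × Tor => K q.1 s q.2 := fun s => Kc.comp (by fun_prop : Continuous fun q : ℝ × Tor => (((q.1, s), q.2) : (ℝ × ℝ) × Tor))
  have c2 : ∀ u, Continuous fun q : ℝ × Tor => K u q.1 q.2 := fun u => Kc.comp (by fun_prop : Continuous fun q : ℝ × Tor => (((u, q.1), q.2) : (ℝ × ℝ) × Tor))
  have fin : ∫ t, ((∫ u in (0:ℝ)..1, K u 0 t) - (∫ u in (0:ℝ)..1, K u 1 t) + I • (∫ s in (0:ℝ)..1, K 1 s t)
      - I • (∫ s in (0:ℝ)..1, K 0 s t)) ∂tm = 0 := by simp only [rect, integral_zero]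
  have i1 := ci (fun u t => K u 0 t) (c1 0)
  have i2 := ci (fun u t => K u 1 t) (c1 1)
  have i3 := (ci (fun s t => K 1 s t) (c2 1)).smul I
  have i4 := (ci (fun s t => K 0 s t) (c2 0)).smul I
  have e0 := integral_sub (i1.sub i2 |>.add i3) i4
  have e1 := integral_add (i1.sub i2) i3
  have e2 := integral_sub i1 i2
  simp only [Pi.add_apply, Pi.sub_apply, Pi.smul_apply] at e0 e1 e2
  rw [e0, e1, e2, integral_smul, integral_smul, fub (fun u t => K u 0 t) (c1 0), fub (fun u t => K u 1 t) (c1 1), fub (fun s t => K 1 s t) (c2 1), fub (fun s t => K 0 s t) (c2 0)] at fin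
  simp only [Kint, intervalIntegral.integral_const] at fin
  have y0 : ys 0 = y := by funext i; simp [ys, cl]
  have y1 : ys 1 = z := by funext i; simp [ys, cl]
  rw [y0, y1] at fin
  simp at fin
  exact sub_eq_zero.1 fin

end SS

namespace SS
open MeasureTheory UnitAddTorus

abbrev Z3 := Fin 3 → ℤ
def ex (T : Z3) (w : Fin 3 → ℂ) : ℂ := cexp (Real.pi * I * (T 0 * w 0 + T 1 * w 1 + T 2 * w 2))
def dt (T : Z3) (y : Fin 3 → ℝ) : ℝ := T 0 * y 0 + T 1 * y 1 + T 2 * y 2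

lemma norm_ex (T : Z3) (w : Fin 3 → ℂ) : ‖ex T w‖ = Real.exp (-Real.pi * dt T fun i => (w i).im) := by
  rw [ex, norm_exp]; congr 1; simp [dt, mul_re, mul_im]

lemma ex_wp (T : Z3) (y x : Fin 3 → ℝ) : ex T (wp y x) = Real.exp (-Real.pi * dt T y) * mFourier T (pr x) := by
  simp only [mFourier, pr, ContinuousMap.coe_mk, fourier_coe_apply, Fin.prod_univ_three, ← Complex.exp_add,
    ex, wp, ofReal_exp, dt]
  congr 1
  push_cast
  linear_combination (Real.pi * (T 0 * y 0 + T 1 * y 1 + T 2 * y 2) : ℂ) * I_sq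

lemma ex_neg (T : Z3) (w) : ex (-T) w * ex T w = 1 := by
  rw [ex, ex, ← Complex.exp_add, Complex.exp_eq_one_iff]; exact ⟨0, by simp; ring⟩

lemma ex_per (T : Z3) (w) (k : Fin 3 → ℤ) : ex T (w + fun i => 2 * (k i : ℂ)) = ex T w := by
  rw [ex, ex, Complex.exp_eq_exp_iff_exists_int]
  exact ⟨T 0 * k 0 + T 1 * k 1 + T 2 * k 2, by simp; ring⟩

def z3e : Z3 ≃ ℤ × ℤ × ℤ := ⟨fun T => (T 0, T 1, T 2), fun p => ![p.1, p.2.1, p.2.2],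
  fun T => by funext i; fin_cases i <;> rfl, fun p => rfl⟩

lemma sum_exp {c : ℝ} (hc : 0 < c) : Summable fun T : Z3 => Real.exp (-c * (|(T 0 : ℝ)| + |(T 1 : ℝ)| + |(T 2 : ℝ)|)) := by
  have h0 : Summable fun n : ℕ => Real.exp (-c * n) := by
    simpa [mul_comm] using Real.summable_exp_nat_mul_iff.2 (neg_lt_zero.2 hc)
  have h1 : Summable fun n : ℤ => Real.exp (-c * |(n:ℝ)|) := by
    refine Summable.of_nat_of_neg ?_ ?_ <;> simpa using h0
  have h2 := h1.mul_of_nonneg (h1.mul_of_nonneg h1 (fun _ => by positivity) (fun _ => by positivity))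
    (fun _ => by positivity) (fun _ => by positivity)
  refine ((z3e.summable_iff).2 h2).congr fun T => ?_
  simp only [Function.comp, ← Real.exp_add]; congr 1; show -c * |(T 0 : ℝ)| + (-c * |(T 1 : ℝ)| + -c * |(T 2 : ℝ)|) = _; ring

lemma norm_mF (T : Z3) (t : Tor) : ‖mFourier T t‖ = 1 := by
  simp only [mFourier, fourier_apply, ContinuousMap.coe_mk, norm_prod, Circle.norm_coe, Finset.prod_const_one]

lemma Cn_open : IsOpen Cn := by
  have : Cn = {y | 0 < y 0} ∩ {y | y 1 ^ 2 < y 0 * y 2} := rfl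
  rw [this]
  exact (isOpen_lt (by fun_prop) (by fun_prop)).inter (isOpen_lt (by fun_prop) (by fun_prop))

lemma four_ex {f : (Fin 3 → ℂ) → ℂ} (hf : DifferentiableOn ℂ f U3) (hp : PerU f) :
    ∃ A : Z3 → ℂ, ∀ w ∈ U3, HasSum (fun T => A T * ex T w) (f w) := by
  have hy0 : (![1, 0, 1] : Fin 3 → ℝ) ∈ Cn := by simp [Cn]
  let A : Z3 → ℂ := fun T => ∫ t, ex (-T) (wp ![1,0,1] (rep t)) * f (wp ![1,0,1] (rep t)) ∂tm
  have hc : ∀ y ∈ Cn, Continuous fun t => f (wp y (rep t)) := fun y hy =>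
    (wp_per hp hy).cont1 (wp_cont hf.continuousOn continuous_const continuous_id fun _ => hy)
  have hA : ∀ y ∈ Cn, ∀ T, mFourierCoeff (fun t => f (wp y (rep t))) T = Real.exp (-Real.pi * dt T y) * A T := by
    intro y hy T
    have h1 : A T = ∫ t, ex (-T) (wp y (rep t)) * f (wp y (rep t)) ∂tm := by
      refine cauchy (h := fun w => ex (-T) w * f w) (DifferentiableOn.mul (by unfold ex; fun_prop) hf) ?_ hy0 hy
      intro w hw k
      show ex _ _ * f _ = _
      rw [ex_per, hp w hw]
    rw [coef_tm, h1, ← integral_const_mul]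
    congr 1; funext t
    have h2 := ex_wp (-T) y (rep t)
    rw [pr_rep] at h2
    have h3 : dt (-T) y = - dt T y := by simp [dt]; ring
    rw [h2, h3, smul_eq_mul, ← mul_assoc, ← mul_assoc, ← ofReal_mul, ← Real.exp_add]; simp
  have hbd : ∀ y, ∃ C : ℝ, y ∈ Cn → ∀ T, ‖A T‖ * Real.exp (-Real.pi * dt T y) ≤ C := by
    intro y
    refine ⟨∫ t, ‖f (wp y (rep t))‖ ∂tm, fun hy T => ?_⟩
    have := congrArg norm (hA y hy T)
    rw [norm_mul, norm_real, Real.norm_of_nonneg (Real.exp_pos _).le, mul_comm] at this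
    rw [← this, coef_tm]
    refine (norm_integral_le_integral_norm _).trans (le_of_eq ?_)
    congr 1; funext t
    rw [norm_smul]
    rw [norm_mF, one_mul]
  choose C hC using hbd
  refine ⟨A, fun w hw => ?_⟩
  have hy := U3_iff.1 hw
  set y : Fin 3 → ℝ := fun i => (w i).im with hyd
  obtain ⟨δ, hδ, hball⟩ := Metric.isOpen_iff.1 Cn_open y hy
  let sg : (Fin 3 → Bool) → Fin 3 → ℝ := fun σ i => y i + (if σ i then δ/2 else -(δ/2))
  have hsg : ∀ σ, sg σ ∈ Cn := fun σ => hball (by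
    rw [Metric.mem_ball, dist_pi_lt_iff hδ]
    intro i; simp only [sg, Real.dist_eq, add_sub_cancel_left]
    split_ifs <;> simp only [abs_neg, abs_of_pos (half_pos hδ)] <;> linarith)
  have hb : ∀ T, ‖A T‖ * Real.exp (-Real.pi * dt T y) ≤ (∑ σ, |C (sg σ)|) *
      Real.exp (-(Real.pi * (δ/2)) * (|(T 0 : ℝ)| + |(T 1 : ℝ)| + |(T 2 : ℝ)|)) := by
    intro T
    let σ : Fin 3 → Bool := fun i => decide ((T i : ℝ) < 0)
    have h1 := hC (sg σ) (hsg σ) T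
    have h2 : C (sg σ) ≤ ∑ σ, |C (sg σ)| := (le_abs_self _).trans
      (Finset.single_le_sum (f := fun σ => |C (sg σ)|) (fun _ _ => abs_nonneg _) (Finset.mem_univ σ))
    have h4 : ∀ i, (T i : ℝ) * sg σ i = T i * y i - δ/2 * |(T i : ℝ)| := by
      intro i; by_cases h : (T i : ℝ) < 0
      · simp only [sg, σ, h, decide_true, if_true, abs_of_neg h]; ring
      · simp only [sg, σ, h, decide_false, abs_of_nonneg (not_lt.1 h)]; simp; ring
    have h3 : -Real.pi * dt T y = -Real.pi * dt T (sg σ) +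
      (-(Real.pi * (δ/2)) * (|(T 0 : ℝ)| + |(T 1 : ℝ)| + |(T 2 : ℝ)|)) := by
      rw [dt, dt, h4, h4, h4]; ring
    rw [h3, Real.exp_add, ← mul_assoc]
    exact mul_le_mul_of_nonneg_right (h1.trans h2) (Real.exp_pos _).le
  have hs : Summable (mFourierCoeff fun t => f (wp y (rep t))) := by
    refine Summable.of_norm_bounded ((sum_exp (c := Real.pi * (δ/2)) (by positivity)).mul_left (∑ σ, |C (sg σ)|)) fun T => ?_
    rw [hA y hy T, norm_mul, norm_real, Real.norm_of_nonneg (Real.exp_pos _).le, mul_comm]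
    exact hb T
  have hwx : w = wp y (fun i => (w i).re / 2) := by
    funext i; apply Complex.ext <;> simp [wp, hyd]; ring
  have := hasSum_mFourier_series_apply_of_summable (f := ⟨_, hc y hy⟩) hs (pr fun i => (w i).re / 2)
  simp only [ContinuousMap.coe_mk] at this
  rw [(wp_per hp hy).lift, ← hwx] at this
  refine this.congr_fun fun T => ?_
  rw [hA y hy T, hwx, ex_wp, ← hwx, smul_eq_mul]; ring

lemma coef_F (T S : Z3) : mFourierCoeff (mFourier T) S = if S = T then 1 else 0 := by
  have := mFourierBasis_repr (d := Fin 3) (mFourierLp 2 T) S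
  have e : mFourierBasis (d := Fin 3) T = mFourierLp 2 T := by rw [coe_mFourierBasis]
  rw [← e, HilbertBasis.repr_self, lp.single_apply, e] at this
  rw [← mFourierCoeff_toLp]
  refine Eq.trans this.symm ?_
  simp [Pi.single_apply]

lemma four_uniq {A : Z3 → ℂ} (h : ∀ w ∈ U3, HasSum (fun T => A T * ex T w) 0) : A = 0 := by
  have hy0 : (![1, 0, 1] : Fin 3 → ℝ) ∈ Cn := by simp [Cn]
  let b : Z3 → ℂ := fun T => A T * Real.exp (-Real.pi * dt T ![1,0,1])
  have h1 : ∀ t : Tor, HasSum (fun T => b T * mFourier T t) 0 := by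
    intro t
    have := h _ (wp_mem (x := rep t).2 hy0)
    simp only [ex_wp, pr_rep, ← mul_assoc] at this
    exact this
  have hs : Summable fun T => ‖b T‖ := by
    have := (h1 0).summable.norm
    refine this.congr fun T => ?_
    have : mFourier T (0 : Tor) = 1 := by simp [mFourier]
    rw [this, mul_one]
  funext S
  have h2 := hasSum_integral_of_summable_integral_norm (μ := tm) (F := fun T t => mFourier (-S) t • (b T * mFourier T t)) ?_ ?_
  · have e1 : (fun t => ∑' T, mFourier (-S) t • (b T * mFourier T t)) = fun _ => 0 := by
      funext t
      exact ((h1 t).const_smul (mFourier (-S) t)).tsum_eq.trans (smul_zero _)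
    rw [e1, integral_zero] at h2
    have e2 : ∀ T, ∫ t, mFourier (-S) t • (b T * mFourier T t) ∂tm = if T = S then b T else 0 := by
      intro T
      have := coef_F T S
      rw [coef_tm] at this
      simp only [smul_eq_mul, mul_left_comm _ (b T)] at this ⊢
      rw [integral_const_mul, this]; simp [eq_comm]
    simp only [e2] at h2
    have := (hasSum_ite_eq S (b S)).unique (h2.congr_fun fun T => by split_ifs with h <;> simp [h])
    have := mul_eq_zero.1 this
    exact this.resolve_right (by exact_mod_cast (Real.exp_pos _).ne')
  · intro T
    refine Continuous.integrable_of_hasCompactSupport ?_ (HasCompactSupport.of_compactSpace _)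
    fun_prop
  · refine hs.congr fun T => ?_
    simp [norm_mF]

end SS

namespace SS
variable {j : ℕ}

def trZ (a b c : ℤ) : GZ := mkZ 1 !![a, b; b, c] 0 1 (by
  refine ⟨by simp, ?_, by simp⟩; ext i k; fin_cases i <;> fin_cases k <;> simp)
def lvZ (p q r s : ℤ) (h : p * s - q * r = 1) : GZ := mkZ !![p, q; r, s] 0 0 !![s, -r; -q, p] (by
  refine ⟨by simp, by simp, ?_⟩
  ext i k; fin_cases i <;> fin_cases k <;> simp [Matrix.mul_apply, Fin.sum_univ_two] <;> linarith)

lemma cz_one : cz 1 = 1 := by ext i k; simp [cz, Matrix.one_apply, apply_ite]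
lemma cz_zero : cz 0 = 0 := by ext i k; simp [cz]

lemma sl_tr (a b c : ℤ) (H : M2 → Fin (j+1) → ℂ) {τ : M2} (hτ : τ ∈ HH) :
    sl (ι (trZ a b c)) H τ = H (τ + cz !![a, b; b, c]) := by
  have h := mkZ_dn (1 : Matrix (Fin 2) (Fin 2) ℤ) !![a, b; b, c] 0 1 (by
    refine ⟨by simp, ?_, by simp⟩; ext i k; fin_cases i <;> fin_cases k <;> simp) τ
  have hd : dn (ι (trZ a b c)) τ = 1 := h.2.trans (by rw [cz_zero, cz_one, zero_mul, zero_add])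
  have hn : num (ι (trZ a b c)) τ = τ + cz !![a, b; b, c] := h.1.trans (by rw [cz_one, one_mul])
  rw [sl_of _ _ hτ, act, hd, hn]; simp [symAct_one]

def uw (p q r s : ℤ) (w : Fin 3 → ℂ) : Fin 3 → ℂ :=
  ![p^2 * w 0 + 2*p*q*w 1 + q^2 * w 2, p*r*w 0 + (p*s+q*r)*w 1 + q*s*w 2, r^2*w 0 + 2*r*s*w 1 + s^2*w 2]

lemma lv_dn (p q r s : ℤ) (h) (w : Fin 3 → ℂ) :
    dn (ι (lvZ p q r s h)) (mt w) = !![(s:ℂ), -r; -q, p] ∧ act (ι (lvZ p q r s h)) (mt w) = mt (uw p q r s w) ∧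
    (dn (ι (lvZ p q r s h)) (mt w)).det = 1 ∧ (dn (ι (lvZ p q r s h)) (mt w))⁻¹ = !![(p:ℂ), r; q, s] := by
  have hc : (p:ℂ) * s - q * r = 1 := by exact_mod_cast h
  obtain ⟨h1, h2⟩ := mkZ_dn !![p, q; r, s] 0 0 !![s, -r; -q, p] (by
    refine ⟨by simp, by simp, ?_⟩
    ext i k; fin_cases i <;> fin_cases k <;> simp [Matrix.mul_apply, Fin.sum_univ_two] <;> linarith) (mt w)
  have hd : dn (ι (lvZ p q r s h)) (mt w) = !![(s:ℂ), -r; -q, p] := h2.trans (by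
    ext i k; fin_cases i <;> fin_cases k <;> simp [cz])
  have hi : (!![(s:ℂ), -r; -q, p])⁻¹ = !![(p:ℂ), r; q, s] := by
    apply Matrix.inv_eq_right_inv
    ext i k; fin_cases i <;> fin_cases k <;> simp [Matrix.mul_apply, Fin.sum_univ_two] <;> first | linear_combination hc | ring
  refine ⟨hd, ?_, by rw [hd, det_fin_two_of]; linear_combination hc, by rw [hd, hi]⟩
  rw [act, hd, hi]
  have hn : num (ι (lvZ p q r s h)) (mt w) = !![(p:ℂ), q; r, s] * mt w := h1.trans (by
    have : cz !![p, q; r, s] = !![(p:ℂ), q; r, s] := by ext i k; fin_cases i <;> fin_cases k <;> simp [cz]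
    rw [this, cz_zero, add_zero])
  rw [hn]
  ext i k; fin_cases i <;> fin_cases k <;> simp [mt, mat, uw, Matrix.mul_apply, Fin.sum_univ_two] <;> ring

lemma sl_lv (p q r s : ℤ) (h) (H : M2 → Fin (j+1) → ℂ) {w : Fin 3 → ℂ} (hw : w ∈ U3) (x y : ℂ) :
    hat 0 0 (sl (ι (lvZ p q r s h)) H (mt w)) x y = hat 0 0 (H (mt (uw p q r s w))) (p*x+q*y) (r*x+s*y) := by
  obtain ⟨h1, h2, h3, h4⟩ := lv_dn p q r s h w
  rw [hat_sl _ _ (show mt w ∈ HH from hw), h2, h3, h4]; simp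

lemma uw_mem (p q r s : ℤ) (h : p * s - q * r = 1) {w : Fin 3 → ℂ} (hw : w ∈ U3) : uw p q r s w ∈ U3 := by
  have := act_mem (ι (lvZ p q r s h)) (show mt w ∈ HH from hw)
  rw [(lv_dn p q r s h w).2.1] at this; exact this

lemma lev_tr (a b c : ℤ) : Lev (trZ (2*a) (2*b) (2*c)) := by
  have h2 : (2 : ZMod 2) = 0 := rfl
  refine mkZ_lev _ _ _ _ _ ?_ ?_ ?_ ?_ <;> ext i k <;> fin_cases i <;> fin_cases k <;>
    simp [Matrix.one_apply, h2]
lemma lev_lv (k : ℤ) (h) : Lev (lvZ 1 0 (2*k) 1 h) := by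
  have h2 : (2 : ZMod 2) = 0 := rfl
  refine mkZ_lev _ _ _ _ _ ?_ ?_ ?_ ?_ <;> ext i k <;> fin_cases i <;> fin_cases k <;>
    simp [Matrix.one_apply, h2]

def Four (A : Z3 → Fin (j+1) → ℂ) (H : M2 → Fin (j+1) → ℂ) : Prop :=
  ∀ w ∈ U3, ∀ i, HasSum (fun T => A T i * ex T w) (H (mt w) i)

lemma Fam.four {𝓕 : Set (M2 → Fin (j+1) → ℂ)} (h : Fam 𝓕) {H} (hH : H ∈ 𝓕) : ∃ A, Four A H := by
  have : ∀ i, ∃ A : Z3 → ℂ, ∀ w ∈ U3, HasSum (fun T => A T * ex T w) (H (mt w) i) := fun i => by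
    refine four_ex (h.hol H hH i) fun w hw k => ?_
    show H _ i = H _ i
    rw [← congrFun (h.lev H hH _ (lev_tr (k 0) (k 1) (k 2))) (mt w), sl_tr _ _ _ _ (show mt w ∈ HH from hw)]
    congr 2; ext i l; fin_cases i <;> fin_cases l <;> simp [mt, mat, cz]
  choose A hA using this
  exact ⟨fun T i => A i T, fun w hw i => hA i w hw⟩

lemma Four.hat {A : Z3 → Fin (j+1) → ℂ} {H : M2 → Fin (j+1) → ℂ} (h : Four A H) (a b : ℕ) (x y : ℂ) {w} (hw : w ∈ U3) :
    HasSum (fun T => hat a b (A T) x y * ex T w) (hat a b (H (mt w)) x y) := by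
  unfold SS.hat
  simp only [Finset.sum_mul]
  refine hasSum_sum fun i _ => ?_
  refine (((h w hw i).mul_right _).mul_right _).congr_fun fun T => ?_
  ring

def Tu (p q r s : ℤ) (T : Z3) : Z3 :=
  ![T 0 * p^2 + T 1 * (p*r) + T 2 * r^2, 2 * T 0 * p*q + T 1 * (p*s+q*r) + 2*T 2*r*s, T 0 * q^2 + T 1*(q*s) + T 2 * s^2]
lemma Tu_ex (p q r s : ℤ) (T : Z3) (w) : ex T (uw p q r s w) = ex (Tu p q r s T) w := by
  unfold ex uw Tu; congr 1; simp; ring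
lemma Tu_Tu {p q r s : ℤ} (h : p * s - q * r = 1) (T : Z3) : Tu p q r s (Tu s (-q) (-r) p T) = T := by
  have e : p * s = 1 + q * r := by linarith
  funext i; fin_cases i <;> simp [Tu]
  · linear_combination (T 0 * (p*s-q*r+1)) * h
  · linear_combination (T 1 * (p*s-q*r+1)) * h
  · linear_combination (T 2 * (p*s-q*r+1)) * h
def TuE (p q r s : ℤ) (h : p * s - q * r = 1) : Z3 ≃ Z3 := ⟨Tu p q r s, Tu s (-q) (-r) p,
  fun T => by simpa using Tu_Tu (p := s) (q := -q) (r := -r) (s := p) (by linarith) T, fun T => Tu_Tu h T⟩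

lemma coef_lv {A A' : Z3 → Fin (j+1) → ℂ} {H : M2 → Fin (j+1) → ℂ} {p q r s : ℤ} (h : p * s - q * r = 1)
    (hA : Four A H) (hA' : Four A' (sl (ι (lvZ p q r s h)) H)) (T : Z3) (x y : ℂ) :
    hat 0 0 (A' (Tu p q r s T)) x y = hat 0 0 (A T) (p*x+q*y) (r*x+s*y) := by
  have : (fun T => hat 0 0 (A' T) x y - hat 0 0 (A ((TuE p q r s h).symm T)) (p*x+q*y) (r*x+s*y)) = 0 := by
    refine four_uniq fun w hw => ?_
    have h1 := hA'.hat 0 0 x y hw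
    have h2 := hA.hat 0 0 (p*x+q*y) (r*x+s*y) (uw_mem p q r s h hw)
    rw [← (TuE p q r s h).symm.hasSum_iff] at h2
    rw [sl_lv _ _ _ _ _ _ hw] at h1
    have h3 := h1.sub h2
    rw [sub_self] at h3
    refine h3.congr_fun fun T => ?_
    simp only [Function.comp, Tu_ex]
    have : Tu p q r s ((TuE p q r s h).symm T) = T := (TuE p q r s h).apply_symm_apply T
    rw [this]; ring
  have := congrFun this (TuE p q r s h T)
  simp only [Equiv.symm_apply_apply] at this
  exact sub_eq_zero.1 this

end SS

namespace SS
variable {j : ℕ}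

lemma hat_bd (a b : ℕ) : ∃ K : ℝ, 0 ≤ K ∧ ∀ (v : Fin (j+1) → ℂ) (s t : ℂ),
    ‖hat a b v s t‖ ≤ K * (∑ i, ‖v i‖) * (1 + ‖s‖ + ‖t‖) ^ j := by
  refine ⟨∑ i : Fin (j+1), (((j - (i:ℕ)).descFactorial a : ℝ) * ((i:ℕ).descFactorial b : ℝ)), by positivity, fun v s t => ?_⟩
  unfold hat
  refine (norm_sum_le _ _).trans ?_
  rw [Finset.sum_mul_sum, Finset.sum_mul]
  refine Finset.sum_le_sum fun i _ => ?_
  have h1 : ‖s‖ ^ (j - (i:ℕ) - a) * ‖t‖ ^ ((i:ℕ) - b) ≤ (1 + ‖s‖ + ‖t‖) ^ j := by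
    have e : (1:ℝ) ≤ 1 + ‖s‖ + ‖t‖ := by linarith [norm_nonneg s, norm_nonneg t]
    calc _ ≤ (1 + ‖s‖ + ‖t‖) ^ (j - (i:ℕ) - a) * (1 + ‖s‖ + ‖t‖) ^ ((i:ℕ) - b) := by
          gcongr <;> linarith [norm_nonneg s, norm_nonneg t]
      _ = (1 + ‖s‖ + ‖t‖) ^ ((j - (i:ℕ) - a) + ((i:ℕ) - b)) := by rw [pow_add]
      _ ≤ _ := pow_le_pow_right₀ e (by omega)
  have h2 : ‖v i‖ ≤ ∑ i, ‖v i‖ := Finset.single_le_sum (f := fun i => ‖v i‖) (fun _ _ => norm_nonneg _) (Finset.mem_univ i)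
  simp only [norm_mul, norm_pow, Complex.norm_natCast]
  rw [← Finset.mul_sum, mul_comm ‖v i‖]
  gcongr

lemma K1 {𝓕 : Set (M2 → Fin (j+1) → ℂ)} (hF : Fam 𝓕) {H} (hH : H ∈ 𝓕) {A} (hA : Four A H) {T : Z3}
    (hT : T 2 < 0 ∨ (T 2 = 0 ∧ T 1 ≠ 0)) : A T = 0 := by
  have hw : (![I, 0, I] : Fin 3 → ℂ) ∈ U3 := U3_iff.2 (by simp [Cn])
  have hex : ∀ S, ‖ex S ![I,0,I]‖ = Real.exp (-Real.pi * (S 0 + S 2)) := fun S => by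
    rw [norm_ex]; congr 1; simp [dt]
  have hC : ∃ C : ℝ, 0 ≤ C ∧ ∀ S, ∑ i, ‖A S i‖ ≤ C * Real.exp (Real.pi * (S 0 + S 2)) := by
    refine ⟨∑ i, ∑' S, ‖A S i * ex S ![I,0,I]‖, by positivity, fun S => ?_⟩
    rw [Finset.sum_mul]
    refine Finset.sum_le_sum fun i _ => ?_
    have := (hA _ hw i).summable.norm.le_tsum S fun _ _ => norm_nonneg _
    rw [norm_mul, hex] at this
    calc ‖A S i‖ = ‖A S i‖ * Real.exp (-Real.pi * (S 0 + S 2)) * Real.exp (Real.pi * (S 0 + S 2)) := by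
          rw [mul_assoc, ← Real.exp_add]; simp
      _ ≤ _ := by gcongr
  obtain ⟨C, hC0, hC⟩ := hC
  obtain ⟨K, hK0, hK⟩ := hat_bd (j := j) 0 0
  obtain ⟨ε, hε1, hε2⟩ : ∃ ε : ℤ, |ε| = 1 ∧ ∀ k : ℕ, T 1 * (2 * (ε * k)) + T 2 * (2 * (ε * k)) ^ 2 ≤ -(2 * k) := by
    have hsq : ∀ k : ℕ, (k:ℤ) ≤ k ^ 2 := fun k => by exact_mod_cast Nat.le_self_pow two_ne_zero k
    rcases le_or_gt (T 1) 0 with h | h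
    · refine ⟨1, rfl, fun k => ?_⟩
      have := hsq k
      rcases hT with hT | ⟨hT, h0⟩
      · nlinarith [mul_nonneg (neg_nonneg.2 h) (Int.natCast_nonneg k), mul_le_mul_of_nonneg_right (Int.le_sub_one_of_lt hT) (sq_nonneg (k:ℤ))]
      · rw [hT]; nlinarith [mul_le_mul_of_nonneg_right (Int.le_sub_one_of_lt (lt_of_le_of_ne h h0)) (Int.natCast_nonneg k)]
    · refine ⟨-1, rfl, fun k => ?_⟩
      have := hsq k
      rcases hT with hT | ⟨hT, h0⟩
      · nlinarith [mul_nonneg h.le (Int.natCast_nonneg k), mul_le_mul_of_nonneg_right (Int.le_sub_one_of_lt hT) (sq_nonneg (k:ℤ))]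
      · rw [hT]; nlinarith [mul_le_mul_of_nonneg_right (Int.add_one_le_iff.2 h) (Int.natCast_nonneg k)]
  refine hat_inj fun x y => ?_
  rw [hat_zero]
  have key : ∀ k : ℕ, ‖hat 0 0 (A T) x y‖ ≤ (K * C * Real.exp (Real.pi * (T 0 + T 2)) * (1 + ‖x‖ + ‖y‖) ^ j * Real.exp 1) *
      ((1 + 2 * (k:ℝ)) ^ j * Real.exp (-(1 + 2 * (k:ℝ)))) := by
    intro k
    have h1 : (1:ℤ) * 1 - 0 * (2 * (ε * k)) = 1 := by ring
    have hl := hF.lev H hH _ (lev_lv (ε * k) h1)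
    have h2 := coef_lv h1 hA (by rw [hl]; exact hA) T x (y - 2 * (ε * k) * x)
    push_cast at h2
    rw [show (1:ℂ) * x + 0 * (y - 2 * (ε * k) * x) = x by ring,
      show 2 * ((ε:ℂ) * k) * x + 1 * (y - 2 * (ε * k) * x) = y by ring] at h2
    rw [← h2]
    refine (hK _ _ _).trans ?_
    have h3 : ∑ i, ‖A (Tu 1 0 (2 * (ε * k)) 1 T) i‖ ≤ C * Real.exp (Real.pi * (T 0 + T 2)) * Real.exp (-(2 * (k:ℝ))) := by
      refine (hC _).trans ?_
      rw [mul_assoc, ← Real.exp_add]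
      gcongr
      have e1 : (((Tu 1 0 (2 * (ε * k)) 1 T) 0 : ℤ) : ℝ) + (((Tu 1 0 (2 * (ε * k)) 1 T) 2 : ℤ) : ℝ) ≤ T 0 + T 2 - 2 * k := by
        have := hε2 k
        have : (Tu 1 0 (2 * (ε * k)) 1 T) 0 + (Tu 1 0 (2 * (ε * k)) 1 T) 2 ≤ T 0 + T 2 - 2 * k := by
          simp [Tu]; linarith
        exact_mod_cast this
      have e2 := Real.pi_gt_three
      nlinarith [Nat.cast_nonneg (α := ℝ) k]
    have h4 : 1 + ‖x‖ + ‖y - 2 * (ε * k) * x‖ ≤ (1 + ‖x‖ + ‖y‖) * (1 + 2 * k) := by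
      have hεr : |(ε:ℝ)| = 1 := by exact_mod_cast hε1
      have := norm_sub_le y (2 * (ε * k) * x)
      simp [hεr] at this
      nlinarith [norm_nonneg x, norm_nonneg y, Nat.cast_nonneg (α := ℝ) k, mul_nonneg (norm_nonneg y) (Nat.cast_nonneg (α := ℝ) k)]
    calc _ ≤ K * (C * Real.exp (Real.pi * (T 0 + T 2)) * Real.exp (-(2 * (k:ℝ)))) * ((1 + ‖x‖ + ‖y‖) * (1 + 2 * k)) ^ j := by
          gcongr
      _ = _ := by
        rw [mul_pow, show -(2 * (k:ℝ)) = 1 + (-(1 + 2 * k)) by ring, Real.exp_add]; ring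
  have lim : Tendsto (fun k : ℕ => (K * C * Real.exp (Real.pi * (T 0 + T 2)) * (1 + ‖x‖ + ‖y‖) ^ j * Real.exp 1) *
      ((1 + 2 * (k:ℝ)) ^ j * Real.exp (-(1 + 2 * (k:ℝ))))) atTop (𝓝 0) := by
    rw [← mul_zero (K * C * Real.exp (Real.pi * (T 0 + T 2)) * (1 + ‖x‖ + ‖y‖) ^ j * Real.exp 1)]
    refine Tendsto.const_mul _ ((Real.tendsto_pow_mul_exp_neg_atTop_nhds_zero j).comp (f := fun k : ℕ => 1 + 2 * (k:ℝ)) ?_)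
    exact tendsto_atTop_add_const_left _ _ (tendsto_natCast_atTop_atTop.const_mul_atTop two_pos)
  exact norm_le_zero_iff.1 (ge_of_tendsto' lim key)

lemma K2 {𝓕 : Set (M2 → Fin (j+1) → ℂ)} (hF : Fam 𝓕) {H} (hH : H ∈ 𝓕) {A} (hA : Four A H) {T : Z3}
    (hT : T 2 ≤ 0) : A T = 0 := by
  by_cases h : T 2 < 0 ∨ (T 2 = 0 ∧ T 1 ≠ 0)
  · exact K1 hF hH hA h
  push Not at h
  have hT2 : T 2 = 0 := le_antisymm hT h.1
  have hT1 := h.2 hT2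
  funext i
  have : (fun T : Z3 => if T 1 = 0 ∧ T 2 = 0 then A T i else 0) = 0 := by
    refine four_uniq fun w hw => ?_
    have him : 0 < (w 0).im := (U3_iff.1 hw).1
    have hm : ∀ t : ℝ, 0 < t → (![w 0, 0, t * I] : Fin 3 → ℂ) ∈ U3 := fun t ht => U3_iff.2 (by simp [Cn]; exact ⟨him, by positivity⟩)
    have hn : ∀ (t : ℝ) T, ‖A T i * ex T ![w 0, 0, t * I]‖ = ‖A T i‖ * Real.exp (-Real.pi * (T 0 * (w 0).im + T 2 * t)) := by
      intro t T; rw [norm_mul, norm_ex]; simp [dt]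
    have hs := (hA _ (hm 1 one_pos) i).summable.norm
    have hbd : ∀ t : ℝ, 1 ≤ t → ∀ T, ‖A T i * ex T ![w 0, 0, t * I]‖ ≤ ‖A T i * ex T ![w 0, 0, (1:ℝ) * I]‖ := by
      intro t ht T
      rcases lt_or_ge (T 2) 0 with h | h
      · rw [K1 hF hH hA (Or.inl h)]; simp
      rw [hn, hn]
      have : (0:ℝ) ≤ T 2 := by exact_mod_cast h
      gcongr ‖A T i‖ * Real.exp ?_
      nlinarith [Real.pi_pos, mul_nonneg Real.pi_pos.le (mul_nonneg this (sub_nonneg.2 ht))]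
    have hlim := tendsto_tsum_of_dominated_convergence (𝓕 := atTop) (f := fun (t : ℝ) T => A T i * ex T ![w 0, 0, t * I])
      (g := fun T => (if T 1 = 0 ∧ T 2 = 0 then A T i else 0) * ex T w) hs ?_ ?_
    · have h0 := hF.cusp H hH (w 0) him i
      have e : (fun t : ℝ => ∑' T, A T i * ex T ![w 0, 0, t * I]) =ᶠ[atTop] fun t => H (mat (w 0) 0 (t * I)) i := by
        filter_upwards [eventually_gt_atTop 0] with t ht
        exact (hA _ (hm t ht) i).tsum_eq
      have h1 := tendsto_nhds_unique (hlim.congr' e) h0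
      have hg : Summable (fun T : Z3 => (if T 1 = 0 ∧ T 2 = 0 then A T i else 0) * ex T w) := by
        refine Summable.of_norm_bounded hs fun T => ?_
        split_ifs with h
        · rw [hn, norm_mul, norm_ex]; simp [dt, h]
        · simp; positivity
      exact (hg.hasSum_iff).2 h1
    · intro T
      rcases lt_trichotomy (T 2) 0 with h | h | h
      · simp only [K1 hF hH hA (Or.inl h)]; simp
      · by_cases h1 : T 1 = 0
        · simp only [h, h1, and_self, if_true]
          refine tendsto_const_nhds.congr fun t => ?_
          simp [ex, h, h1]
        · simp only [K1 hF hH hA (Or.inr ⟨h, h1⟩)]; simp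
      · rw [if_neg (by omega), zero_mul, tendsto_zero_iff_norm_tendsto_zero]
        simp only [hn]
        rw [← mul_zero ‖A T i‖]
        refine Tendsto.const_mul _ (Real.tendsto_exp_atBot.comp ?_)
        have : (0:ℝ) < T 2 := by exact_mod_cast h
        exact (tendsto_atTop_add_const_left _ _ (tendsto_id.const_mul_atTop this)).const_mul_atTop_of_neg (neg_lt_zero.2 Real.pi_pos)
    · filter_upwards [eventually_ge_atTop 1] with t ht T using hbd t ht T
  have := congrFun this T
  simpa [hT1, hT2] using this

def Pos (T : Z3) : Prop := 0 < T 0 ∧ 0 < T 2 ∧ T 1 ^ 2 < 4 * T 0 * T 2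

lemma K3 {𝓕 : Set (M2 → Fin (j+1) → ℂ)} (hF : Fam 𝓕) {H} (hH : H ∈ 𝓕) {A} (hA : Four A H) {T : Z3}
    (hT : A T ≠ 0) (q s : ℤ) (hqs : IsCoprime q s) : 0 < T 0 * q^2 + T 1*(q*s) + T 2 * s^2 := by
  obtain ⟨a, b, h⟩ := hqs
  have h' : b * s - q * (-a) = 1 := by linarith
  obtain ⟨A', hA'⟩ := hF.four (hF.sl_mem H hH (lvZ b q (-a) s h'))
  by_contra hc
  have h0 : A' (Tu b q (-a) s T) = 0 := K2 hF (hF.sl_mem H hH _) hA' (by simpa [Tu] using hc)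
  apply hT
  refine hat_inj fun x y => ?_
  have := coef_lv h' hA hA' T (s * x - q * y) (a * x + b * y)
  rw [h0, hat_zero] at this
  have hc' : (a:ℂ) * q + b * s = 1 := by exact_mod_cast h
  push_cast at this
  rw [show (b:ℂ) * (s * x - q * y) + q * (a * x + b * y) = x by linear_combination x * hc',
    show -(a:ℂ) * (s * x - q * y) + s * (a * x + b * y) = y by linear_combination y * hc'] at this
  rw [← this, hat_zero]

lemma K4 {𝓕 : Set (M2 → Fin (j+1) → ℂ)} (hF : Fam 𝓕) {H} (hH : H ∈ 𝓕) {A} (hA : Four A H) {T : Z3}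
    (hT : A T ≠ 0) : Pos T := by
  have h0 : 0 < T 0 := by simpa using K3 hF hH hA hT 1 0 isCoprime_one_left
  have h2 : 0 < T 2 := by simpa using K3 hF hH hA hT 0 1 isCoprime_one_right
  refine ⟨h0, h2, ?_⟩
  have hg : (0:ℤ) < (Int.gcd (T 1) (2 * T 0)) := by
    have := Int.gcd_pos_of_ne_zero_right (T 1) (show 2 * T 0 ≠ 0 by omega)
    exact_mod_cast this
  obtain ⟨g, a, b, hg0, hab, ha, hb⟩ := Int.exists_gcd_one' (m := T 1) (n := 2 * T 0) (by exact_mod_cast hg)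
  have := K3 hF hH hA hT (-a) b (by rw [IsCoprime.neg_left_iff]; exact Int.isCoprime_iff_gcd_eq_one.2 hab)
  have hgp : (0:ℤ) < g := by exact_mod_cast hg0
  have h5 : 0 < (T 0 * (-a)^2 + T 1 * (-a * b) + T 2 * b^2) * g^2 := by positivity
  have h6 : (T 0 * (-a)^2 + T 1 * (-a * b) + T 2 * b^2) * g^2 = T 0 * (4 * T 0 * T 2 - T 1 ^ 2) := by
    have : (T 0 * (-a)^2 + T 1 * (-a * b) + T 2 * b^2) * g^2 = T 0 * (a * g)^2 - T 1 * ((a*g) * (b*g)) + T 2 * (b*g)^2 := by ring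
    rw [this, ← ha, ← hb]; ring
  rw [h6] at h5
  have := (mul_pos_iff_of_pos_left h0).1 h5
  linarith

end SS

namespace SS
variable {j : ℕ}

def Good (A : Z3 → ℂ) : Prop := (∀ T, A T ≠ 0 → Pos T) ∧ ∀ w ∈ U3, Summable fun T => A T * ex T w
def EE (A : Z3 → ℂ) (w : Fin 3 → ℂ) : ℂ := ∑' T, A T * ex T w

lemma Pos.abs {T : Z3} (h : Pos T) : |(T 1 : ℝ)| ≤ T 0 + T 2 ∧ (0:ℝ) < T 0 ∧ (0:ℝ) < T 2 ∧ (T 1 : ℝ)^2 ≤ 4 * T 0 * T 2 := by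
  obtain ⟨h0, h2, h1⟩ := h
  have a0 : (0:ℝ) < T 0 := by exact_mod_cast h0
  have a2 : (0:ℝ) < T 2 := by exact_mod_cast h2
  have a1 : (T 1 : ℝ)^2 ≤ 4 * T 0 * T 2 := by exact_mod_cast h1.le
  exact ⟨abs_le_of_sq_le_sq (by nlinarith [sq_nonneg ((T 0 : ℝ) - T 2)]) (by positivity), a0, a2, a1⟩

lemma Good.near {A : Z3 → ℂ} (hA : Good A) {w} (hw : w ∈ U3) : ∃ κ > 0, ∃ u : Z3 → ℝ, Summable u ∧
    ∀ v ∈ Metric.ball w κ, v ∈ U3 ∧ ∀ T, ‖A T * ex T v‖ * (|(T 0:ℝ)| + |(T 1:ℝ)| + |(T 2:ℝ)|) ≤ u T := by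
  obtain ⟨ε, hε, hb⟩ := Metric.isOpen_iff.1 U3_open w hw
  set κ := ε / 4 with hκ
  have hκ0 : 0 < κ := by positivity
  have hw' : w - ![2*κ*I, 0, 2*κ*I] ∈ U3 := hb (by
    rw [mem_ball_iff_norm, sub_sub_cancel_left, norm_neg, pi_norm_lt_iff hε]
    intro i; fin_cases i <;> simp [abs_of_pos hκ0] <;> linarith)
  refine ⟨κ/2, by positivity, fun T => ‖A T * ex T (w - ![2*κ*I, 0, 2*κ*I])‖ * (2 / κ), (hA.2 _ hw').norm.mul_right _, fun v hv => ⟨hb (Metric.ball_subset_ball (by linarith) hv), fun T => ?_⟩⟩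
  by_cases hT : A T = 0
  · simp [hT]
  obtain ⟨h1, h0, h2, -⟩ := (hA.1 T hT).abs
  rw [mem_ball_iff_norm, pi_norm_lt_iff (by positivity)] at hv
  have him : ∀ i, |(v i).im - (w i).im| ≤ κ / 2 := fun i => by
    have := (Complex.abs_im_le_norm ((v - w) i)).trans (hv i).le
    simpa using this
  beta_reduce
  rw [norm_mul, norm_mul, norm_ex, norm_ex]
  have key : dt T (fun i => ((w - ![2*κ*I, 0, 2*κ*I]) i).im) + κ * (T 0 + T 2) ≤ dt T fun i => (v i).im := by
    have e0 := abs_le.1 (him 0)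
    have e2 := abs_le.1 (him 2)
    have e1 : -((T 0 + T 2) * (κ/2)) ≤ T 1 * ((v 1).im - (w 1).im) := by
      have : |T 1 * ((v 1).im - (w 1).im)| ≤ (T 0 + T 2) * (κ/2) := by
        rw [abs_mul]; exact mul_le_mul h1 (him 1) (abs_nonneg _) (by positivity)
      exact (abs_le.1 this).1
    simp [dt]
    nlinarith
  have hx : κ * (T 0 + T 2) * Real.exp (-(κ * (T 0 + T 2))) ≤ 1 := by
    have := Real.add_one_le_exp (κ * ((T 0:ℝ) + T 2))
    rw [Real.exp_neg, ← div_eq_mul_inv, div_le_one (Real.exp_pos _)]; linarith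
  have e1 : Real.exp (-Real.pi * dt T fun i => (v i).im) ≤ Real.exp (-Real.pi * dt T (fun i => ((w - ![2*κ*I, 0, 2*κ*I]) i).im)) * Real.exp (-(κ * (T 0 + T 2))) := by
    rw [← Real.exp_add, Real.exp_le_exp]
    have := Real.pi_gt_three
    have := mul_pos hκ0 (add_pos h0 h2)
    nlinarith
  have e2 : (|(T 0:ℝ)| + |(T 1:ℝ)| + |(T 2:ℝ)|) ≤ 2 * (T 0 + T 2) := by
    rw [abs_of_pos h0, abs_of_pos h2]; linarith
  calc _ ≤ ‖A T‖ * (Real.exp (-Real.pi * dt T (fun i => ((w - ![2*κ*I, 0, 2*κ*I]) i).im)) * Real.exp (-(κ * (T 0 + T 2)))) * (2 * (T 0 + T 2)) := by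
        gcongr
    _ = ‖A T‖ * Real.exp (-Real.pi * dt T (fun i => ((w - ![2*κ*I, 0, 2*κ*I]) i).im)) * ((2 / κ) * (κ * (T 0 + T 2) * Real.exp (-(κ * (T 0 + T 2))))) := by
        field_simp
    _ ≤ _ := by
      refine mul_le_mul_of_nonneg_left ?_ (by positivity)
      exact mul_le_of_le_one_right (by positivity) hx

lemma Good.mul {A : Z3 → ℂ} (hA : Good A) (k : Fin 3) : Good fun T => T k * A T := by
  refine ⟨fun T h => hA.1 T (right_ne_zero_of_mul h), fun w hw => ?_⟩
  obtain ⟨κ, hκ, u, hu, h⟩ := hA.near hw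
  refine Summable.of_norm_bounded hu fun T => ((h w (Metric.mem_ball_self hκ)).2 T).trans' ?_
  rw [mul_assoc, norm_mul, mul_comm, Complex.norm_intCast]
  gcongr
  fin_cases k <;> simp <;> linarith [abs_nonneg (T 0 : ℝ), abs_nonneg (T 1 : ℝ), abs_nonneg (T 2 : ℝ)]

lemma Good.lin {A B : Z3 → ℂ} (hA : Good A) (hB : Good B) (c d : ℂ) : Good (fun T => c * A T + d * B T) ∧
    ∀ w ∈ U3, EE (fun T => c * A T + d * B T) w = c * EE A w + d * EE B w := by
  have e : ∀ w T, (c * A T + d * B T) * ex T w = c * (A T * ex T w) + d * (B T * ex T w) := fun w T => by ring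
  refine ⟨⟨fun T h => ?_, fun w hw => ?_⟩, fun w hw => ?_⟩
  · by_contra h'
    exact h (by beta_reduce; rw [not_not.1 fun h0 => h' (hA.1 T h0), not_not.1 fun h0 => h' (hB.1 T h0)]; ring)
  · simp only [e]; exact ((hA.2 w hw).mul_left c).add ((hB.2 w hw).mul_left d)
  · simp only [EE, e]; rw [((hA.2 w hw).mul_left c).tsum_add ((hB.2 w hw).mul_left d), tsum_mul_left, tsum_mul_left]

lemma Good.deriv {A : Z3 → ℂ} (hA : Good A) {w} (hw : w ∈ U3) :
    HasFDerivAt (EE A) (∑ k : Fin 3, (Real.pi * I * EE (fun T => T k * A T) w) • (ContinuousLinearMap.proj (R := ℂ) (φ := fun _ : Fin 3 => ℂ) k)) w := by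
  obtain ⟨κ, hκ, u, hu, h⟩ := hA.near hw
  let L : Z3 → ((Fin 3 → ℂ) →L[ℂ] ℂ) := fun T => ∑ k : Fin 3, (Real.pi * I * T k) • (ContinuousLinearMap.proj (R := ℂ) (φ := fun _ : Fin 3 => ℂ) k)
  have hL : ∀ T, ‖L T‖ ≤ Real.pi * (|(T 0:ℝ)| + |(T 1:ℝ)| + |(T 2:ℝ)|) := fun T => by
    refine ContinuousLinearMap.opNorm_le_bound _ (by positivity) fun v => ?_
    simp only [L, Fin.sum_univ_three, _root_.add_apply, _root_.smul_apply, ContinuousLinearMap.proj_apply, smul_eq_mul]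
    refine (norm_add₃_le).trans ?_
    simp only [norm_mul, Complex.norm_intCast, Complex.norm_real, Complex.norm_I, Real.norm_eq_abs, abs_of_pos Real.pi_pos]
    have n0 := norm_le_pi_norm v 0
    have n1 := norm_le_pi_norm v 1
    have n2 := norm_le_pi_norm v 2
    calc _ ≤ Real.pi * 1 * |(T 0:ℝ)| * ‖v‖ + Real.pi * 1 * |(T 1:ℝ)| * ‖v‖ + Real.pi * 1 * |(T 2:ℝ)| * ‖v‖ := by gcongr
      _ = _ := by ring
  have hd : ∀ T, ∀ v, HasFDerivAt (fun v => A T * ex T v) ((A T * ex T v) • L T) v := by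
    intro T v
    have : HasFDerivAt (fun v : Fin 3 → ℂ => (Real.pi * I * (T 0 * v 0 + T 1 * v 1 + T 2 * v 2) : ℂ)) (L T) v := by
      have := (L T).hasFDerivAt (x := v)
      refine this.congr_of_eventuallyEq (Eventually.of_forall fun v => ?_)
      simp [L, Fin.sum_univ_three]; ring
    have := (this.cexp).const_mul (A T)
    rw [smul_smul] at this
    exact this
  have hs := hasFDerivAt_tsum_of_isPreconnected (hu.mul_left Real.pi) Metric.isOpen_ball (convex_ball w κ).isPreconnected
    (fun T v _ => hd T v) (fun T v hv => by
      rw [norm_smul]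
      calc _ ≤ ‖A T * ex T v‖ * (Real.pi * (|(T 0:ℝ)| + |(T 1:ℝ)| + |(T 2:ℝ)|)) := by gcongr; exact hL T
        _ = Real.pi * (‖A T * ex T v‖ * (|(T 0:ℝ)| + |(T 1:ℝ)| + |(T 2:ℝ)|)) := by ring
        _ ≤ _ := mul_le_mul_of_nonneg_left ((h v hv).2 T) Real.pi_pos.le) (Metric.mem_ball_self hκ) (hA.2 w hw) (Metric.mem_ball_self hκ)
  have e : ∑' T, (A T * ex T w) • L T = ∑ k : Fin 3, (Real.pi * I * EE (fun T => T k * A T) w) • (ContinuousLinearMap.proj (R := ℂ) (φ := fun _ : Fin 3 => ℂ) k) := by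
    refine HasSum.tsum_eq ?_
    have : ∀ k : Fin 3, HasSum (fun T => (A T * ex T w) • (Real.pi * I * T k) • (ContinuousLinearMap.proj (R := ℂ) (φ := fun _ : Fin 3 => ℂ) k)) ((Real.pi * I * EE (fun T => T k * A T) w) • (ContinuousLinearMap.proj (R := ℂ) (φ := fun _ : Fin 3 => ℂ) k)) := by
      intro k
      have := (((hA.mul k).2 w hw).hasSum.mul_left (Real.pi * I : ℂ)).smul_const (ContinuousLinearMap.proj (R := ℂ) (φ := fun _ : Fin 3 => ℂ) k)
      refine this.congr_fun fun T => ?_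
      rw [smul_smul]; congr 1; ring
    refine (hasSum_sum fun k _ => this k).congr_fun fun T => ?_
    simp [L, Finset.smul_sum]
  rw [e] at hs
  exact hs

lemma Good.deriv_curve {A : Z3 → ℂ} (hA : Good A) {w : ℝ → Fin 3 → ℂ} {w' : Fin 3 → ℂ} {t : ℝ} (hw : w t ∈ U3)
    (hd : ∀ k, HasDerivAt (fun t => w t k) (w' k) t) :
    HasDerivAt (fun t => EE A (w t)) (Real.pi * I * (EE (fun T => T 0 * A T) (w t) * w' 0 + EE (fun T => T 1 * A T) (w t) * w' 1 + EE (fun T => T 2 * A T) (w t) * w' 2)) t := by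
  have := ((hA.deriv hw).restrictScalars ℝ).comp_hasDerivAt t (hasDerivAt_pi.2 hd)
  refine hdc this (fun r => rfl) ?_
  simp [Fin.sum_univ_three]; ring

lemma Good.cont {A : Z3 → ℂ} (hA : Good A) : ContinuousOn (EE A) U3 := fun _ hw => (hA.deriv hw).continuousAt.continuousWithinAt

def SY (w : Fin 3 → ℂ) : Prop := 2/5 ≤ (w 0).im ∧ |(w 1).im| ≤ (w 0).im / 2 ∧ (w 0).im ≤ (w 2).im

lemma SY.mem {w} (h : SY w) : w ∈ U3 := by
  obtain ⟨h1, h2, h3⟩ := h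
  refine U3_iff.2 ⟨by simp only; linarith, ?_⟩
  have := sq_le_sq' (by linarith [(abs_le.1 h2).1]) (abs_le.1 h2).2
  show (w 1).im ^ 2 < (w 0).im * (w 2).im
  nlinarith

lemma Good.bound {A : Z3 → ℂ} (hA : Good A) : ∃ C : ℝ, 0 ≤ C ∧ ∀ w, SY w → ‖EE A w‖ ≤ C * Real.exp (-(Real.pi/4) * ((w 0).im + (w 2).im)) := by
  have hw0 : (![1/10*I, 0, 1/10*I] : Fin 3 → ℂ) ∈ U3 := U3_iff.2 (by simp [Cn])
  have hs := (hA.2 _ hw0).norm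
  refine ⟨∑' T, ‖A T * ex T ![1/10*I, 0, 1/10*I]‖, tsum_nonneg fun _ => norm_nonneg _, fun w hw => ?_⟩
  have hb : ∀ T, ‖A T * ex T w‖ ≤ ‖A T * ex T ![1/10*I, 0, 1/10*I]‖ * Real.exp (-(Real.pi/4) * ((w 0).im + (w 2).im)) := by
    intro T
    by_cases hT : A T = 0
    · simp [hT]
    have hP := hA.1 T hT
    obtain ⟨-, h0, h2, h1⟩ := hP.abs
    have i0 : (1:ℝ) ≤ T 0 := by exact_mod_cast hP.1
    have i2 : (1:ℝ) ≤ T 2 := by exact_mod_cast hP.2.1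
    obtain ⟨y0, y1, y2⟩ := hw
    rw [norm_mul, norm_mul, mul_assoc]
    refine mul_le_mul_of_nonneg_left ?_ (norm_nonneg _)
    rw [norm_ex, norm_ex, ← Real.exp_add, Real.exp_le_exp]
    have y02 : 0 ≤ (w 2).im := by linarith
    have k1 : |T 1 * (w 1).im| ≤ (T 0 * (w 0).im + T 2 * (w 2).im) / 2 := by
      refine abs_le_of_sq_le_sq ?_ (by positivity)
      have := sq_le_sq' (by linarith [(abs_le.1 y1).1]) (abs_le.1 y1).2
      have a1 : ((T 1:ℝ) * (w 1).im)^2 ≤ (4 * T 0 * T 2) * ((w 0).im/2)^2 := by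
        rw [mul_pow]; gcongr
      have a2 : (4 * T 0 * T 2) * ((w 0).im/2)^2 ≤ (T 0 * (w 0).im) * (T 2 * (w 2).im) := by
        have : 0 ≤ (T 0:ℝ) * T 2 * (w 0).im * ((w 2).im - (w 0).im) := by
          apply mul_nonneg <;> [positivity; linarith]
        nlinarith
      nlinarith [sq_nonneg ((T 0:ℝ) * (w 0).im - T 2 * (w 2).im)]
    have k2 := (abs_le.1 k1).1
    have k3 : (1/4) * ((w 0).im + (w 2).im) + (T 0 + T 2) / 10 ≤ dt T fun i => (w i).im := by
      simp only [dt]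
      nlinarith [mul_nonneg (sub_nonneg.2 i0) (show 0 ≤ (w 0).im by linarith), mul_nonneg (sub_nonneg.2 i2) y02]
    have k4 : dt T (fun i => ((![1/10*I, 0, 1/10*I] : Fin 3 → ℂ) i).im) = (T 0 + T 2) / 10 := by
      simp [dt]; ring
    rw [k4]
    nlinarith [mul_le_mul_of_nonneg_left k3 Real.pi_pos.le]
  calc ‖EE A w‖ ≤ ∑' T, ‖A T * ex T w‖ := norm_tsum_le_tsum_norm (hA.2 w hw.mem).norm
    _ ≤ ∑' T, ‖A T * ex T ![1/10*I, 0, 1/10*I]‖ * Real.exp (-(Real.pi/4) * ((w 0).im + (w 2).im)) :=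
        (hA.2 w hw.mem).norm.tsum_le_tsum hb (hs.mul_right _)
    _ = _ := tsum_mul_right

end SS

namespace SS

def i0 : M2 := mat I 0 I
lemma i0_mem : i0 ∈ HH := mat_mem.2 (by simp)
def wg (g : G) : Fin 3 → ℂ := ![act g i0 0 0, act g i0 0 1, act g i0 1 1]
lemma wg_mt (g : G) : mt (wg g) = act g i0 := (HH_mat (act_mem g i0_mem).1).symm
lemma wg_mem (g : G) : wg g ∈ U3 := by
  show mt _ ∈ HH; rw [wg_mt]; exact act_mem g i0_mem
def yy (g : G) (k : Fin 3) : ℝ := (wg g k).im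
def Kc (g : G) : M2 := dn g i0 * (dn g i0)ᴴ
def kA (g : G) : ℝ := ‖dn g i0 0 0‖^2 + ‖dn g i0 0 1‖^2
def kC (g : G) : ℝ := ‖dn g i0 1 0‖^2 + ‖dn g i0 1 1‖^2
def kB (g : G) : ℝ := (dn g i0 0 0 * (starRingEnd ℂ) (dn g i0 1 0) + dn g i0 0 1 * (starRingEnd ℂ) (dn g i0 1 1)).re

lemma act_e (g : G) : act g i0 = !![wg g 0, wg g 1; wg g 1, wg g 2] := (wg_mt g).symm

lemma num_e (g : G) (k : Fin 2) : num g i0 0 k = wg g 0 * dn g i0 0 k + wg g 1 * dn g i0 1 k ∧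
    num g i0 1 k = wg g 1 * dn g i0 0 k + wg g 2 * dn g i0 1 k := by
  rw [← act_dn g i0_mem, act_e]; simp [Matrix.mul_apply, Fin.sum_univ_two]

lemma Y_K (g : G) : (!![(yy g 0 : ℂ), yy g 1; yy g 1, yy g 2] : M2) * (dn g i0 * (dn g i0)ᴴ) = 1 := by
  rw [← Matrix.mul_assoc, mul_eq_one_comm]
  have h := herm g i0
  have e1 : act g i0 - (act g i0)ᴴ = (2 * I : ℂ) • (!![(yy g 0 : ℂ), yy g 1; yy g 1, yy g 2] : M2) := by
    rw [act_e]; ext i k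
    fin_cases i <;> fin_cases k <;> simp [Matrix.conjTranspose_apply, yy, Complex.ext_iff] <;> ring
  have e2 : i0 - i0ᴴ = (2 * I : ℂ) • (1 : M2) := by
    ext i k; fin_cases i <;> fin_cases k <;> simp [i0, mat, Matrix.conjTranspose_apply] <;> ring
  have e3 : (dn g i0)ᴴ * num g i0 - (num g i0)ᴴ * dn g i0 = (dn g i0)ᴴ * (act g i0 - (act g i0)ᴴ) * dn g i0 := by
    rw [← act_dn g i0_mem, conjTranspose_mul]; noncomm_ring
  rw [e3, e1, e2] at h
  rw [Matrix.mul_smul, Matrix.smul_mul, Matrix.mul_assoc] at h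
  exact smul_right_injective _ (show (2 * I : ℂ) ≠ 0 by simp) h

lemma nsq (z : ℂ) : ‖z‖^2 = z.re^2 + z.im^2 := by rw [Complex.sq_norm, Complex.normSq_apply]; ring

lemma Krel (g : G) : yy g 0 * kA g + yy g 1 * kB g = 1 ∧ yy g 0 * kB g + yy g 1 * kC g = 0 ∧
    yy g 1 * kA g + yy g 2 * kB g = 0 ∧ yy g 1 * kB g + yy g 2 * kC g = 1 ∧
    ‖num g i0 0 0‖^2 + ‖num g i0 0 1‖^2 = (wg g 0).re^2 * kA g + 2 * (wg g 0).re * (wg g 1).re * kB g + (wg g 1).re^2 * kC g + yy g 0 := by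
  have h := Y_K g
  have h00 := congrFun (congrFun h 0) 0
  have h01 := congrFun (congrFun h 0) 1
  have h10 := congrFun (congrFun h 1) 0
  have h11 := congrFun (congrFun h 1) 1
  rw [(num_e g 0).1, (num_e g 1).1]
  have hy0 : 0 < yy g 0 := (U3_iff.1 (wg_mem g)).1
  simp [Matrix.mul_apply, Fin.sum_univ_two, Complex.ext_iff] at h00 h01 h10 h11
  simp only [kA, kB, kC, nsq]
  simp
  have e : (dn g i0 0 0).re * (dn g i0 1 0).im - (dn g i0 0 0).im * (dn g i0 1 0).re + ((dn g i0 0 1).re * (dn g i0 1 1).im - (dn g i0 0 1).im * (dn g i0 1 1).re) = 0 := by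
    have := h01.2
    apply mul_left_cancel₀ hy0.ne'
    linarith
  obtain ⟨h00, -⟩ := h00
  obtain ⟨h01, -⟩ := h01
  obtain ⟨h10, -⟩ := h10
  obtain ⟨h11, -⟩ := h11
  refine ⟨by linarith, by linarith, by linarith, by linarith, ?_⟩
  simp only [show (wg g 0).im = yy g 0 from rfl, show (wg g 1).im = yy g 1 from rfl]
  linear_combination yy g 0 * h00 + yy g 1 * h01 - 2 * ((wg g 0).re * yy g 1 - yy g 0 * (wg g 1).re) * e

/-- finiteness -/
lemma row_fin (g : G) (R : ℝ) : {v : Fin 2 ⊕ Fin 2 → ℤ | ∀ k, |((fun l => (v l : ℝ)) ᵥ* g.1) k| ≤ R}.Finite := by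
  let M : ℝ := ∑ k, ∑ l, R * |(g⁻¹).1 l k|
  refine (Set.finite_Icc (fun _ : Fin 2 ⊕ Fin 2 => -⌈M⌉) (fun _ => ⌈M⌉)).subset fun v hv => ?_
  have hv : ∀ k, |((fun l => (v l : ℝ)) ᵥ* g.1) k| ≤ R := hv
  have h1 : ∀ k, |(v k : ℝ)| ≤ M := fun k => by
    have e : (fun l => (v l : ℝ)) = ((fun l => (v l : ℝ)) ᵥ* g.1) ᵥ* (g⁻¹).1 := by
      rw [vecMul_vecMul, show g.1 * (g⁻¹).1 = 1 from congrArg Subtype.val (mul_inv_cancel g), vecMul_one]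
    have e2 := congrFun e k
    rw [e2]
    have hR : 0 ≤ R := (abs_nonneg _).trans (hv k)
    calc _ ≤ ∑ l, |((fun l => (v l : ℝ)) ᵥ* g.1) l * (g⁻¹).1 l k| := Finset.abs_sum_le_sum_abs _ _
      _ ≤ ∑ l, R * |(g⁻¹).1 l k| := Finset.sum_le_sum fun l _ => by
          rw [abs_mul]; exact mul_le_mul_of_nonneg_right (hv l) (abs_nonneg _)
      _ ≤ _ := Finset.single_le_sum (f := fun k => ∑ l, R * |(g⁻¹).1 l k|) (fun _ _ => Finset.sum_nonneg fun _ _ => by positivity) (Finset.mem_univ k)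
  constructor <;> intro k
  · have := (abs_le.1 (h1 k)).1
    have h2 := Int.le_ceil M
    have : (-⌈M⌉ : ℝ) ≤ v k := by linarith
    exact_mod_cast this
  · have := (abs_le.1 (h1 k)).2.trans (Int.le_ceil M)
    exact_mod_cast this

def nrm (g : G) (i : Fin 2 ⊕ Fin 2) : ℝ := ∑ k, (g.1 i k)^2
lemma nrm_nonneg (g i) : 0 ≤ nrm g i := Finset.sum_nonneg fun _ _ => sq_nonneg _
lemma nrm_row (γ : GZ) (g : G) (i k) : ((fun l => (γ.1 i l : ℝ)) ᵥ* g.1) k = (ι γ * g).1 i k := by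
  show _ = ((ι γ).1 * g.1) i k
  rw [Matrix.mul_apply]; rfl
lemma nrm_fin (γ : GZ) (g : G) (i) (R : ℝ) (h : nrm (ι γ * g) i ≤ R) : γ.1 i ∈ {v : Fin 2 ⊕ Fin 2 → ℤ | ∀ k, |((fun l => (v l : ℝ)) ᵥ* g.1) k| ≤ R + 1} := by
  intro k
  rw [nrm_row]
  have h1 : ((ι γ * g).1 i k)^2 ≤ R := (Finset.single_le_sum (f := fun k => ((ι γ * g).1 i k)^2) (fun _ _ => sq_nonneg _) (Finset.mem_univ k)).trans h
  refine abs_le_of_sq_le_sq ?_ ?_ <;> nlinarith [sq_nonneg ((ι γ * g).1 i k)]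

def nm (g : G) : ℝ := ∑ i, nrm g i
lemma nm_fin (g : G) (R : ℝ) : {γ : GZ | nm (ι γ * g) ≤ R}.Finite := by
  have h := Set.Finite.pi' (fun _ : Fin 2 ⊕ Fin 2 => row_fin g (R+1))
  refine Set.Finite.of_finite_image (f := fun γ : GZ => (γ.1 : Fin 2 ⊕ Fin 2 → Fin 2 ⊕ Fin 2 → ℤ)) (h.subset ?_) (fun a _ b _ e => Subtype.ext e)
  rintro _ ⟨γ, hγ, rfl⟩ i
  exact nrm_fin γ g i R ((Finset.single_le_sum (f := fun i => nrm (ι γ * g) i) (fun _ _ => nrm_nonneg _ _) (Finset.mem_univ i)).trans hγ)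

lemma nrm_k (g : G) : nrm g (Sum.inr 0) = kA g ∧ nrm g (Sum.inr 1) = kC g := by
  constructor <;> simp [nrm, kA, kC, nsq, dn, i0, mat, gc, gd, cm, Matrix.mul_apply, Fin.sum_univ_two, toBlocks₂₁, toBlocks₂₂] <;> ring

lemma exists_min (g : G) : ∃ γ : GZ, ∀ γ' : GZ, kA (ι γ * g) + kC (ι γ * g) ≤ kA (ι γ' * g) + kC (ι γ' * g) := by
  let Q : (Fin 2 → Fin 2 ⊕ Fin 2 → ℤ) → ℝ := fun m => ∑ i, ∑ k, (((fun l => (m i l : ℝ)) ᵥ* g.1) k)^2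
  have hQ : ∀ γ : GZ, Q (fun i => γ.1 (Sum.inr i)) = kA (ι γ * g) + kC (ι γ * g) := by
    intro γ
    rw [← (nrm_k _).1, ← (nrm_k _).2]
    simp only [Q, nrm_row, Fin.sum_univ_two, nrm]
  have hf : {m | (∃ γ : GZ, m = fun i => γ.1 (Sum.inr i)) ∧ Q m ≤ kA g + kC g}.Finite := by
    refine (Set.Finite.pi' (fun _ : Fin 2 => row_fin g (kA g + kC g + 1))).subset ?_
    rintro _ ⟨⟨γ, rfl⟩, h⟩ i
    refine nrm_fin γ g _ _ ?_
    rw [hQ, ← (nrm_k (ι γ * g)).1, ← (nrm_k (ι γ * g)).2] at h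
    have h0 := nrm_nonneg (ι γ * g) (Sum.inr 0)
    have h1 := nrm_nonneg (ι γ * g) (Sum.inr 1)
    fin_cases i <;> simp <;> linarith
  have h1 : Q (fun i => (1 : GZ).1 (Sum.inr i)) = kA g + kC g := by rw [hQ, map_one, one_mul]
  obtain ⟨_, ⟨⟨γ, rfl⟩, hγ⟩, hm⟩ := Set.exists_min_image _ Q hf ⟨fun i => (1 : GZ).1 (Sum.inr i), ⟨1, rfl⟩, h1.le⟩
  refine ⟨γ, fun γ' => ?_⟩
  rw [← hQ, ← hQ]
  by_cases h : Q (fun i => γ'.1 (Sum.inr i)) ≤ kA g + kC g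
  · exact hm _ ⟨⟨γ', rfl⟩, h⟩
  · exact hγ.trans (not_le.1 h).le

def J1 (a b c d : ℤ) (h : a * d - b * c = 1) : GZ := mkZ !![a,0;0,1] !![b,0;0,0] !![c,0;0,0] !![d,0;0,1] (by
  refine ⟨?_, ?_, ?_⟩ <;> ext i k <;> fin_cases i <;> fin_cases k <;> simp [Matrix.mul_apply, Fin.sum_univ_two] <;> linarith)

lemma mkZ_mul (A B C D : Matrix (Fin 2) (Fin 2) ℤ) (h) (g : G) :
    num (ι (mkZ A B C D h) * g) i0 = cz A * num g i0 + cz B * dn g i0 ∧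
    dn (ι (mkZ A B C D h) * g) i0 = cz C * num g i0 + cz D * dn g i0 := by
  obtain ⟨h1, h2⟩ := num_mul (ι (mkZ A B C D h)) g i0_mem
  obtain ⟨h3, h4⟩ := mkZ_dn A B C D h (act g i0)
  rw [h1, h2, h3, h4, add_mul, add_mul, Matrix.mul_assoc, Matrix.mul_assoc, act_dn g i0_mem]; simp

def SS1 (g : G) : Prop := SY (wg g) ∧ ∀ k, |(wg g k).re| ≤ 1/2

lemma tr_wg (a b c : ℤ) (g : G) : dn (ι (trZ a b c) * g) i0 = dn g i0 ∧ wg (ι (trZ a b c) * g) = wg g + ![(a:ℂ), b, c] := by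
  obtain ⟨h1, h2⟩ := mkZ_mul 1 !![a, b; b, c] 0 1 (SymplecticGroup.fromBlocks_mem_iff.1 (trZ a b c).2) g
  have h3 : dn (ι (trZ a b c) * g) i0 = dn g i0 := h2.trans (by rw [cz_zero, cz_one]; simp)
  refine ⟨h3, ?_⟩
  have h4 : act (ι (trZ a b c) * g) i0 = act g i0 + cz !![a, b; b, c] := by
    rw [act, h3, show num (ι (trZ a b c) * g) i0 = _ from h1, cz_one, add_mul, Matrix.one_mul, Matrix.mul_assoc, mul_nonsing_inv _ (dn_ne g i0_mem).isUnit, Matrix.mul_one, ← act.eq_def]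
  funext i; simp only [wg, h4]; fin_cases i <;> simp [cz]

lemma k_lv (p q r s : ℤ) (h) (g : G) : dn (ι (lvZ p q r s h) * g) i0 = !![(s:ℂ), -r; -q, p] * dn g i0 := by
  obtain ⟨h1, h2⟩ := mkZ_mul !![p, q; r, s] 0 0 !![s, -r; -q, p] (SymplecticGroup.fromBlocks_mem_iff.1 (lvZ p q r s h).2) g
  refine Eq.trans h2 ?_
  rw [cz_zero, zero_mul, zero_add]; congr 1; ext i k; fin_cases i <;> fin_cases k <;> simp [cz]

lemma reduce (g : G) : ∃ γ : GZ, SS1 (ι γ * g) := by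
  let Mn : G → Prop := fun g => ∀ γ : GZ, kA g + kC g ≤ kA (ι γ * g) + kC (ι γ * g)
  have hM : ∀ (γ : GZ) (g : G), Mn g → kA (ι γ * g) + kC (ι γ * g) = kA g + kC g → Mn (ι γ * g) := by
    intro γ g h e γ'
    rw [e, ← mul_assoc, ← map_mul]; exact h _
  obtain ⟨γ1, h1⟩ : ∃ γ : GZ, Mn (ι γ * g) := by
    obtain ⟨γ, h⟩ := exists_min g
    refine ⟨γ, fun γ' => ?_⟩
    rw [← mul_assoc, ← map_mul]; exact h _
  obtain ⟨γ2, h2, h2'⟩ : ∃ γ : GZ, Mn (ι γ * g) ∧ kC (ι γ * g) ≤ kA (ι γ * g) := by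
    rcases le_total (kC (ι γ1 * g)) (kA (ι γ1 * g)) with h | h
    · exact ⟨γ1, h1, h⟩
    · have hs : (0:ℤ) * 0 - 1 * (-1) = 1 := by norm_num
      have e := k_lv 0 1 (-1) 0 hs (ι γ1 * g)
      have eA : kA (ι (lvZ 0 1 (-1) 0 hs) * (ι γ1 * g)) = kC (ι γ1 * g) := by
        simp [kA, kC, e, Matrix.mul_apply, Fin.sum_univ_two]
      have eC : kC (ι (lvZ 0 1 (-1) 0 hs) * (ι γ1 * g)) = kA (ι γ1 * g) := by
        simp [kA, kC, e, Matrix.mul_apply, Fin.sum_univ_two]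
      refine ⟨lvZ 0 1 (-1) 0 hs * γ1, ?_, ?_⟩
      · rw [map_mul, mul_assoc]; exact hM _ _ h1 (by rw [eA, eC, add_comm])
      · rw [map_mul, mul_assoc, eA, eC]; exact h
  set g2 := ι γ2 * g with hg2
  let r := fun k => - round ((wg g2 k).re)
  obtain ⟨e1, e2⟩ := tr_wg (r 0) (r 1) (r 2) g2
  have eA : kA (ι (trZ (r 0) (r 1) (r 2)) * g2) = kA g2 := by simp only [kA, e1]
  have eC : kC (ι (trZ (r 0) (r 1) (r 2)) * g2) = kC g2 := by simp only [kC, e1]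
  have h3 := hM (trZ (r 0) (r 1) (r 2)) g2 h2 (by rw [eA, eC])
  rw [← eA, ← eC] at h2'
  have hre : ∀ k, |(wg (ι (trZ (r 0) (r 1) (r 2)) * g2) k).re| ≤ 1/2 := by
    intro k
    have := abs_sub_round ((wg g2 k).re)
    rw [e2]; fin_cases k <;> simpa [r, sub_eq_add_neg] using this
  refine ⟨trZ (r 0) (r 1) (r 2) * γ2, ?_⟩
  rw [map_mul, mul_assoc, ← hg2]
  generalize ι (trZ (r 0) (r 1) (r 2)) * g2 = g' at h3 h2' hre
  refine ⟨?_, hre⟩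
  have s1 : ∀ k : ℤ, 0 ≤ -(2 * k * kB g') + k^2 * kC g' := by
    intro k
    have hs : (1:ℤ) * 1 - 0 * k = 1 := by ring
    have e := k_lv 1 0 k 1 hs g'
    have eA : kA (ι (lvZ 1 0 k 1 hs) * g') = kA g' - 2 * k * kB g' + k^2 * kC g' := by
      simp [kA, kC, kB, e, Matrix.mul_apply, Fin.sum_univ_two, nsq]; ring
    have eC : kC (ι (lvZ 1 0 k 1 hs) * g') = kC g' := by
      simp [kC, e, Matrix.mul_apply, Fin.sum_univ_two]
    have := h3 (lvZ 1 0 k 1 hs)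
    rw [eA, eC] at this; linarith
  have s2 : kA g' ≤ ‖num g' i0 0 0‖^2 + ‖num g' i0 0 1‖^2 := by
    have e := (mkZ_mul _ _ _ _ (SymplecticGroup.fromBlocks_mem_iff.1 (J1 0 (-1) 1 0 (by norm_num)).2) g').2
    have e : dn (ι (J1 0 (-1) 1 0 (by norm_num)) * g') i0 = _ := e
    have := h3 (J1 0 (-1) 1 0 (by norm_num))
    rw [kA.eq_def (_ * _), kC.eq_def (_ * _), e] at this
    simp [Matrix.mul_apply, Fin.sum_univ_two, cz] at this
    simp only [kC] at this; linarith
  obtain ⟨k1, k2, k3, k4, k5⟩ := Krel g'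
  rw [k5] at s2
  have u1 := s1 1
  have u2 := s1 (-1)
  push_cast at u1 u2
  have hy : 0 < yy g' 0 ∧ yy g' 1 ^ 2 < yy g' 0 * yy g' 2 := U3_iff.1 (wg_mem g')
  have x0 := abs_le.1 (hre 0)
  have x1 := abs_le.1 (hre 1)
  generalize (wg g' 0).re = X0 at *
  generalize (wg g' 1).re = X1 at *
  show 2/5 ≤ yy g' 0 ∧ |yy g' 1| ≤ yy g' 0 / 2 ∧ yy g' 0 ≤ yy g' 2
  obtain ⟨hy0, hy1⟩ := hy
  generalize yy g' 0 = a at *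
  generalize yy g' 1 = b at *
  generalize yy g' 2 = c at *
  have hA0 : 0 ≤ kA g' := by unfold kA; positivity
  have hC0 : 0 ≤ kC g' := by unfold kC; positivity
  clear h3 s1 k5 e1 e2
  generalize kA g' = A at *
  generalize kB g' = B at *
  generalize kC g' = C at *
  -- a = C/Δ, b = -B/Δ, c = A/Δ
  have hΔ : 0 < a * c - b^2 := by linarith
  have eA : A = c / (a*c-b^2) := by rw [eq_div_iff hΔ.ne']; linear_combination c * k1 - b * k3
  have eB : B = -b / (a*c-b^2) := by rw [eq_div_iff hΔ.ne']; linear_combination a * k3 - b * k1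
  have eC : C = a / (a*c-b^2) := by rw [eq_div_iff hΔ.ne']; linear_combination a * k4 - b * k2
  have hac : a ≤ c := by rw [eA, eC, div_le_div_iff_of_pos_right hΔ] at h2'; exact h2'
  have hb : |b| ≤ a / 2 := by
    have v1 : 0 ≤ (2 * b + a) / (a*c-b^2) := by
      have : (2 * b + a) / (a*c-b^2) = -(2 * 1 * B) + 1^2 * C := by rw [eB, eC]; ring
      rw [this]; exact u1
    have v2 : 0 ≤ (-2 * b + a) / (a*c-b^2) := by
      have : (-2 * b + a) / (a*c-b^2) = -(2 * (-1) * B) + (-1)^2 * C := by rw [eB, eC]; ring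
      rw [this]; exact u2
    have v1 := (div_nonneg_iff.1 v1).elim (fun h => h.1) fun h => absurd h.2 (not_le.2 hΔ)
    have v2 := (div_nonneg_iff.1 v2).elim (fun h => h.1) fun h => absurd h.2 (not_le.2 hΔ)
    rw [abs_le]; constructor <;> linarith
  refine ⟨?_, hb, hac⟩
  have q1 : A ≤ 4 * a := by
    have r0 : X0^2 ≤ 1/4 := by nlinarith
    have r1 : X1^2 ≤ 1/4 := by nlinarith
    have r2 : 2 * X0 * X1 * B ≤ C / 4 := by
      have : |2 * X0 * X1 * B| ≤ 2 * (1/2) * (1/2) * (C/2) := by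
        simp only [abs_mul, abs_two]
        gcongr
        · exact abs_le.2 x0
        · exact abs_le.2 x1
        · rw [abs_le]; constructor <;> linarith
      linarith [le_abs_self (2 * X0 * X1 * B)]
    nlinarith
  have q2 : 1 ≤ A * a := by
    have : b * B ≤ 0 := by rw [eB]; have : b * (-b / (a*c-b^2)) = -(b^2 / (a*c-b^2)) := by ring
                           rw [this]; have := div_nonneg (sq_nonneg b) hΔ.le; linarith
    linarith
  by_contra hc
  nlinarith

end SS

namespace SS
open MeasureTheory
section abs
variable {X Λ : Type} [Group X] [TopologicalSpace X] [IsTopologicalGroup X] [MeasurableSpace X] [BorelSpace X]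
  [SecondCountableTopology X] [Group Λ] [Countable Λ] {κ : Λ →* X} {μ : Measure X} [μ.IsMulLeftInvariant]
  {ψ : X → ENNReal}

lemma wd (hψ : Measurable ψ) {f : X → ENNReal} (hf : Measurable f) :
    ∫⁻ g, f g ∂(μ.withDensity ψ) = ∫⁻ g, ψ g * f g ∂μ := lintegral_withDensity_eq_lintegral_mul _ hψ hf

lemma U0 (hψ : Measurable ψ) (h1 : ∀ g, ∑' γ, ψ (κ γ * g) = 1) {φ f : X → ENNReal}
    (hφ : Measurable φ) (hf : Measurable f) (hi : ∀ γ g, f (κ γ * g) = f g) :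
    ∫⁻ g, φ g * f g ∂μ = ∫⁻ g, f g * ∑' γ : Λ, φ (κ γ⁻¹ * g) ∂(μ.withDensity ψ) := by
  have m : ∀ γ : Λ, Measurable fun g => φ (κ γ⁻¹ * g) := fun γ => hφ.comp (measurable_const_mul _)
  have m' : ∀ γ : Λ, Measurable fun g => ψ (κ γ * g) := fun γ => hψ.comp (measurable_const_mul _)
  rw [wd hψ (f := fun g => f g * ∑' γ : Λ, φ (κ γ⁻¹ * g)) (hf.mul (Measurable.tsum m))]
  calc _ = ∫⁻ g, ∑' γ : Λ, ψ (κ γ * g) * (φ g * f g) ∂μ := by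
        simp only [ENNReal.tsum_mul_right, h1, one_mul]
    _ = ∑' γ : Λ, ∫⁻ g, ψ (κ γ * g) * (φ g * f g) ∂μ :=
        lintegral_tsum fun γ => ((m' γ).mul (hφ.mul hf)).aemeasurable
    _ = ∑' γ : Λ, ∫⁻ g, ψ g * (φ (κ γ⁻¹ * g) * f g) ∂μ := by
        refine tsum_congr fun γ => ?_
        rw [← lintegral_mul_left_eq_self (fun g => ψ g * (φ (κ γ⁻¹ * g) * f g)) (κ γ)]
        refine lintegral_congr fun g => ?_
        rw [hi, ← mul_assoc (κ γ⁻¹), ← map_mul]; simp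
    _ = _ := by
        refine (lintegral_tsum fun γ : Λ => (hψ.mul ((m γ).mul hf)).aemeasurable).symm.trans ?_
        refine lintegral_congr fun g => ?_
        simp only [Pi.mul_apply, ENNReal.tsum_mul_left, ENNReal.tsum_mul_right]
        ring

lemma U1 (hψ : Measurable ψ) (h1 : ∀ g, ∑' γ, ψ (κ γ * g) = 1) {f : X → ENNReal}
    (hf : Measurable f) (hi : ∀ γ g, f (κ γ * g) = f g) {h : X} (hh : Measure.map (· * h) μ = μ) :
    ∫⁻ g, f (g * h) ∂(μ.withDensity ψ) = ∫⁻ g, f g ∂(μ.withDensity ψ) := by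
  have mh : Measurable fun g : X => g * h := measurable_mul_const h
  rw [wd hψ (f := fun g => f (g * h)) (hf.comp mh)]
  have e : ∫⁻ g, ψ g * f (g * h) ∂μ = ∫⁻ g, ψ (g * h⁻¹) * f g ∂μ := by
    conv_rhs => rw [← hh]
    refine Eq.trans ?_ (lintegral_map ((hψ.comp (measurable_mul_const h⁻¹)).mul hf) mh).symm
    simp
  refine e.trans ?_
  refine (U0 hψ h1 (hψ.comp (measurable_mul_const h⁻¹)) hf hi).trans ?_
  refine lintegral_congr fun g => ?_
  rw [← (Equiv.inv Λ).tsum_eq]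
  simp only [Function.comp, mul_assoc]
  simp [h1]

lemma U2 (hψ : Measurable ψ) (h1 : ∀ g, ∑' γ, ψ (κ γ * g) = 1) {f : X → ENNReal}
    (hf : Measurable f) (hi : ∀ γ g, f (κ γ * g) = f g) {S : Set X} (hS : MeasurableSet S)
    (hs : ∀ g, ∃ γ, κ γ * g ∈ S) : ∫⁻ g, f g ∂(μ.withDensity ψ) ≤ ∫⁻ g in S, f g ∂μ := by
  have : ∫⁻ g in S, f g ∂μ = ∫⁻ g, S.indicator 1 g * f g ∂μ := by
    rw [← lintegral_indicator hS]; refine lintegral_congr fun g => ?_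
    by_cases h : g ∈ S <;> simp [h]
  rw [this, U0 hψ h1 (measurable_one.indicator hS) hf hi]
  refine lintegral_mono fun g => le_mul_of_one_le_right' ?_
  obtain ⟨γ, hγ⟩ := hs g
  refine le_trans ?_ (ENNReal.le_tsum γ⁻¹)
  simp [hγ]

lemma U3' (hψ : Measurable ψ) (h1 : ∀ g, ∑' γ, ψ (κ γ * g) = 1) {f : X → ENNReal}
    (hf : Measurable f) (hi : ∀ γ g, f (κ γ * g) = f g) (h0 : ∫⁻ g, f g ∂(μ.withDensity ψ) = 0) :
    f =ᵐ[μ] 0 := by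
  rw [lintegral_eq_zero_iff hf] at h0
  have := U0 (μ := μ) (φ := 1) hψ h1 measurable_one hf hi
  rw [← lintegral_eq_zero_iff hf]
  simp only [Pi.one_apply, one_mul] at this
  rw [this, ← lintegral_zero (μ := μ.withDensity ψ)]
  refine lintegral_congr_ae ?_
  filter_upwards [h0] with g hg
  simp only [Pi.zero_apply] at *
  rw [hg, zero_mul]

lemma U4 (hψ : Measurable ψ) (h1 : ∀ g, ∑' γ, ψ (κ γ * g) = 1) {f : X → ℝ}
    (hf : Continuous f) (hi : ∀ γ g, f (κ γ * g) = f g) {h : X} (hh : Measure.map (· * h) μ = μ)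
    (hI : Integrable f (μ.withDensity ψ)) : Integrable (fun g => f (g * h)) (μ.withDensity ψ) ∧
    ∫ g, f (g * h) ∂(μ.withDensity ψ) = ∫ g, f g ∂(μ.withDensity ψ) := by
  have mh : Continuous fun g : X => g * h := continuous_mul_const h
  have k : ∀ F : ℝ → ENNReal, Measurable F → ∫⁻ g, F (f (g * h)) ∂(μ.withDensity ψ) = ∫⁻ g, F (f g) ∂(μ.withDensity ψ) :=
    fun F hF => U1 (f := fun g => F (f g)) hψ h1 (hF.comp hf.measurable) (fun γ g => by simp only [hi]) hh
  have I2 : Integrable (fun g => f (g * h)) (μ.withDensity ψ) := by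
    refine ⟨(hf.comp mh).measurable.aestronglyMeasurable, ?_⟩
    have := hI.2
    rw [HasFiniteIntegral] at *
    rwa [k (fun x => ‖x‖ₑ) (by fun_prop)]
  refine ⟨I2, ?_⟩
  rw [integral_eq_lintegral_pos_part_sub_lintegral_neg_part I2, integral_eq_lintegral_pos_part_sub_lintegral_neg_part hI,
    k (fun x => ENNReal.ofReal x) (by fun_prop), k (fun x => ENNReal.ofReal (-x)) (by fun_prop)]

lemma U5 [SFinite μ] (hψ : Measurable ψ) (h1 : ∀ g, ∑' γ, ψ (κ γ * g) = 1) {f f' : X → ℝ}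
    (hf : Continuous f) (hi : ∀ γ g, f (κ γ * g) = f g) (hf' : Continuous f') (hi' : ∀ γ g, f' (κ γ * g) = f' g)
    (hI : Integrable f (μ.withDensity ψ)) (hI' : Integrable f' (μ.withDensity ψ))
    {h : ℝ → X} (hc : Continuous h) (h0 : h 0 = 1) (ha : ∀ s t, h (s + t) = h s * h t)
    (hh : ∀ t, Measure.map (· * h t) μ = μ)
    (hd : ∀ g, HasDerivAt (fun t => f (g * h t)) (f' g) 0) : ∫ g, f' g ∂(μ.withDensity ψ) = 0 := by
  set ν := μ.withDensity ψ
  have d : ∀ g s, HasDerivAt (fun t => f (g * h t)) (f' (g * h s)) s := fun g s => by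
    have := hd (g * h s)
    have e := HasDerivAt.comp_sub_const s s (f := fun t => f (g * h s * h t)) (f' := f' (g * h s)) (by simpa using this)
    have e2 : (fun t => f (g * h t)) = fun t => f (g * h s * h (t - s)) := by
      ext t; rw [mul_assoc, ← ha]; simp
    rw [e2]; exact e
  have c2 : Continuous fun p : X × ℝ => f' (p.1 * h p.2) := by fun_prop
  have F : ∀ g, f (g * h 1) - f g = ∫ s in (0:ℝ)..1, f' (g * h s) := fun g => by
    rw [intervalIntegral.integral_eq_sub_of_hasDerivAt (fun s _ => d g s)
      ((hf'.comp (by fun_prop)).intervalIntegrable _ _)]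
    simp [h0]
  have A := U4 hψ h1 hf hi (hh 1) hI
  have B : ∫ g, (f (g * h 1) - f g) ∂ν = 0 := by
    rw [integral_sub A.1 hI, A.2, sub_self]
  simp only [F, intervalIntegral.integral_of_le zero_le_one] at B
  rw [integral_integral_swap] at B
  · have e : ∀ s, ∫ g, f' (g * h s) ∂ν = ∫ g, f' g ∂ν := fun s => (U4 hψ h1 hf' hi' (hh s) hI').2
    simp only [e] at B
    simpa using B
  · refine (integrable_prod_iff' c2.aestronglyMeasurable).2 ?_
    refine ⟨Eventually.of_forall fun s => (U4 hψ h1 hf' hi' (hh s) hI').1, ?_⟩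
    have : ∀ s, ∫ g, ‖f' (g * h s)‖ ∂ν = ∫ g, ‖f' g‖ ∂ν := fun s =>
      (U4 (f := fun g => ‖f' g‖) hψ h1 hf'.norm (fun γ g => by simp only [hi']) (hh s) hI'.norm).2
    simp only [Function.uncurry, this]
    exact integrable_const _
end abs
end SS

namespace SS
open MeasureTheory

instance : MeasurableSpace G := borel G
instance : BorelSpace G := ⟨rfl⟩
lemma G_emb : IsClosedEmbedding (Subtype.val : G → Matrix (Fin 2 ⊕ Fin 2) (Fin 2 ⊕ Fin 2) ℝ) := by
  refine IsClosed.isClosedEmbedding_subtypeVal ?_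
  exact isClosed_eq (f := fun A => A * J (Fin 2) ℝ * Aᵀ) (by fun_prop) continuous_const
instance : SecondCountableTopology G :=
  haveI : SecondCountableTopology (Matrix (Fin 2 ⊕ Fin 2) (Fin 2 ⊕ Fin 2) ℝ) := inferInstanceAs (SecondCountableTopology (Fin 2 ⊕ Fin 2 → Fin 2 ⊕ Fin 2 → ℝ))
  G_emb.isEmbedding.secondCountableTopology
instance : Countable GZ :=
  haveI : Countable (Matrix (Fin 2 ⊕ Fin 2) (Fin 2 ⊕ Fin 2) ℤ) := inferInstanceAs (Countable (Fin 2 ⊕ Fin 2 → Fin 2 ⊕ Fin 2 → ℤ))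
  inferInstanceAs (Countable (Subtype _))
instance : IsTopologicalGroup G where
  continuous_inv := by
    rw [continuous_induced_rng]
    have : (Subtype.val ∘ fun a : G => a⁻¹) = fun a : G => -J (Fin 2) ℝ * (a.1)ᵀ * J (Fin 2) ℝ := by
      ext1 a; exact SymplecticGroup.coe_inv a
    rw [this]; fun_prop
instance : LocallyCompactSpace G :=
  haveI : LocallyCompactSpace (Matrix (Fin 2 ⊕ Fin 2) (Fin 2 ⊕ Fin 2) ℝ) := inferInstanceAs (LocallyCompactSpace (Fin 2 ⊕ Fin 2 → Fin 2 ⊕ Fin 2 → ℝ))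
  G_emb.locallyCompactSpace
def μ : Measure G := Measure.haar
instance : μ.IsHaarMeasure := inferInstanceAs (Measure.haar.IsHaarMeasure)

lemma g_cont (i k) : Continuous fun g : G => g.1 i k := (continuous_subtype_val (p := fun A => A ∈ Matrix.symplecticGroup (Fin 2) ℝ)).matrix_elem i k
lemma nm_cont : Continuous nm := continuous_finsetSum _ fun i _ => continuous_finsetSum _ fun k _ => (g_cont i k).pow 2
def D0 : Set G := {g | ∀ γ : GZ, nm g ≤ nm (ι γ * g)}
lemma D0_meas : MeasurableSet D0 := by
  have : D0 = ⋂ γ : GZ, {g | nm g ≤ nm (ι γ * g)} := by ext; simp [D0]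
  rw [this]
  exact (isClosed_iInter fun γ => isClosed_le nm_cont (nm_cont.comp (continuous_const_mul _))).measurableSet
def ND (g : G) : ENNReal := ∑' γ : GZ, D0.indicator 1 (ι γ * g)
def ψ (g : G) : ENNReal := D0.indicator 1 g * (ND g)⁻¹
lemma ψ_meas : Measurable ψ :=
  (measurable_one.indicator D0_meas).mul (Measurable.tsum fun γ : GZ =>
    (measurable_one.indicator D0_meas).comp (measurable_const_mul (ι γ))).inv
lemma ND_inv (γ : GZ) (g : G) : ND (ι γ * g) = ND g := by
  unfold ND
  rw [← (Equiv.mulRight γ).tsum_eq (fun γ' => D0.indicator (1 : G → ENNReal) (ι γ' * g))]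
  simp [mul_assoc]
lemma ψ_sum (g : G) : ∑' γ : GZ, ψ (ι γ * g) = 1 := by
  simp only [ψ, ND_inv]
  rw [ENNReal.tsum_mul_right]
  refine ENNReal.mul_inv_cancel ?_ ?_
  · obtain ⟨γ, h1, h2⟩ := Set.exists_min_image _ (fun γ => nm (ι γ * g)) (nm_fin g (nm g)) ⟨1, by simp⟩
    have : ι γ * g ∈ D0 := fun γ' => by
      rw [← mul_assoc, ← map_mul]
      by_cases h : nm (ι (γ' * γ) * g) ≤ nm g
      · exact h2 _ h
      · exact (show nm (ι γ * g) ≤ nm g from h1).trans (not_le.1 h).le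
    refine ne_of_gt (lt_of_lt_of_le zero_lt_one (le_trans ?_ (ENNReal.le_tsum γ)))
    simp [this]
  · have hf : {γ : GZ | ι γ * g ∈ D0}.Finite := (nm_fin g (nm g)).subset fun γ h => by
      have := h γ⁻¹
      rw [← mul_assoc, ← map_mul] at this; simpa using this
    rw [tsum_eq_sum (s := hf.toFinset) (fun γ h => by simpa using h)]
    refine ENNReal.sum_ne_top.2 fun γ _ => ?_
    by_cases h : ι γ * g ∈ D0 <;> simp [h]

lemma right_inv {h k : G} (e : k * h * k⁻¹ = h⁻¹) : Measure.map (· * h) μ = μ := by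
  rw [Measure.map_right_mul_eq_modularCharacterFun_smul]
  have h1 : Measure.modularCharacterFun h * Measure.modularCharacterFun h = 1 := by
    have e1 := congrArg Measure.modularCharacterFun (show k * h * k⁻¹ * h = 1 by rw [e]; simp)
    have e2 := congrArg Measure.modularCharacterFun (mul_inv_cancel k)
    simp only [Measure.modularCharacterFun_map_mul, Measure.modularCharacterFun_map_one] at e1 e2
    calc _ = (Measure.modularCharacterFun k * Measure.modularCharacterFun k⁻¹) * (Measure.modularCharacterFun h * Measure.modularCharacterFun h) := by rw [e2, one_mul]
      _ = _ := by rw [← e1]; ring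
  have : Measure.modularCharacterFun h = 1 := by
    have := mul_self_eq_one_iff.1 (congrArg NNReal.toReal h1)
    rcases this with h' | h'
    · exact NNReal.coe_injective h'
    · have := NNReal.coe_nonneg (Measure.modularCharacterFun h)
      have h2 := this.trans_eq h'
      norm_num at h2
  rw [this, one_smul]

/-! continuity -/
lemma dn_cont (i k) : Continuous fun g : G => dn g i0 i k := by
  simp only [dn, gc, gd, cm, i0, mat, Matrix.mul_apply, Matrix.add_apply, Matrix.map_apply, toBlocks₂₁, toBlocks₂₂, Fin.sum_univ_two, of_apply, ofRealHom_eq_coe]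
  have h := fun i k => Complex.continuous_ofReal.comp (g_cont i k)
  exact (((h _ _).mul continuous_const).add ((h _ _).mul continuous_const)).add (h _ _)
lemma num_cont (i k) : Continuous fun g : G => num g i0 i k := by
  simp only [num, ga, gb, cm, i0, mat, Matrix.mul_apply, Matrix.add_apply, Matrix.map_apply, toBlocks₁₁, toBlocks₁₂, Fin.sum_univ_two, of_apply, ofRealHom_eq_coe]
  have h := fun i k => Complex.continuous_ofReal.comp (g_cont i k)
  exact (((h _ _).mul continuous_const).add ((h _ _).mul continuous_const)).add (h _ _)
lemma det_cont : Continuous fun g : G => (dn g i0).det⁻¹ := by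
  refine Continuous.inv₀ ?_ fun g => dn_ne g i0_mem
  simp only [det_fin_two]
  have := dn_cont
  exact ((this 0 0).mul (this 1 1)).sub ((this 0 1).mul (this 1 0))
def N (g : G) : M2 := ((dn g i0)⁻¹)ᵀ
lemma N_e (g : G) : N g 0 0 = (dn g i0).det⁻¹ * dn g i0 1 1 ∧ N g 0 1 = -(dn g i0).det⁻¹ * dn g i0 1 0 ∧
    N g 1 0 = -(dn g i0).det⁻¹ * dn g i0 0 1 ∧ N g 1 1 = (dn g i0).det⁻¹ * dn g i0 0 0 := by
  simp [N, Matrix.inv_def, adjugate_fin_two]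
lemma N_cont (i k) : Continuous fun g : G => N g i k := by
  have h := dn_cont
  have hd := det_cont
  fin_cases i <;> fin_cases k <;> simp only [N_e, Fin.zero_eta, Fin.mk_one]
  exacts [hd.mul (h _ _), hd.neg.mul (h _ _), hd.neg.mul (h _ _), hd.mul (h _ _)]
lemma act_N (g : G) (i k) : act g i0 i k = num g i0 i 0 * N g k 0 + num g i0 i 1 * N g k 1 := by
  simp [act, N, Matrix.mul_apply]
lemma wg_cont (k) : Continuous fun g : G => wg g k := by
  have h := num_cont
  have h' := N_cont
  fin_cases k <;> simp [wg, act_N] <;> exact ((h _ _).mul (h' _ _)).add ((h _ _).mul (h' _ _))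

lemma Krel1 (g : G) :
    ‖num g i0 1 0‖^2 + ‖num g i0 1 1‖^2 = (wg g 1).re^2 * kA g + 2 * (wg g 1).re * (wg g 2).re * kB g + (wg g 2).re^2 * kC g + yy g 2 := by
  have h := Y_K g
  have h00 := congrFun (congrFun h 0) 0
  have h01 := congrFun (congrFun h 0) 1
  have h10 := congrFun (congrFun h 1) 0
  have h11 := congrFun (congrFun h 1) 1
  rw [(num_e g 0).2, (num_e g 1).2]
  have hy0 : 0 < yy g 0 := (U3_iff.1 (wg_mem g)).1
  simp [Matrix.mul_apply, Fin.sum_univ_two, Complex.ext_iff] at h00 h01 h10 h11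
  simp only [kA, kB, kC, nsq]
  simp
  have e : (dn g i0 0 0).re * (dn g i0 1 0).im - (dn g i0 0 0).im * (dn g i0 1 0).re + ((dn g i0 0 1).re * (dn g i0 1 1).im - (dn g i0 0 1).im * (dn g i0 1 1).re) = 0 := by
    have := h01.2
    apply mul_left_cancel₀ hy0.ne'
    linarith
  obtain ⟨h10, -⟩ := h10
  obtain ⟨h11, -⟩ := h11
  simp only [show (wg g 1).im = yy g 1 from rfl, show (wg g 2).im = yy g 2 from rfl]
  linear_combination yy g 1 * h10 + yy g 2 * h11 - 2 * ((wg g 1).re * yy g 2 - yy g 1 * (wg g 2).re) * e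

lemma nrm_P (g : G) : nrm g (Sum.inl 0) = ‖num g i0 0 0‖^2 + ‖num g i0 0 1‖^2 ∧ nrm g (Sum.inl 1) = ‖num g i0 1 0‖^2 + ‖num g i0 1 1‖^2 := by
  constructor <;> simp [nrm, nsq, num, i0, mat, ga, gb, cm, Matrix.mul_apply, Fin.sum_univ_two, toBlocks₁₁, toBlocks₁₂] <;> ring

lemma SS1_bd {g : G} (h : SS1 g) : 3/4 * yy g 0 * kA g ≤ 1 ∧ 3/4 * yy g 2 * kC g ≤ 1 ∧ nrm g (Sum.inl 0) ≤ 10 * yy g 0 ∧ nrm g (Sum.inl 1) ≤ 10 * yy g 2 := by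
  obtain ⟨⟨a1, a2, a3⟩, hx⟩ := h
  obtain ⟨k1, k2, k3, k4, k5⟩ := Krel g
  have k6 := Krel1 g
  rw [(nrm_P g).1, (nrm_P g).2, k5, k6]
  simp only [show ∀ k, (wg g k).im = yy g k from fun _ => rfl] at *
  have hA : 0 ≤ kA g := by unfold kA; positivity
  have hC : 0 ≤ kC g := by unfold kC; positivity
  generalize kA g = A at *; generalize kB g = B at *; generalize kC g = C at *
  generalize yy g 0 = y0 at *; generalize yy g 1 = y1 at *; generalize yy g 2 = y2 at *
  have p0 : 0 < y0 := by linarith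
  have p2 : 0 < y2 := by linarith
  have q : y1^2 ≤ y0^2/4 := by rw [← sq_abs]; linarith [pow_le_pow_left₀ (abs_nonneg y1) a2 2, div_pow y0 2 2]
  have q1 : y1^2 ≤ y0*y2/4 := by linarith [mul_le_mul_of_nonneg_left a3 p0.le, sq y0]
  have c1 : 3/4 * y0 * A ≤ 1 := by
    have e : y2 * (y0 * A - 1) = y1^2 * A := by linear_combination y2 * k1 - y1 * k3
    have : y2 * (3/4 * y0 * A) ≤ y2 * 1 := by linarith [mul_le_mul_of_nonneg_right q1 hA]
    exact le_of_mul_le_mul_left this p2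
  have c2 : 3/4 * y2 * C ≤ 1 := by
    have e : y0 * (y2 * C - 1) = y1^2 * C := by linear_combination y0 * k4 - y1 * k2
    have : y0 * (3/4 * y2 * C) ≤ y0 * 1 := by linarith [mul_le_mul_of_nonneg_right q1 hC]
    exact le_of_mul_le_mul_left this p0
  have bA : A ≤ 10/3 := by linarith [mul_le_mul_of_nonneg_right a1 hA]
  have bC : C ≤ 10/3 := by linarith [mul_le_mul_of_nonneg_right (a1.trans a3) hC]
  have bB : 2 * |B| ≤ C := by
    have e : y0 * B = - (y1 * C) := by linarith
    have e2 : y0 * |B| = |y1| * C := by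
      rw [← abs_of_pos p0, ← abs_mul, e, abs_neg, abs_mul, abs_of_nonneg hC]
    have : y0 * (2 * |B|) ≤ y0 * C := by linarith [mul_le_mul_of_nonneg_right a2 hC]
    exact le_of_mul_le_mul_left this p0
  have key : ∀ x x' : ℝ, |x| ≤ 1/2 → |x'| ≤ 1/2 → x^2*A + 2*x*x'*B + x'^2*C ≤ 10/3 := by
    intro x x' hx hx'
    have f1 : x^2 ≤ 1/4 := by rw [← sq_abs]; linarith [pow_le_pow_left₀ (abs_nonneg x) hx 2]
    have f2 : x'^2 ≤ 1/4 := by rw [← sq_abs]; linarith [pow_le_pow_left₀ (abs_nonneg x') hx' 2]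
    have f3 : x*x'*B ≤ 1/4 * |B| := by
      refine (le_abs_self _).trans ?_
      rw [abs_mul, abs_mul]
      exact mul_le_mul_of_nonneg_right (by linarith [mul_le_mul hx hx' (abs_nonneg _) (by norm_num)]) (abs_nonneg _)
    linarith [mul_le_mul_of_nonneg_right f1 hA, mul_le_mul_of_nonneg_right f2 hC]
  exact ⟨c1, c2, by linarith [key _ _ (hx 0) (hx 1)], by linarith [key _ _ (hx 1) (hx 2)]⟩

def Kp : Set G := {g | ∀ i k, g.1 i k ∈ Set.Icc (-4:ℝ) 4}
lemma Kp_cpt : IsCompact Kp := by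
  have h : IsCompact (Set.univ.pi fun _ : Fin 2 ⊕ Fin 2 => Set.univ.pi fun _ : Fin 2 ⊕ Fin 2 => Set.Icc (-4:ℝ) 4) :=
    isCompact_univ_pi fun _ => isCompact_univ_pi fun _ => isCompact_Icc
  have := G_emb.isCompact_preimage h
  convert this using 1
  ext g; exact ⟨fun h i _ k _ => h i k, fun h i k => h i trivial k trivial⟩

def eg (a b : ℝ) (ha : a ≠ 0) (hb : b ≠ 0) : G := ⟨fromBlocks !![a⁻¹,0;0,b⁻¹] 0 0 !![a,0;0,b], by
  rw [SymplecticGroup.fromBlocks_mem_iff]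
  refine ⟨by simp, by simp, ?_⟩
  ext i k; fin_cases i <;> fin_cases k <;> simp [ha, hb, Matrix.mul_apply, Fin.sum_univ_two]⟩

def Sp (p q : ℕ) : Set G := {g | SS1 g ∧ ((p:ℝ)^2 ≤ yy g 0 ∧ yy g 0 ≤ (p+1)^2) ∧ ((q:ℝ)^2 ≤ yy g 2 ∧ yy g 2 ≤ (q+1)^2)}
lemma SS1_cl : IsClosed {g | SS1 g} := by
  have h := wg_cont
  have hi := fun k => Complex.continuous_im.comp (h k)
  refine (((isClosed_le continuous_const (hi 0)).inter ((isClosed_le (hi 1).abs ((hi 0).div_const 2)).inter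
    (isClosed_le (hi 0) (hi 2))))).inter ?_
  have e : {g | ∀ k, |(wg g k).re| ≤ 1/2} = ⋂ k, {g | |(wg g k).re| ≤ 1/2} := by ext; simp
  change IsClosed {g | ∀ k, |(wg g k).re| ≤ 1/2}
  rw [e]
  exact isClosed_iInter fun k => isClosed_le (Complex.continuous_re.comp (h k)).abs continuous_const
lemma yy_cont (k) : Continuous fun g : G => yy g k := Complex.continuous_im.comp (wg_cont k)
lemma Sp_meas (p q) : MeasurableSet (Sp p q) := by
  have h := yy_cont
  exact (SS1_cl.inter (((isClosed_le continuous_const (h 0)).inter (isClosed_le (h 0) continuous_const)).inter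
    ((isClosed_le continuous_const (h 2)).inter (isClosed_le (h 2) continuous_const)))).measurableSet

lemma Sp_mu (p q) : μ (Sp p q) ≤ μ Kp := by
  have hp : (0:ℝ) < p + 1 := by positivity
  have hq : (0:ℝ) < q + 1 := by positivity
  rw [← measure_preimage_mul μ (eg (p+1) (q+1) hp.ne' hq.ne') Kp]
  refine measure_mono ?_
  rintro g ⟨h, ⟨p1, p2⟩, q1, q2⟩ i k
  have hr : ∀ i k, (g.1 i k)^2 ≤ nrm g i := fun i k =>
    Finset.single_le_sum (f := fun k => (g.1 i k)^2) (fun _ _ => sq_nonneg _) (Finset.mem_univ k)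
  obtain ⟨b1, b2, b3, b4⟩ := SS1_bd h
  obtain ⟨⟨a1, a2, a3⟩, hx⟩ := h
  simp only [show ∀ k, (wg g k).im = yy g k from fun _ => rfl] at *
  have n0 : 0 ≤ kA g := by unfold kA; positivity
  have n2 : 0 ≤ kC g := by unfold kC; positivity
  have s0 : ((p:ℝ)+1)^2 ≤ 7 * yy g 0 := by nlinarith [sq_nonneg ((p:ℝ)-1)]
  have s2 : ((q:ℝ)+1)^2 ≤ 7 * yy g 2 := by nlinarith [sq_nonneg ((q:ℝ)-1)]
  have key : ∀ x : ℝ, x^2 ≤ 16 → x ∈ Set.Icc (-4:ℝ) 4 := fun x hx => by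
    constructor <;> nlinarith
  apply key
  have e : (eg (p+1) (q+1) hp.ne' hq.ne' * g).1 = (eg (p+1) (q+1) hp.ne' hq.ne').1 * g.1 := rfl
  rw [e, Matrix.mul_apply]
  have r := hr i k
  rcases i with i | i <;> fin_cases i <;> simp [eg, fromBlocks] at r ⊢ <;> rw [mul_pow]
  · rw [inv_pow, inv_mul_le_iff₀ (by positivity)]; nlinarith
  · rw [inv_pow, inv_mul_le_iff₀ (by positivity)]; nlinarith
  · rw [(nrm_k g).1] at r
    nlinarith [mul_le_mul_of_nonneg_left r (sq_nonneg ((p:ℝ)+1)), mul_le_mul_of_nonneg_right s0 n0]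
  · rw [(nrm_k g).2] at r
    nlinarith [mul_le_mul_of_nonneg_left r (sq_nonneg ((q:ℝ)+1)), mul_le_mul_of_nonneg_right s2 n2]

lemma Sp_cov {g : G} (h : SS1 g) : ∃ p q, g ∈ Sp p q := by
  have a : ∀ y : ℝ, 0 ≤ y → ∃ p : ℕ, (p:ℝ)^2 ≤ y ∧ y ≤ (p+1)^2 := fun y hy => by
    refine ⟨⌊√y⌋₊, ?_, ?_⟩
    · have := Nat.floor_le (Real.sqrt_nonneg y)
      calc _ ≤ (√y)^2 := by gcongr
        _ = y := Real.sq_sqrt hy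
    · have := (Nat.lt_floor_add_one (√y)).le
      calc y = (√y)^2 := (Real.sq_sqrt hy).symm
        _ ≤ _ := by gcongr
  have h' := U3_iff.1 (wg_mem g)
  obtain ⟨p, hp⟩ := a (yy g 0) h'.1.le
  obtain ⟨q, hq⟩ := a (yy g 2) (by have := h.1; obtain ⟨a1, a2, a3⟩ := this; exact (show (0:ℝ) ≤ 2/5 by norm_num).trans (a1.trans a3))
  exact ⟨p, q, h, hp, hq⟩

lemma integ {f : G → ℝ} (hf : Continuous f) (hi : ∀ γ g, f (ι γ * g) = f g) {C δ : ℝ} (hδ : 0 < δ)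
    (hb : ∀ g, SS1 g → |f g| ≤ C * Real.exp (-δ * (yy g 0 + yy g 2))) : Integrable f (μ.withDensity ψ) := by
  refine ⟨hf.aestronglyMeasurable, ?_⟩
  have hC : 0 ≤ C := by
    obtain ⟨γ, h⟩ := reduce 1
    exact nonneg_of_mul_nonneg_left ((abs_nonneg _).trans (hb _ h)) (Real.exp_pos _)
  let a : ℕ → ENNReal := fun p => ENNReal.ofReal (Real.exp (-δ * p))
  have ha : ∑' p, a p ≠ ⊤ := by
    have : Summable fun p : ℕ => Real.exp (-δ * p) := by
      have := Real.summable_exp_nat_mul_iff (a := -δ) |>.2 (by linarith)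
      simpa [mul_comm] using this
    rw [← ENNReal.ofReal_tsum_of_nonneg (fun _ => (Real.exp_pos _).le) this]
    exact ENNReal.ofReal_ne_top
  have hle : ∀ p q, ∫⁻ g in Sp p q, ‖f g‖ₑ ∂μ ≤ (ENNReal.ofReal C * a p * a q) * μ Kp := fun p q => by
    calc _ ≤ ∫⁻ g in Sp p q, ENNReal.ofReal C * a p * a q ∂μ := by
          refine setLIntegral_mono measurable_const fun g hg => ?_
          rw [← ENNReal.ofReal_mul hC, ← ENNReal.ofReal_mul (by positivity), ← ofReal_norm]
          refine ENNReal.ofReal_le_ofReal ((hb g hg.1).trans ?_)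
          rw [mul_assoc, ← Real.exp_add]
          have c : ∀ p : ℕ, (p:ℝ) ≤ (p:ℝ)^2 := fun p => by exact_mod_cast Nat.le_self_pow two_ne_zero p
          refine mul_le_mul_of_nonneg_left (Real.exp_le_exp.2 ?_) hC
          have := hg.2.1.1; have := hg.2.2.1
          nlinarith [c p, c q]
      _ ≤ _ := by rw [setLIntegral_const]; exact mul_le_mul_right (Sp_mu p q) _
  have m : Measurable fun g => ‖f g‖ₑ := hf.measurable.enorm
  have S := U2 (μ := μ) (κ := ι) ψ_meas ψ_sum m (fun γ g => by simp only [hi]) SS1_cl.measurableSet reduce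
  refine lt_of_le_of_lt S ?_
  have S2 : {g | SS1 g} ⊆ ⋃ pq : ℕ × ℕ, Sp pq.1 pq.2 := fun g h => by
    obtain ⟨p, q, h⟩ := Sp_cov h
    exact Set.mem_iUnion.2 ⟨(p, q), h⟩
  calc _ ≤ ∫⁻ g in ⋃ pq : ℕ × ℕ, Sp pq.1 pq.2, ‖f g‖ₑ ∂μ := lintegral_mono_set S2
    _ ≤ ∑' pq : ℕ × ℕ, ∫⁻ g in Sp pq.1 pq.2, ‖f g‖ₑ ∂μ := lintegral_iUnion_le _ _
    _ ≤ ∑' pq : ℕ × ℕ, (ENNReal.ofReal C * a pq.1 * a pq.2) * μ Kp := ENNReal.tsum_le_tsum fun pq => hle _ _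
    _ = ENNReal.ofReal C * (∑' p, a p) * (∑' q, a q) * μ Kp := by
        rw [ENNReal.tsum_mul_right, ENNReal.tsum_prod']
        simp only [ENNReal.tsum_mul_left, ENNReal.tsum_mul_right]
    _ < ⊤ := by
        refine ENNReal.mul_lt_top (ENNReal.mul_lt_top (ENNReal.mul_lt_top ENNReal.ofReal_lt_top ?_) ?_) Kp_cpt.measure_lt_top
        all_goals exact lt_top_iff_ne_top.2 ha
end SS

namespace SS
open MeasureTheory

abbrev M4R := Matrix (Fin 2 ⊕ Fin 2) (Fin 2 ⊕ Fin 2) ℝ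
structure PX (X : M4R) : Prop where
  cube : X * X * X = X
  sym : Xᵀ = X
  anti : X * J (Fin 2) ℝ = -(J (Fin 2) ℝ * X)
def hm (X : M4R) (t : ℝ) : M4R := 1 + Real.sinh t • X + (Real.cosh t - 1) • (X * X)
lemma hm_add {X} (h : PX X) (s t : ℝ) : hm X (s + t) = hm X s * hm X t := by
  have c := h.cube
  have c2 : X * X * (X * X) = X * X := by rw [← mul_assoc, c]
  have c3 : X * (X * X) = X := by rw [← mul_assoc, c]
  simp only [hm, Real.sinh_add, Real.cosh_add, mul_add, add_mul, one_mul, mul_one, Matrix.smul_mul, Matrix.mul_smul, smul_smul, c, c2, c3]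
  module
lemma hm_J {X} (h : PX X) (t : ℝ) : hm X t * J (Fin 2) ℝ = J (Fin 2) ℝ * hm X (-t) := by
  have c : X * X * J (Fin 2) ℝ = J (Fin 2) ℝ * (X * X) := by
    rw [mul_assoc, h.anti, mul_neg, ← mul_assoc, h.anti]; simp [mul_assoc]
  simp only [hm, Real.sinh_neg, Real.cosh_neg, mul_add, add_mul, one_mul, mul_one, Matrix.smul_mul, Matrix.mul_smul, h.anti, c]
  module
lemma hm_zero (X) : hm X 0 = 1 := by simp [hm]
def hx (X : M4R) (h : PX X) (t : ℝ) : G := ⟨hm X t, by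
  show hm X t * J (Fin 2) ℝ * (hm X t)ᵀ = J (Fin 2) ℝ
  have : (hm X t)ᵀ = hm X t := by simp [hm, h.sym]
  rw [this, hm_J h, mul_assoc, ← hm_add h]; simp [hm_zero]⟩
lemma hx_add {X} (h : PX X) (s t : ℝ) : hx X h (s + t) = hx X h s * hx X h t := Subtype.ext (hm_add h s t)
lemma hx_zero {X} (h : PX X) : hx X h 0 = 1 := Subtype.ext (hm_zero X)
lemma hx_cont {X} (h : PX X) : Continuous (hx X h) := by
  refine continuous_induced_rng.2 ?_
  show Continuous (hm X)
  unfold hm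
  have := Real.continuous_sinh; have := Real.continuous_cosh
  fun_prop
lemma hx_right {X} (h : PX X) (t : ℝ) : Measure.map (· * hx X h t) μ = μ := by
  refine right_inv (k := SymplecticGroup.symJ (Fin 2) ℝ) ?_
  rw [mul_inv_eq_iff_eq_mul]
  have : (hx X h t)⁻¹ = hx X h (-t) := by rw [inv_eq_iff_mul_eq_one, ← hx_add]; simp [hx_zero]
  rw [this]
  refine Subtype.ext ?_
  have := hm_J h (-t)
  rw [neg_neg] at this
  exact this.symm
lemma hx_deriv {X} (h : PX X) (g : G) (i k) : HasDerivAt (fun t => (g * hx X h t).1 i k) ((g.1 * X) i k) 0 := by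
  have e : ∀ t, (g * hx X h t).1 i k = g.1 i k + Real.sinh t * (g.1 * X) i k + (Real.cosh t - 1) * (g.1 * (X * X)) i k := fun t => by
    show (g.1 * hm X t) i k = _
    simp [hm, mul_add]
  refine hdc (((Real.hasDerivAt_sinh 0).mul_const ((g.1 * X) i k)).const_add (g.1 i k) |>.add
    (((Real.hasDerivAt_cosh 0).sub_const 1).mul_const ((g.1 * (X * X)) i k))) e ?_
  simp

def Sr : Fin 3 → Matrix (Fin 2) (Fin 2) ℝ := ![!![1,0;0,0], !![0,1;1,0], !![0,0;0,1]]
def Sc (s : Fin 3) : M2 := cm (Sr s)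
lemma Sr_prop (s : Fin 3) : Sr s * Sr s * Sr s = Sr s ∧ (Sr s)ᵀ = Sr s := by
  fin_cases s <;> constructor <;> ext i k <;> fin_cases i <;> fin_cases k <;> simp [Sr, Matrix.mul_apply, Fin.sum_univ_two]
lemma P1 (s) : PX (fromBlocks 0 (Sr s) (Sr s) 0) where
  cube := by simp [fromBlocks_multiply, Sr_prop s]
  sym := by simp [fromBlocks_transpose, Sr_prop s]
  anti := by simp [J, fromBlocks_multiply, fromBlocks_neg]
lemma P2 (s) : PX (fromBlocks (Sr s) 0 0 (-Sr s)) where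
  cube := by simp [fromBlocks_multiply, Sr_prop s]
  sym := by simp [fromBlocks_transpose, Sr_prop s]
  anti := by simp [J, fromBlocks_multiply, fromBlocks_neg]
def h1 (s : Fin 3) : ℝ → G := hx _ (P1 s)
def h2 (s : Fin 3) : ℝ → G := hx _ (P2 s)

def RD (s : Fin 3) (f f' : G → ℂ) : Prop := ∀ g, HasDerivAt (fun t : ℝ => f (g * h1 s t)) (f' g) 0 ∧
  HasDerivAt (fun t : ℝ => f (g * h2 s t)) (I * f' g) 0
lemma at0 (s) (g : G) : g * h1 s 0 = g ∧ g * h2 s 0 = g := by simp [h1, h2, hx_zero]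
lemma RD.add {s f f' k k'} (hf : RD s f f') (hk : RD s k k') : RD s (fun g => f g + k g) (fun g => f' g + k' g) := fun g =>
  ⟨(hf g).1.add (hk g).1, hdc ((hf g).2.add (hk g).2) (fun _ => rfl) (by ring)⟩
lemma RD.mul {s f f' k k'} (hf : RD s f f') (hk : RD s k k') : RD s (fun g => f g * k g) (fun g => f' g * k g + f g * k' g) := fun g =>
  ⟨hdc ((hf g).1.mul (hk g).1) (fun _ => rfl) (by simp only [at0]), hdc ((hf g).2.mul (hk g).2) (fun _ => rfl) (by simp only [at0]; ring)⟩
lemma RD.const (s c) : RD s (fun _ => c) (fun _ => 0) := fun g => ⟨hasDerivAt_const _ _, by simpa using hasDerivAt_const (0:ℝ) c⟩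
lemma RD.inv {s f f'} (hf : RD s f f') (h0 : ∀ g, f g ≠ 0) : RD s (fun g => (f g)⁻¹) (fun g => -f' g * (f g)⁻¹^2) := fun g =>
  ⟨hdc ((hf g).1.inv (h0 _)) (fun _ => rfl) (by simp only [at0]; field_simp), hdc ((hf g).2.inv (h0 _)) (fun _ => rfl) (by simp only [at0]; field_simp)⟩
lemma RD.congr {s f f' k k'} (hf : RD s f f') (e : ∀ g, k g = f g) (e' : ∀ g, k' g = f' g) : RD s k k' := by
  obtain rfl : k = f := funext e
  obtain rfl : k' = f' := funext e'
  exact hf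

def PP (g : G) : ℝ := yy g 0 + yy g 2
lemma PP_pos {g} (h : SS1 g) : 0 < PP g := by
  obtain ⟨⟨a, b, c⟩, -⟩ := h
  simp only [show ∀ k, (wg g k).im = yy g k from fun _ => rfl] at *
  unfold PP; linarith
def Cl (e : ℕ) (f : G → ℂ) : Prop := Continuous f ∧ ∃ C : ℝ, ∃ M : ℕ, 0 ≤ C ∧ ∀ g, SS1 g → ‖f g‖ ≤ C * (1 + PP g)^M * Real.exp (-(e * (Real.pi/4)) * PP g)
lemma Cl.add {e f k} (hf : Cl e f) (hk : Cl e k) : Cl e (fun g => f g + k g) := by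
  obtain ⟨c, C, M, hC, hb⟩ := hf
  obtain ⟨c', C', M', hC', hb'⟩ := hk
  refine ⟨c.add c', C + C', M + M', by positivity, fun g hg => (norm_add_le _ _).trans ?_⟩
  have hP := PP_pos hg
  have b := (hb g hg).trans (mul_le_mul_of_nonneg_right (mul_le_mul_of_nonneg_left (pow_le_pow_right₀ (by linarith : 1 ≤ 1 + PP g) (Nat.le_add_right M M')) hC) (Real.exp_pos _).le)
  have b' := (hb' g hg).trans (mul_le_mul_of_nonneg_right (mul_le_mul_of_nonneg_left (pow_le_pow_right₀ (by linarith : 1 ≤ 1 + PP g) (Nat.le_add_left M' M)) hC') (Real.exp_pos _).le)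
  linarith
lemma Cl.mul {e e' f k} (hf : Cl e f) (hk : Cl e' k) : Cl (e + e') (fun g => f g * k g) := by
  obtain ⟨c, C, M, hC, hb⟩ := hf
  obtain ⟨c', C', M', hC', hb'⟩ := hk
  refine ⟨c.mul c', C * C', M + M', by positivity, fun g hg => ?_⟩
  have hP := PP_pos hg
  rw [norm_mul]
  refine (mul_le_mul (hb g hg) (hb' g hg) (norm_nonneg _) (by positivity)).trans_eq ?_
  rw [show -(((e + e' : ℕ):ℝ) * (Real.pi/4)) * PP g = -(e * (Real.pi/4)) * PP g + -(e' * (Real.pi/4)) * PP g by push_cast; ring, Real.exp_add]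
  ring
lemma Cl.const (c : ℂ) : Cl 0 (fun _ => c) := ⟨continuous_const, ‖c‖, 0, norm_nonneg _, fun g _ => by simp⟩
lemma Cl.zero (e : ℕ) : Cl e (fun _ => 0) := ⟨continuous_const, 0, 0, le_rfl, fun g _ => by simp⟩
lemma Cl.conj {e f} (hf : Cl e f) : Cl e (fun g => (starRingEnd ℂ) (f g)) := by
  obtain ⟨c, C, M, hC, hb⟩ := hf
  exact ⟨Complex.continuous_conj.comp c, C, M, hC, fun g hg => by simpa using hb g hg⟩
lemma Cl.sum {κ : Type} {e} (F : Finset κ) {f : κ → G → ℂ} (h : ∀ i ∈ F, Cl e (f i)) : Cl e (fun g => ∑ i ∈ F, f i g) := by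
  classical
  induction F using Finset.induction_on with
  | empty => simpa using Cl.zero e
  | insert i F hi ih =>
    simp only [Finset.sum_insert hi]
    exact (h i (by simp)).add (ih fun i hi => h i (by simp [hi]))
lemma Cl.pow {f} (hf : Cl 0 f) (n : ℕ) : Cl 0 (fun g => f g ^ n) := by
  induction n with
  | zero => simpa using Cl.const 1
  | succ n ih => simp only [pow_succ]; exact ih.mul hf

lemma Cl.integ {f} (hf : Cl 2 f) (hi : ∀ γ g, f (ι γ * g) = f g) : Integrable (fun g => (f g).re) (μ.withDensity ψ) ∧
    Integrable (fun g => (f g).im) (μ.withDensity ψ) := by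
  obtain ⟨c, C, M, hC, hb⟩ := hf
  have hp := Real.pi_gt_three
  have b : ∀ g, SS1 g → ‖f g‖ ≤ C * M.factorial * Real.exp 1 * Real.exp (-(Real.pi/2-1) * (yy g 0 + yy g 2)) := fun g hg => by
    refine (hb g hg).trans ?_
    have hP := PP_pos hg
    have := Real.pow_div_factorial_le_exp (1 + PP g) (by linarith) M
    rw [div_le_iff₀ (by positivity)] at this
    calc _ ≤ C * (Real.exp (1 + PP g) * M.factorial) * Real.exp (-((2:ℕ) * (Real.pi/4)) * PP g) := by gcongr
      _ = C * M.factorial * (Real.exp (1 + PP g) * Real.exp (-((2:ℕ) * (Real.pi/4)) * PP g)) := by ring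
      _ = C * M.factorial * (Real.exp 1 * Real.exp (-(Real.pi/2-1) * PP g)) := by
          rw [← Real.exp_add, ← Real.exp_add]; congr 2; push_cast; ring
      _ = _ := by unfold PP; ring
  exact ⟨SS.integ (Complex.continuous_re.comp c) (fun γ g => by simp only [hi]) (by linarith) fun g hg => (Complex.abs_re_le_norm _).trans (b g hg),
    SS.integ (Complex.continuous_im.comp c) (fun γ g => by simp only [hi]) (by linarith) fun g hg => (Complex.abs_im_le_norm _).trans (b g hg)⟩

lemma inv_deriv {X} (h : PX X) {f f' : G → ℂ} (hi : ∀ γ g, f (ι γ * g) = f g) (hd : ∀ g, HasDerivAt (fun t => f (g * hx X h t)) (f' g) 0)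
    (γ g) : f' (ι γ * g) = f' g := by
  refine (hd (ι γ * g)).unique ?_
  simpa only [mul_assoc, hi] using hd g

lemma int_zero {X} (h : PX X) {f f' : G → ℂ} (hf : Cl 2 f) (hf' : Cl 2 f') (hi : ∀ γ g, f (ι γ * g) = f g)
    (hd : ∀ g, HasDerivAt (fun t => f (g * hx X h t)) (f' g) 0) :
    ∫ g, (f' g).re ∂(μ.withDensity ψ) = 0 ∧ ∫ g, (f' g).im ∂(μ.withDensity ψ) = 0 := by
  have hi' := inv_deriv h hi hd
  have I1 := hf.integ hi
  have I2 := hf'.integ hi'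
  constructor
  · refine U5 (κ := ι) ψ_meas ψ_sum (Complex.continuous_re.comp hf.1) (fun γ g => by simp [hi]) (Complex.continuous_re.comp hf'.1) (fun γ g => by simp [hi']) I1.1 I2.1
      (hx_cont h) (hx_zero h) (hx_add h) (hx_right h) fun g => ?_
    exact (Complex.reCLM.hasFDerivAt.comp_hasDerivAt (0:ℝ) (hd g))
  · refine U5 (κ := ι) ψ_meas ψ_sum (Complex.continuous_im.comp hf.1) (fun γ g => by simp [hi]) (Complex.continuous_im.comp hf'.1) (fun γ g => by simp [hi']) I1.2 I2.2
      (hx_cont h) (hx_zero h) (hx_add h) (hx_right h) fun g => ?_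
    exact (Complex.imCLM.hasFDerivAt.comp_hasDerivAt (0:ℝ) (hd g))
end SS

namespace SS
open MeasureTheory

def RDm (s : Fin 3) (F F' : G → M2) : Prop := ∀ i k, RD s (fun g => F g i k) (fun g => F' g i k)
lemma RDm.mul {s F F' K K'} (h : RDm s F F') (h' : RDm s K K') : RDm s (fun g => F g * K g) (fun g => F' g * K g + F g * K' g) := fun i k =>
  (((h i 0).mul (h' 0 k)).add ((h i 1).mul (h' 1 k))).congr (fun g => by simp [Matrix.mul_apply, Fin.sum_univ_two])
    (fun g => by simp [Matrix.mul_apply, Fin.sum_univ_two]; ring)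
lemma RDm.tr {s F F'} (h : RDm s F F') : RDm s (fun g => (F g)ᵀ) (fun g => (F' g)ᵀ) := fun i k => h k i

def cj (m : M2) : M2 := m.map (starRingEnd ℂ)
lemma cj_mul (a b : M2) : cj (a * b) = cj a * cj b := Matrix.map_mul
lemma cj_one : cj 1 = 1 := by simp [cj]

lemma dn_entry (g : G) (i k) : dn g i0 i k = I * g.1 (Sum.inr i) (Sum.inl k) + g.1 (Sum.inr i) (Sum.inr k) := by
  fin_cases k <;> simp [dn, gc, gd, cm, i0, mat, Matrix.mul_apply, Fin.sum_univ_two, toBlocks₂₁, toBlocks₂₂] <;> ring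
lemma num_entry (g : G) (i k) : num g i0 i k = I * g.1 (Sum.inl i) (Sum.inl k) + g.1 (Sum.inl i) (Sum.inr k) := by
  fin_cases k <;> simp [num, ga, gb, cm, i0, mat, Matrix.mul_apply, Fin.sum_univ_two, toBlocks₁₁, toBlocks₁₂] <;> ring

lemma RD_entry (s i k) : RD s (fun g => I * g.1 i (Sum.inl k) + g.1 i (Sum.inr k))
    (fun g => ∑ l, I * (starRingEnd ℂ) (I * g.1 i (Sum.inl l) + g.1 i (Sum.inr l)) * Sc s l k) := fun g => by
  have key : ∀ X (h : PX X), HasDerivAt (fun t : ℝ => I * ((g * hx X h t).1 i (Sum.inl k) : ℂ) + ((g * hx X h t).1 i (Sum.inr k) : ℂ))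
      (I * ((g.1 * X) i (Sum.inl k) : ℝ) + ((g.1 * X) i (Sum.inr k) : ℝ)) 0 := fun X h =>
    ((hx_deriv h g i _).ofReal_comp.const_mul I).add (hx_deriv h g i _).ofReal_comp
  constructor
  · refine hdc (key _ (P1 s)) (fun _ => rfl) ?_
    simp [Matrix.mul_apply, Sc, cm, Fin.sum_univ_two, mul_add, add_mul]
    ring_nf; simp
  · refine hdc (key _ (P2 s)) (fun _ => rfl) ?_
    simp [Matrix.mul_apply, Sc, cm, Fin.sum_univ_two, mul_add, add_mul]
    ring_nf; simp; ring

lemma RD_dn (s) : RDm s (fun g => dn g i0) (fun g => I • (cj (dn g i0) * Sc s)) := fun i k =>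
  (RD_entry s _ _).congr (fun g => dn_entry g i k) fun g => by
    simp [cj, Matrix.mul_apply, dn_entry, Fin.sum_univ_two]; ring
lemma RD_num (s) : RDm s (fun g => num g i0) (fun g => I • (cj (num g i0) * Sc s)) := fun i k =>
  (RD_entry s _ _).congr (fun g => num_entry g i k) fun g => by
    simp [cj, Matrix.mul_apply, num_entry, Fin.sum_univ_two]; ring

lemma RD.neg {s f f'} (h : RD s f f') : RD s (fun g => -f g) (fun g => -f' g) :=
  ((RD.const s (-1)).mul h).congr (fun g => by ring) (fun g => by ring)

def dl (g : G) : ℂ := (dn g i0).det⁻¹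
lemma dl_e (g : G) : dl g * (dn g i0 0 0 * dn g i0 1 1 - dn g i0 0 1 * dn g i0 1 0) = 1 := by
  have := dn_ne g i0_mem
  rw [← det_fin_two]; exact inv_mul_cancel₀ this
lemma N_e' (g : G) : N g = !![dl g * dn g i0 1 1, -dl g * dn g i0 1 0; -dl g * dn g i0 0 1, dl g * dn g i0 0 0] := by
  obtain ⟨a, b, c, d⟩ := N_e g
  ext i k; fin_cases i <;> fin_cases k <;> simp [a, b, c, d, dl]
lemma RD_dl {s F'} (h : RDm s (fun g => dn g i0) F') : RD s dl (fun g => -(F' g 0 0 * dn g i0 1 1 + dn g i0 0 0 * F' g 1 1 - F' g 0 1 * dn g i0 1 0 - dn g i0 0 1 * F' g 1 0) * dl g ^ 2) := by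
  have d := ((h 0 0).mul (h 1 1)).add ((h 0 1).mul (h 1 0)).neg
  have d0 : ∀ g : G, dn g i0 0 0 * dn g i0 1 1 + -(dn g i0 0 1 * dn g i0 1 0) ≠ 0 := fun g => by
    rw [← sub_eq_add_neg, ← det_fin_two]; exact dn_ne g i0_mem
  refine (d.inv d0).congr (fun g => ?_) (fun g => ?_) <;> simp only [dl, det_fin_two, sub_eq_add_neg]
  ring
lemma RD_N {s F'} (h : RDm s (fun g => dn g i0) F') : RDm s N (fun g => -(N g * (F' g)ᵀ * N g)) := by
  have d := RD_dl h
  intro i k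
  fin_cases i <;> fin_cases k
  · refine (d.mul (h 1 1)).congr (fun g => by simp [N_e']) (fun g => ?_)
    simp only [Matrix.neg_apply, Matrix.mul_apply, Fin.sum_univ_two, transpose_apply]
    simp [N_e']
    linear_combination (dl g * F' g 1 1) * dl_e g
  · refine (d.mul (h 1 0)).neg.congr (fun g => by simp [N_e']) (fun g => ?_)
    simp only [Matrix.neg_apply, Matrix.mul_apply, Fin.sum_univ_two, transpose_apply]
    simp [N_e']
    linear_combination -(dl g * F' g 1 0) * dl_e g
  · refine (d.mul (h 0 1)).neg.congr (fun g => by simp [N_e']) (fun g => ?_)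
    simp only [Matrix.neg_apply, Matrix.mul_apply, Fin.sum_univ_two, transpose_apply]
    simp [N_e']
    linear_combination -(dl g * F' g 0 1) * dl_e g
  · refine (d.mul (h 0 0)).congr (fun g => by simp [N_e']) (fun g => ?_)
    simp only [Matrix.neg_apply, Matrix.mul_apply, Fin.sum_univ_two, transpose_apply]
    simp [N_e']
    linear_combination (dl g * F' g 0 0) * dl_e g

def Q (g : G) : M2 := I • ((cj (dn g i0))ᵀ * N g)
lemma N_dn (g : G) : (dn g i0)ᵀ * N g = 1 ∧ N g * (dn g i0)ᵀ = 1 := by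
  have h : IsUnit (dn g i0).det := (dn_ne g i0_mem).isUnit
  constructor
  · rw [N, ← transpose_mul, nonsing_inv_mul _ h, transpose_one]
  · rw [N, ← transpose_mul, mul_nonsing_inv _ h, transpose_one]
lemma Sc_T (s) : (Sc s)ᵀ = Sc s := by rw [Sc, ← cm_T, (Sr_prop s).2]
lemma RD_N' (s) : RDm s N (fun g => -(N g * Sc s * Q g)) := by
  have := RD_N (RD_dn s)
  have e : ∀ g, N g * (I • (cj (dn g i0) * Sc s))ᵀ * N g = N g * Sc s * Q g := fun g => by
    rw [Q, transpose_smul, transpose_mul, Sc_T]; simp [mul_assoc]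
  simpa only [e] using this
lemma RD_dl' (s) : RD s dl (fun g => -(Sc s * Q g).trace * dl g) := by
  refine (RD_dl (RD_dn s)).congr (fun _ => rfl) fun g => ?_
  simp [Q, N_e', trace_fin_two, Matrix.mul_apply, Fin.sum_univ_two]
  have : Sc s 0 1 = Sc s 1 0 := congrFun (congrFun (Sc_T s) 1) 0
  rw [this]; ring
lemma dnH (g : G) : dn g i0 * (dn g i0)ᴴ = cj (dn g i0) * (dn g i0)ᵀ := by
  have h := Y_K g
  set Y : M2 := !![(yy g 0 : ℂ), yy g 1; yy g 1, yy g 2]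
  have hY : cj Y = Y := by ext i k; fin_cases i <;> fin_cases k <;> simp [Y, cj]
  have h' := congrArg cj h
  rw [cj_mul, hY, cj_one, cj_mul] at h'
  have e : cj ((dn g i0)ᴴ) = (dn g i0)ᵀ := by ext; simp [cj]
  rw [e] at h'
  have := mul_eq_one_comm.1 h
  calc _ = (dn g i0 * (dn g i0)ᴴ) * (Y * (cj (dn g i0) * (dn g i0)ᵀ)) := by rw [h', mul_one]
    _ = _ := by rw [← mul_assoc, this, one_mul]
lemma Q_sym (g : G) : (Q g)ᵀ = Q g := by
  have h := dnH g
  have e : (cj (dn g i0))ᵀ = (dn g i0)ᴴ := by ext; simp [cj]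
  have n2 : (N g)ᵀ * dn g i0 = 1 := by have := congrArg Matrix.transpose (N_dn g).1; simpa using this
  rw [Q, transpose_smul, transpose_mul, transpose_transpose, e]
  congr 1
  calc (N g)ᵀ * cj (dn g i0) = (N g)ᵀ * (cj (dn g i0) * (dn g i0)ᵀ) * N g := by rw [← mul_assoc, mul_assoc, (N_dn g).1, mul_one]
    _ = (N g)ᵀ * dn g i0 * (dn g i0)ᴴ * N g := by rw [← h]; simp only [mul_assoc]
    _ = _ := by rw [n2, one_mul]

lemma RD_act (s) : RDm s (fun g => act g i0) (fun g => (2:ℂ) • (N g * Sc s * (N g)ᵀ)) := by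
  have h := (RD_num s).mul (RD_N' s).tr
  have e1 : ∀ g, num g i0 * (N g)ᵀ = act g i0 := fun g => rfl
  have e2 : ∀ g, I • (cj (num g i0) * Sc s) * (N g)ᵀ + num g i0 * (-(N g * Sc s * Q g))ᵀ = (2:ℂ) • (N g * Sc s * (N g)ᵀ) := fun g => by
    have key : cj (num g i0) - act g i0 * cj (dn g i0) = (-(2 * I)) • N g := by
      have h := congrArg Matrix.transpose (herm g i0)
      have a1 : ((dn g i0)ᴴ)ᵀ = cj (dn g i0) := by ext; simp [cj]
      have a2 : ((num g i0)ᴴ)ᵀ = cj (num g i0) := by ext; simp [cj]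
      have a3 : (i0 - i0ᴴ)ᵀ = (2 * I) • (1 : M2) := by
        ext i k; fin_cases i <;> fin_cases k <;> simp [i0, mat, Matrix.conjTranspose_apply] <;> ring
      rw [transpose_sub, transpose_mul, transpose_mul, a1, a2, a3] at h
      have a4 : N g * (num g i0)ᵀ = act g i0 := by
        have : (act g i0)ᵀ = act g i0 := (act_mem g i0_mem).1
        rw [← this, ← e1, transpose_mul, transpose_transpose]
      have := congrArg (fun m => N g * m) h
      simp only [mul_sub, ← mul_assoc, a4, (N_dn g).2, one_mul, Matrix.mul_smul, mul_one] at this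
      rw [neg_smul, ← this]; abel
    have t : (-(N g * Sc s * Q g))ᵀ = -((N g)ᵀ * I • cj (dn g i0) * (Sc s * (N g)ᵀ)) := by
      rw [transpose_neg, transpose_mul, transpose_mul, Sc_T, Q, transpose_smul, transpose_mul, transpose_transpose]; simp
    rw [t]
    calc _ = I • ((cj (num g i0) - act g i0 * cj (dn g i0)) * (Sc s * (N g)ᵀ)) := by
          rw [← e1]; simp only [Matrix.smul_mul, Matrix.mul_smul, sub_mul, smul_sub, mul_neg, mul_assoc]; abel
      _ = _ := by
          rw [key, Matrix.smul_mul, smul_smul, ← mul_assoc]; congr 1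
          linear_combination -2 * I_mul_I
  simpa only [e1, e2] using h

/-! bounds -/
lemma Cl_bd {f : G → ℂ} (hc : Continuous f) {C : ℝ} {M : ℕ} (h0 : 0 ≤ C) (hb : ∀ g, SS1 g → ‖f g‖ ≤ C * (1 + PP g)^M) : Cl 0 f :=
  ⟨hc, C, M, h0, fun g hg => by simpa using hb g hg⟩
lemma Cl_dn (i k) : Cl 0 fun g => dn g i0 i k := by
  refine Cl_bd (C := 3) (M := 0) (dn_cont i k) (by norm_num) fun g hg => ?_
  obtain ⟨b1, b2, -, -⟩ := SS1_bd hg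
  obtain ⟨⟨a1, a2, a3⟩, -⟩ := hg
  simp only [show ∀ k, (wg g k).im = yy g k from fun _ => rfl] at *
  have n0 : 0 ≤ kA g := by unfold kA; positivity
  have n2 : 0 ≤ kC g := by unfold kC; positivity
  have bA : kA g ≤ 10/3 := by linarith [mul_le_mul_of_nonneg_right a1 n0]
  have bC : kC g ≤ 10/3 := by linarith [mul_le_mul_of_nonneg_right (a1.trans a3) n2]
  have : ‖dn g i0 i k‖^2 ≤ 9 := by
    unfold kA at bA; unfold kC at bC
    fin_cases i <;> fin_cases k <;> simp only [Fin.zero_eta, Fin.mk_one] <;>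
    linarith [sq_nonneg ‖dn g i0 0 0‖, sq_nonneg ‖dn g i0 0 1‖, sq_nonneg ‖dn g i0 1 0‖, sq_nonneg ‖dn g i0 1 1‖]
  rw [pow_zero, mul_one]
  exact (le_abs_self _).trans (abs_le_of_sq_le_sq (a := ‖dn g i0 i k‖) (b := 3) (by norm_num; exact this) (by norm_num))
lemma Cl_dl : Cl 0 dl := by
  refine Cl_bd (C := 1) (M := 1) det_cont (by norm_num) fun g hg => ?_
  have h := congrArg Matrix.det (Y_K g)
  rw [det_mul, det_mul, det_conjTranspose, det_one, det_fin_two_of] at h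
  have hp := PP_pos hg
  have : ‖dl g‖^2 = yy g 0 * yy g 2 - yy g 1 * yy g 1 := by
    have d0 := dn_ne g i0_mem
    rw [dl, norm_inv, inv_pow, ← one_div, div_eq_iff (by positivity)]
    have : (dn g i0).det * star (dn g i0).det = ((‖(dn g i0).det‖^2 : ℝ) : ℂ) := by
      rw [Complex.star_def, Complex.mul_conj, Complex.normSq_eq_norm_sq]
    rw [this] at h
    exact_mod_cast h.symm
  obtain ⟨⟨a1, a2, a3⟩, -⟩ := hg
  simp only [show ∀ k, (wg g k).im = yy g k from fun _ => rfl] at *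
  rw [one_mul, pow_one]
  refine (le_abs_self _).trans (abs_le_of_sq_le_sq (a := ‖dl g‖) (b := 1 + PP g) ?_ (by linarith))
  rw [this]; unfold PP
  nlinarith [mul_self_nonneg (yy g 1), mul_self_nonneg (yy g 0 - yy g 2), sq_nonneg (yy g 0 + yy g 2)]
lemma Cl_N (i k) : Cl 0 fun g => N g i k := by
  have hd := Cl_dn
  have hl := Cl_dl
  have e := N_e'
  fin_cases i <;> fin_cases k <;> simp [e]
  · exact hl.mul (hd _ _)
  · simpa using (Cl.const (-1)).mul (hl.mul (hd 1 0))
  · simpa using (Cl.const (-1)).mul (hl.mul (hd 0 1))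
  · exact hl.mul (hd _ _)
lemma Cl_mul {F K : G → M2} (h : ∀ i k, Cl 0 fun g => F g i k) (h' : ∀ i k, Cl 0 fun g => K g i k) (i k) : Cl 0 fun g => (F g * K g) i k := by
  simp only [Matrix.mul_apply, Fin.sum_univ_two]
  exact ((h _ _).mul (h' _ _)).add ((h _ _).mul (h' _ _))
lemma Cl_Q (i k) : Cl 0 fun g => Q g i k := by
  have := (Cl.const I).mul (Cl_mul (F := fun g => (cj (dn g i0))ᵀ) (fun i k => (Cl_dn k i).conj) Cl_N i k)
  simpa [Q] using this
end SS

namespace SS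
open MeasureTheory

def R (s : Fin 3) (e : ℕ) (f f' : G → ℂ) : Prop := Cl e f ∧ Cl e f' ∧ RD s f f'
lemma R.add {s e f f' k k'} (h : R s e f f') (h' : R s e k k') : R s e (fun g => f g + k g) (fun g => f' g + k' g) :=
  ⟨h.1.add h'.1, h.2.1.add h'.2.1, h.2.2.add h'.2.2⟩
lemma R.mul {s e e' f f' k k'} (h : R s e f f') (h' : R s e' k k') : R s (e+e') (fun g => f g * k g) (fun g => f' g * k g + f g * k' g) :=
  ⟨h.1.mul h'.1, (h.2.1.mul h'.1).add (h.1.mul h'.2.1), h.2.2.mul h'.2.2⟩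
lemma R.const (s c) : R s 0 (fun _ => c) (fun _ => 0) := ⟨Cl.const c, Cl.zero 0, RD.const s c⟩
lemma R.congr {s e f f' k k'} (h : R s e f f') (e1 : ∀ g, k g = f g) (e2 : ∀ g, k' g = f' g) : R s e k k' := by
  obtain rfl : k = f := funext e1
  obtain rfl : k' = f' := funext e2
  exact h
lemma R.smul {s e f f'} (c : ℂ) (h : R s e f f') : R s e (fun g => c * f g) (fun g => c * f' g) := by
  have := (R.const s c).mul h
  rw [zero_add] at this
  exact this.congr (fun _ => rfl) (fun g => by ring)
lemma R.mul0 {s e f f' k k'} (h : R s 0 f f') (h' : R s e k k') : R s e (fun g => f g * k g) (fun g => f' g * k g + f g * k' g) := by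
  have := h.mul h'
  rwa [zero_add] at this

lemma Cl_hat {j e : ℕ} (a b : ℕ) {v : G → Fin (j+1) → ℂ} {X Y : G → ℂ} (hv : ∀ i, Cl e fun g => v g i) (hX : Cl 0 X) (hY : Cl 0 Y) :
    Cl e fun g => hat a b (v g) (X g) (Y g) := by
  refine Cl.sum _ fun i _ => ?_
  have := ((hv i).mul (Cl.const (((j - (i:ℕ)).descFactorial a : ℂ) * ((i:ℕ).descFactorial b : ℂ)))).mul ((hX.pow (j - i - a)).mul (hY.pow (i - b)))
  simpa using this
lemma R_hat {j s e} (a b : ℕ) {v v' : G → Fin (j+1) → ℂ} {X X' Y Y' : G → ℂ} (hv : ∀ i, R s e (fun g => v g i) (fun g => v' g i))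
    (hX : R s 0 X X') (hY : R s 0 Y Y') : R s e (fun g => hat a b (v g) (X g) (Y g))
      (fun g => hat a b (v' g) (X g) (Y g) + X' g * hat (a+1) b (v g) (X g) (Y g) + Y' g * hat a (b+1) (v g) (X g) (Y g)) := by
  have z : ∀ a b, Cl e fun g => hat a b (v g) (X g) (Y g) := fun a b => Cl_hat a b (fun i => (hv i).1) hX.1 hY.1
  have z0 : ∀ {f k}, Cl 0 f → Cl e k → Cl e (fun g => f g * k g) := fun h h' => by simpa using h.mul h'
  refine ⟨z a b, ((Cl_hat a b (fun i => (hv i).2.1) hX.1 hY.1).add (z0 hX.2.1 (z _ _))).add (z0 hY.2.1 (z _ _)), fun g => ⟨?_, ?_⟩⟩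
  · refine hdc (hat_hasDerivAt a b (v' := v' g) (fun i => ((hv i).2.2 g).1) (hX.2.2 g).1 (hY.2.2 g).1) (fun _ => rfl) ?_
    simp only [at0]
  · refine hdc (hat_hasDerivAt a b (v' := I • v' g) (fun i => ((hv i).2.2 g).2) (hX.2.2 g).2 (hY.2.2 g).2) (fun _ => rfl) ?_
    simp only [at0, hat_smul]; ring

lemma R_dl (s) : R s 0 dl (fun g => -(Sc s * Q g).trace * dl g) := by
  refine ⟨Cl_dl, ?_, RD_dl' s⟩
  have h : ∀ i k, Cl 0 fun g => (Sc s * Q g) i k := Cl_mul (F := fun _ => Sc s) (fun i k => Cl.const _) Cl_Q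
  have := ((Cl.const (-1)).mul ((h 0 0).add (h 1 1))).mul Cl_dl
  simpa [trace_fin_two] using this
lemma R_N (s i k) : R s 0 (fun g => N g i k) (fun g => -(N g * Sc s * Q g) i k) := by
  refine ⟨Cl_N i k, ?_, RD_N' s i k⟩
  have := (Cl.const (-1)).mul (Cl_mul (Cl_mul (F := N) (K := fun _ => Sc s) Cl_N (fun i k => Cl.const _)) Cl_Q i k)
  simpa using this
def dw (s : Fin 3) (g : G) : Fin 3 → ℂ := ![2 * (N g * Sc s * (N g)ᵀ) 0 0, 2 * (N g * Sc s * (N g)ᵀ) 0 1, 2 * (N g * Sc s * (N g)ᵀ) 1 1]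
lemma RD_wg (s k) : RD s (fun g => wg g k) (fun g => dw s g k) := by
  fin_cases k <;> exact (RD_act s _ _).congr (fun _ => rfl) (fun g => by simp [dw])
lemma Cl_dw (s k) : Cl 0 fun g => dw s g k := by
  have h : ∀ i k, Cl 0 fun g => 2 * (N g * Sc s * (N g)ᵀ) i k := fun i k =>
    (Cl.const 2).mul (Cl_mul (Cl_mul (F := N) (K := fun _ => Sc s) Cl_N (fun i k => Cl.const _)) (K := fun g => (N g)ᵀ) (fun i k => Cl_N k i) i k)
  fin_cases k
  exacts [h 0 0, h 0 1, h 1 1]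
lemma Cl_EE {A} (hA : Good A) : Cl 1 fun g => EE A (wg g) := by
  obtain ⟨C, hC, h⟩ := hA.bound
  refine ⟨hA.cont.comp_continuous (continuous_pi wg_cont) wg_mem, C, 0, hC, fun g hg => ?_⟩
  have := h _ hg.1
  simpa [PP, yy] using this
lemma R_EE (s) {A} (hA : Good A) : R s 1 (fun g => EE A (wg g)) (fun g => Real.pi * I *
    (EE (fun T => T 0 * A T) (wg g) * dw s g 0 + EE (fun T => T 1 * A T) (wg g) * dw s g 1 + EE (fun T => T 2 * A T) (wg g) * dw s g 2)) := by
  refine ⟨Cl_EE hA, ?_, fun g => ⟨?_, ?_⟩⟩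
  · have h := fun k => (Cl_EE (hA.mul k)).mul (Cl_dw s k)
    have := (Cl.const (Real.pi * I)).mul (((h 0).add (h 1)).add (h 2))
    simpa using this
  · refine hdc (hA.deriv_curve (w := fun t => wg (g * h1 s t)) (wg_mem _) fun k => (RD_wg s k g).1) (fun _ => rfl) ?_
    simp only [at0]
  · refine hdc (hA.deriv_curve (w := fun t => wg (g * h2 s t)) (wg_mem _) (w' := fun k => I * dw s g k) fun k => (RD_wg s k g).2) (fun _ => rfl) ?_
    simp only [at0]; ring

lemma vanish {κ : Type} (F : Finset κ) {a a' : Fin 3 → κ → G → ℂ} {b : κ → G → ℂ} {b' : Fin 3 → κ → G → ℂ}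
    (ha : ∀ k, ∀ H ∈ F, R k 1 (a k H) (a' k H)) (hb : ∀ k, ∀ H ∈ F, R k 1 (b H) (b' k H))
    (hab : ∀ H ∈ F, ∀ g, a' 0 H g - a' 1 H g + a' 2 H g = b H g)
    (hi : ∀ k γ g, ∑ H ∈ F, a k H (ι γ * g) * (starRingEnd ℂ) (b H (ι γ * g)) = ∑ H ∈ F, a k H g * (starRingEnd ℂ) (b H g)) :
    ∀ H ∈ F, ∀ g, b H g = 0 := by
  let f0 : Fin 3 → G → ℂ := fun k g => ∑ H ∈ F, a k H g * (starRingEnd ℂ) (b H g)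
  let D1 : Fin 3 → G → ℂ := fun k g => ∑ H ∈ F, (a' k H g * (starRingEnd ℂ) (b H g) + a k H g * (starRingEnd ℂ) (b' k H g))
  let D2 : Fin 3 → G → ℂ := fun k g => ∑ H ∈ F, ((I * a' k H g) * (starRingEnd ℂ) (b H g) + a k H g * (starRingEnd ℂ) (I * b' k H g))
  have c0 : ∀ k, Cl 2 fun g => ∑ H ∈ F, a k H g * (starRingEnd ℂ) (b H g) := fun k =>
    Cl.sum F fun H hH => (ha k H hH).1.mul (hb k H hH).1.conj
  have c1 : ∀ k, Cl 2 (D1 k) := fun k => Cl.sum F fun H hH => ((ha k H hH).2.1.mul (hb k H hH).1.conj).add ((ha k H hH).1.mul (hb k H hH).2.1.conj)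
  have c2 : ∀ k, Cl 2 (D2 k) := fun k => Cl.sum F fun H hH => (Cl.add (e := 2)
    (by simpa using ((Cl.const I).mul (ha k H hH).2.1).mul (hb k H hH).1.conj) (by simpa using (ha k H hH).1.mul ((Cl.const I).mul (hb k H hH).2.1).conj))
  have d1 : ∀ k g, HasDerivAt (fun t => ∑ H ∈ F, a k H (g * h1 k t) * (starRingEnd ℂ) (b H (g * h1 k t))) (D1 k g) 0 := fun k g =>
    HasDerivAt.fun_sum fun H hH => hdc (((ha k H hH).2.2 g).1.mul ((hb k H hH).2.2 g).1.star) (fun _ => rfl) (by simp [at0])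
  have d2 : ∀ k g, HasDerivAt (fun t => ∑ H ∈ F, a k H (g * h2 k t) * (starRingEnd ℂ) (b H (g * h2 k t))) (D2 k g) 0 := fun k g =>
    HasDerivAt.fun_sum fun H hH => hdc (((ha k H hH).2.2 g).2.mul ((hb k H hH).2.2 g).2.star) (fun _ => rfl) (by simp [at0])
  have i1 : ∀ k γ g, D1 k (ι γ * g) = D1 k g := fun k => inv_deriv (f := f0 k) (P1 k) (hi k) (d1 k)
  have i2 : ∀ k γ g, D2 k (ι γ * g) = D2 k g := fun k => inv_deriv (f := f0 k) (P2 k) (hi k) (d2 k)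
  have z1 := fun k => (int_zero (f := f0 k) (P1 k) (c0 k) (c1 k) (hi k) (d1 k)).1
  have z2 := fun k => (int_zero (f := f0 k) (P2 k) (c0 k) (c2 k) (hi k) (d2 k)).2
  have j1 := fun k => ((c1 k).integ (i1 k)).1
  have j2 := fun k => ((c2 k).integ (i2 k)).2
  let f : Fin 3 → G → ℝ := fun k g => (D1 k g).re + (D2 k g).im
  have fz : ∀ k, Integrable (f k) (μ.withDensity ψ) ∧ ∫ g, f k g ∂(μ.withDensity ψ) = 0 := fun k =>
    ⟨(j1 k).add (j2 k), by rw [integral_add (j1 k) (j2 k), z1, z2, add_zero]⟩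
  have fe : ∀ k g, f k g = 2 * (∑ H ∈ F, a' k H g * (starRingEnd ℂ) (b H g)).re := fun k g => by
    simp only [f, D1, D2, Complex.re_sum, Complex.im_sum, Finset.mul_sum, ← Finset.sum_add_distrib]
    refine Finset.sum_congr rfl fun H _ => ?_
    simp; ring
  let q : G → ℝ := fun g => f 0 g - f 1 g + f 2 g
  have qe : ∀ g, q g = 2 * ∑ H ∈ F, ‖b H g‖^2 := fun g => by
    simp only [q, fe, Complex.re_sum, Finset.mul_sum, ← Finset.sum_add_distrib, ← Finset.sum_sub_distrib]
    refine Finset.sum_congr rfl fun H hH => ?_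
    rw [← Complex.normSq_eq_norm_sq, ← Complex.ofReal_re (Complex.normSq _), ← Complex.mul_conj]
    conv_rhs => rw [← hab H hH g]
    simp [sub_mul, add_mul]
    rw [← hab H hH g]; simp; ring
  have qi : ∀ γ g, q (ι γ * g) = q g := fun γ g => by simp only [q, f, i1, i2]
  have q0 : ∀ g, 0 ≤ q g := fun g => by rw [qe]; positivity
  have qc : Continuous q := by
    have hc : ∀ k, Continuous (f k) := fun k => (continuous_re.comp (c1 k).1).add (continuous_im.comp (c2 k).1)
    exact ((hc 0).sub (hc 1)).add (hc 2)
  have qI : Integrable q (μ.withDensity ψ) := ((fz 0).1.sub (fz 1).1).add (fz 2).1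
  have qz : ∫ g, q g ∂(μ.withDensity ψ) = 0 := by
    have := integral_add ((fz 0).1.sub (fz 1).1) (fz 2).1
    refine this.trans ?_
    have h' := integral_sub (fz 0).1 (fz 1).1
    rw [(fz 2).2, add_zero]
    refine h'.trans ?_
    rw [(fz 0).2, (fz 1).2, sub_zero]
  have l0 : ∫⁻ g, ENNReal.ofReal (q g) ∂(μ.withDensity ψ) = 0 := by
    rw [← ofReal_integral_eq_lintegral_ofReal qI (Eventually.of_forall q0), qz, ENNReal.ofReal_zero]
  have ae := U3' ψ_meas ψ_sum (f := fun g => ENNReal.ofReal (q g)) (ENNReal.measurable_ofReal.comp qc.measurable)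
    (fun γ g => by rw [qi]) l0
  have ae' : q =ᵐ[μ] fun _ => 0 := by
    filter_upwards [ae] with g hg
    exact le_antisymm (ENNReal.ofReal_eq_zero.1 hg) (q0 g)
  have qq := (Continuous.ae_eq_iff_eq μ qc continuous_const).1 ae'
  intro H hH g
  have := congrFun qq g
  rw [qe] at this
  have h2 := (Finset.sum_eq_zero_iff_of_nonneg fun H _ => sq_nonneg ‖b H g‖).1 (by linarith) H hH
  simpa using h2
end SS

namespace SS
open MeasureTheory

lemma hat2_aux {j : ℕ} (m : M2) (v : Fin (j+1) → ℂ) (s t p q : ℂ) :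
    let u := m 0 0 * s + m 1 0 * t
    let w := m 0 1 * s + m 1 1 * t
    let p' := m 0 0 * p + m 1 0 * q
    let q' := m 0 1 * p + m 1 1 * q
    (p * hat 2 0 (symAct j m v) s t + q * hat 1 1 (symAct j m v) s t = m 0 0 * (p' * hat 2 0 v u w + q' * hat 1 1 v u w) + m 0 1 * (p' * hat 1 1 v u w + q' * hat 0 2 v u w)) ∧
    (p * hat 1 1 (symAct j m v) s t + q * hat 0 2 (symAct j m v) s t = m 1 0 * (p' * hat 2 0 v u w + q' * hat 1 1 v u w) + m 1 1 * (p' * hat 1 1 v u w + q' * hat 0 2 v u w)) := by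
  intro u w p' q'
  constructor
  · refine (hat_deriv_s 1 0 (symAct j m v) s t p q).unique ?_
    refine hdc (((hat_deriv_s 1 0 v u w p' q').const_mul (m 0 0)).add ((hat_deriv_s 0 1 v u w p' q').const_mul (m 0 1))) (fun r => ?_) rfl
    rw [hat_symAct_s]; simp only [Pi.add_apply, u, w, p', q']; congr 3 <;> ring
  · refine (hat_deriv_s 0 1 (symAct j m v) s t p q).unique ?_
    refine hdc (((hat_deriv_s 1 0 v u w p' q').const_mul (m 1 0)).add ((hat_deriv_s 0 1 v u w p' q').const_mul (m 1 1))) (fun r => ?_) rfl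
    rw [hat_symAct_t]; simp only [Pi.add_apply, u, w, p', q']; congr 3 <;> ring

variable {j : ℕ}
def xg (s t : ℂ) (g : G) : ℂ := N g 0 0 * s + N g 0 1 * t
def yg (s t : ℂ) (g : G) : ℂ := N g 1 0 * s + N g 1 1 * t
def av (H : M2 → Fin (j+1) → ℂ) (s t : ℂ) (k : Fin 3) (g : G) : ℂ := hat (k:ℕ) (2 - (k:ℕ)) (sl g H i0) s t
lemma av_inv (H : M2 → Fin (j+1) → ℂ) (s t k γ g) : av H s t k (ι γ * g) = av (sl (ι γ) H) s t k g := by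
  simp only [av, sl_mul]
lemma av_e (H : M2 → Fin (j+1) → ℂ) (s t g) :
    (av H s t 0 g = dl g * (N g 0 1 ^2 * hat 2 0 (H (act g i0)) (xg s t g) (yg s t g) + 2 * N g 0 1 * N g 1 1 * hat 1 1 (H (act g i0)) (xg s t g) (yg s t g)
      + N g 1 1 ^2 * hat 0 2 (H (act g i0)) (xg s t g) (yg s t g))) ∧
    (av H s t 1 g = dl g * (N g 0 0 * N g 0 1 * hat 2 0 (H (act g i0)) (xg s t g) (yg s t g) + (N g 0 0 * N g 1 1 + N g 0 1 * N g 1 0) * hat 1 1 (H (act g i0)) (xg s t g) (yg s t g)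
      + N g 1 0 * N g 1 1 * hat 0 2 (H (act g i0)) (xg s t g) (yg s t g))) ∧
    (av H s t 2 g = dl g * (N g 0 0 ^2 * hat 2 0 (H (act g i0)) (xg s t g) (yg s t g) + 2 * N g 0 0 * N g 1 0 * hat 1 1 (H (act g i0)) (xg s t g) (yg s t g)
      + N g 1 0 ^2 * hat 0 2 (H (act g i0)) (xg s t g) (yg s t g))) := by
  have e : sl g H i0 = dl g • symAct j (N g)ᵀ (H (act g i0)) := by rw [sl_of _ _ i0_mem]; rfl
  obtain ⟨h1, h2⟩ := hat2_aux (N g)ᵀ (H (act g i0)) s t 1 0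
  obtain ⟨-, h3⟩ := hat2_aux (N g)ᵀ (H (act g i0)) s t 0 1
  simp only [transpose_apply, mul_one, mul_zero, zero_mul, add_zero, zero_add, one_mul] at h1 h2 h3
  refine ⟨?_, ?_, ?_⟩ <;> simp only [av, e, hat_smul, xg, yg] <;> norm_num
  · rw [h3]; ring_nf; simp
  · rw [h2]; ring_nf; simp
  · rw [h1]; ring_nf; simp

section
variable (A : Z3 → Fin (j+1) → ℂ)
def vv (g : G) (i : Fin (j+1)) : ℂ := EE (fun T => A T i) (wg g)
def ek (k : Fin 3) (g : G) (i : Fin (j+1)) : ℂ := EE (fun T => T k * A T i) (wg g)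
variable {A}
lemma R_vv (hG : ∀ i, Good fun T => A T i) (s i) : R s 1 (fun g => vv A g i) (fun g => ((Real.pi * I) • (dw s g 0 • ek A 0 g + dw s g 1 • ek A 1 g + dw s g 2 • ek A 2 g)) i) :=
  (R_EE s (hG i)).congr (fun _ => rfl) (fun g => by simp [ek]; ring)
def dN (s : Fin 3) (g : G) : M2 := -(N g * Sc s * Q g)
lemma R_xy (s : Fin 3) (x y : ℂ) : R s 0 (xg x y) (fun g => dN s g 0 0 * x + dN s g 0 1 * y) ∧ R s 0 (yg x y) (fun g => dN s g 1 0 * x + dN s g 1 1 * y) :=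
  ⟨(((R_N s 0 0).smul x).add ((R_N s 0 1).smul y)).congr (fun g => by simp [xg]; ring) (fun g => by simp [dN]; ring),
   (((R_N s 1 0).smul x).add ((R_N s 1 1).smul y)).congr (fun g => by simp [yg]; ring) (fun g => by simp [dN]; ring)⟩
def bb (A : Z3 → Fin (j+1) → ℂ) (x y : ℂ) (g : G) : ℂ := dl g * (N g 0 0 * N g 1 1 - N g 0 1 * N g 1 0)^2 * (2 * Real.pi * I *
  (hat 0 2 (ek A 0 g) (xg x y g) (yg x y g) - hat 1 1 (ek A 1 g) (xg x y g) (yg x y g) + hat 2 0 (ek A 2 g) (xg x y g) (yg x y g)))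
lemma R_bb (hG : ∀ i, Good fun T => A T i) (s x y) : ∃ b', R s 1 (bb A x y) b' := by
  have hE : ∀ k a b, ∃ f', R s 1 (fun g => hat a b (ek A k g) (xg x y g) (yg x y g)) f' := fun k a b =>
    ⟨_, R_hat a b (v' := fun g i => _) (fun i => R_EE s ((hG i).mul k)) (R_xy s x y).1 (R_xy s x y).2⟩
  obtain ⟨f0, h0⟩ := hE 0 0 2
  obtain ⟨f1, h1⟩ := hE 1 1 1
  obtain ⟨f2, h2⟩ := hE 2 2 0
  have d := ((R_N s 0 0).mul0 (R_N s 1 1)).add (((R_N s 0 1).mul0 (R_N s 1 0)).smul (-1))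
  exact ⟨_, (((R_dl s).mul0 (d.mul0 d)).mul0 (((h0.add (h1.smul (-1))).add h2).smul (2 * Real.pi * I))).congr
    (fun g => by simp only [bb]; ring) (fun _ => rfl)⟩
lemma three {a : Fin 3 → G → ℂ} {b f0 f1 f2 : G → ℂ} (h0 : R 0 1 (a 0) f0) (h1 : R 1 1 (a 1) f1) (h2 : R 2 1 (a 2) f2) (hb : ∀ g, f0 g - f1 g + f2 g = b g) :
    ∃ a' : Fin 3 → G → ℂ, (∀ k, R k 1 (a k) (a' k)) ∧ ∀ g, a' 0 g - a' 1 g + a' 2 g = b g :=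
  ⟨![f0, f1, f2], fun k => by fin_cases k <;> assumption, hb⟩
lemma R_av (hG : ∀ i, Good fun T => A T i) {H : M2 → Fin (j+1) → ℂ} (hH : ∀ g, H (act g i0) = vv A g) (x y : ℂ) :
    ∃ a' : Fin 3 → G → ℂ, (∀ k, R k 1 (av H x y k) (a' k)) ∧ ∀ g, a' 0 g - a' 1 g + a' 2 g = bb A x y g := by
  have h := fun s a b => R_hat a b (v' := fun g => ((Real.pi * I) • (dw s g 0 • ek A 0 g + dw s g 1 • ek A 1 g + dw s g 2 • ek A 2 g))) (R_vv hG s) (R_xy s x y).1 (R_xy s x y).2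
  have n : ∀ s i k, R s 0 (fun g => N g i k) (fun g => dN s g i k) := R_N
  have e := av_e H x y
  simp only [hH] at e
  have r := fun s (f f' k k' l l' : G → ℂ) (hf : R s 0 f f') (hk : R s 0 k k') (hl : R s 0 l l') =>
    (R_dl s).mul0 (((hf.mul0 (h s 2 0)).add (hk.mul0 (h s 1 1))).add (hl.mul0 (h s 0 2)))
  have r0 := r 0 _ _ _ _ _ _ ((n 0 0 1).mul0 (n 0 0 1)) (((n 0 0 1).mul0 (n 0 1 1)).smul 2) ((n 0 1 1).mul0 (n 0 1 1))
  have r1 := r 1 _ _ _ _ _ _ ((n 1 0 0).mul0 (n 1 0 1)) (((n 1 0 0).mul0 (n 1 1 1)).add ((n 1 0 1).mul0 (n 1 1 0))) ((n 1 1 0).mul0 (n 1 1 1))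
  have r2 := r 2 _ _ _ _ _ _ ((n 2 0 0).mul0 (n 2 0 0)) (((n 2 0 0).mul0 (n 2 1 0)).smul 2) ((n 2 1 0).mul0 (n 2 1 0))
  refine three (r0.congr (fun g => (e g).1.trans (by ring)) (fun _ => rfl)) (r1.congr (fun g => (e g).2.1.trans (by ring)) (fun _ => rfl))
    (r2.congr (fun g => (e g).2.2.trans (by ring)) (fun _ => rfl)) fun g => ?_
  · have q : Q g 0 1 = Q g 1 0 := congrFun (congrFun (Q_sym g) 1) 0
    simp only [bb, hat_smul, hat_add, dN, dw, Sc, Sr, cm, trace_fin_two, Matrix.neg_apply, Matrix.mul_apply, Fin.sum_univ_two, transpose_apply]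
    simp [q]
    generalize ek A 0 g = e0
    generalize ek A 1 g = e1
    generalize ek A 2 g = e2
    generalize vv A g = v
    generalize hX : xg x y g = X
    generalize hY : yg x y g = Y
    ring
end
end SS

namespace SS
open MeasureTheory
variable {j : ℕ}

lemma trans {w : Fin 3 → ℂ} (hw : w ∈ U3) : ∃ g : G, wg g = w := by
  obtain ⟨h0, h1⟩ := U3_iff.1 hw
  simp only at h0 h1
  set a := Real.sqrt (w 0).im with ha
  have a0 : 0 < a := Real.sqrt_pos.2 h0
  have a2 : a * a = (w 0).im := Real.mul_self_sqrt h0.le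
  set b := (w 1).im / a with hb
  have b1 : a * b = (w 1).im := by rw [hb]; field_simp
  have c0' : 0 < (w 2).im - b * b := by
    have : (w 0).im * (b * b) = (w 1).im ^ 2 := by rw [← a2, ← b1]; ring
    by_contra hc
    have := mul_le_mul_of_nonneg_left (not_lt.1 hc) h0.le
    linarith [mul_sub (w 0).im (w 2).im (b*b)]
  set c := Real.sqrt ((w 2).im - b * b) with hc
  have c0 : 0 < c := Real.sqrt_pos.2 c0'
  have c2 : b * b + c * c = (w 2).im := by rw [hc, Real.mul_self_sqrt c0'.le]; ring
  let L : Matrix (Fin 2) (Fin 2) ℝ := !![a, 0; b, c]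
  let K : Matrix (Fin 2) (Fin 2) ℝ := !![1/a, -b/(a*c); 0, 1/c]
  let X : Matrix (Fin 2) (Fin 2) ℝ := !![(w 0).re, (w 1).re; (w 1).re, (w 2).re]
  have hLK : Lᵀ * K = 1 := by
    ext i k; fin_cases i <;> fin_cases k <;> simp [L, K, Matrix.mul_apply, Fin.sum_univ_two] <;> field_simp; ring
  have hX : Xᵀ = X := by ext i k; fin_cases i <;> fin_cases k <;> simp [X]
  have hm : fromBlocks L (X * K) 0 K ∈ symplecticGroup (Fin 2) ℝ := by
    rw [SymplecticGroup.fromBlocks_mem_iff]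
    refine ⟨by simp, ?_, by simpa using hLK⟩
    simp [transpose_mul, hX, mul_assoc]
  let g : G := ⟨_, hm⟩
  have hi : cm L * i0 = (cm (!![a*a,a*b;a*b,b*b+c*c]) * cm K) * i0 := by
    congr 1
    ext i k; fin_cases i <;> fin_cases k <;> simp [L, K, cm, Matrix.mul_apply, Fin.sum_univ_two] <;>
      norm_cast <;> field_simp <;> ring
  have hn : num g i0 = mt w * dn g i0 := by
    have e1 : num g i0 = cm L * i0 + cm (X * K) := by simp [num, ga, gb, g, toBlocks₁₁, toBlocks₁₂]; rfl
    have e2 : dn g i0 = cm K := by 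
      have z : gc g = 0 := by ext i k; simp [gc, g, toBlocks₂₁, cm]
      rw [dn, z, zero_mul, zero_add]; rfl
    have e3 : i0 = I • (1 : M2) := by ext i k; fin_cases i <;> fin_cases k <;> simp [i0, mat]
    have e4 : mt w = I • cm (!![a*a,a*b;a*b,b*b+c*c]) + cm X := by
      rw [a2, b1, c2]
      ext i k; fin_cases i <;> fin_cases k <;> simp [mt, mat, cm, X] <;> apply Complex.ext <;> simp
    have e5 : cm (X * K) = cm X * cm K := Matrix.map_mul
    rw [e1, e2, hi, e4, e5, e3, add_mul]; simp
  refine ⟨g, ?_⟩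
  have : act g i0 = mt w := by
    rw [act, hn, mul_assoc, mul_nonsing_inv _ (dn_ne g i0_mem).isUnit, mul_one]
  unfold wg; rw [this]
  ext k; fin_cases k <;> simp [mt, mat]

theorem DF {𝓕 : Set (M2 → Fin (j+1) → ℂ)} (hF : Fam 𝓕) {H} (hH : H ∈ 𝓕) {A} (hA : Four A H) (T : Z3) (x y : ℂ) :
    T 0 * hat 0 2 (A T) x y - T 1 * hat 1 1 (A T) x y + T 2 * hat 2 0 (A T) x y = 0 := by
  have hex : ∀ H, ∃ A, H ∈ 𝓕 → Four A H := fun H => by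
    by_cases h : H ∈ 𝓕
    · obtain ⟨A, hA⟩ := hF.four h
      exact ⟨A, fun _ => hA⟩
    · exact ⟨0, fun h' => absurd h' h⟩
  choose 𝓐 h𝓐 using hex
  have good : ∀ {H A}, H ∈ 𝓕 → Four A H → ∀ i, Good fun T => A T i := fun hH hA i =>
    ⟨fun T hT => K4 hF hH hA fun h => hT (congrFun h i), fun w hw => (hA w hw i).summable⟩
  obtain rfl : A = 𝓐 H := by
    have : ∀ i, (fun T => A T i - 𝓐 H T i) = 0 := fun i => four_uniq fun w hw => by
      simpa [sub_mul] using (hA w hw i).sub (h𝓐 H hH w hw i)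
    funext T i; exact sub_eq_zero.1 (congrFun (this i) T)
  have hv : ∀ H ∈ 𝓕, ∀ g, H (act g i0) = vv (𝓐 H) g := fun H hH g => by
    funext i
    rw [← wg_mt]; exact (h𝓐 H hH _ (wg_mem g) i).tsum_eq.symm
  have b0 : ∀ x y g, bb (𝓐 H) x y g = 0 := fun x y => by
    have hR : ∀ H, ∃ a' : Fin 3 → G → ℂ, H ∈ 𝓕 → (∀ k, R k 1 (av H x y k) (a' k)) ∧ ∀ g, a' 0 g - a' 1 g + a' 2 g = bb (𝓐 H) x y g := fun H => by
      by_cases h : H ∈ 𝓕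
      · obtain ⟨a', h'⟩ := R_av (good h (h𝓐 H h)) (hv H h) x y
        exact ⟨a', fun _ => h'⟩
      · exact ⟨0, fun h' => absurd h' h⟩
    choose a' ha' using hR
    have hB : ∀ k H, ∃ b', H ∈ 𝓕 → R k 1 (bb (𝓐 H) x y) b' := fun k H => by
      by_cases h : H ∈ 𝓕
      · obtain ⟨a', h'⟩ := R_bb (good h (h𝓐 H h)) k x y
        exact ⟨a', fun _ => h'⟩
      · exact ⟨0, fun h' => absurd h' h⟩
    choose b' hb' using hB
    have ai : ∀ H ∈ 𝓕, ∀ k γ g, a' H k (ι γ * g) = a' (sl (ι γ) H) k g := fun H hH k γ g => by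
      refine (((ha' H hH).1 k).2.2 (ι γ * g)).1.unique ?_
      simpa only [mul_assoc, av_inv] using (((ha' _ (hF.sl_mem H hH γ)).1 k).2.2 g).1
    have bi : ∀ H ∈ 𝓕, ∀ γ g, bb (𝓐 H) x y (ι γ * g) = bb (𝓐 (sl (ι γ) H)) x y g := fun H hH γ g => by
      rw [← (ha' H hH).2, ← (ha' _ (hF.sl_mem H hH γ)).2]; simp only [ai H hH]
    have mm : ∀ {H}, H ∈ hF.fin.toFinset ↔ H ∈ 𝓕 := hF.fin.mem_toFinset
    refine vanish hF.fin.toFinset (a := fun k H => av H x y k) (a' := fun k H => a' H k) (b := fun H => bb (𝓐 H) x y) (b' := b')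
      (fun k H h => (ha' H (mm.1 h)).1 k) (fun k H h => hb' k H (mm.1 h)) (fun H h => (ha' H (mm.1 h)).2) (fun k γ g => ?_) H (mm.2 hH)
    have hs : ∀ (γ : GZ) (H : M2 → Fin (j+1) → ℂ), H ∈ 𝓕 → sl (ι γ⁻¹) (sl (ι γ) H) = H := fun γ H h => by
      rw [sl_mul, ← map_mul, mul_inv_cancel, map_one, sl_one _ (hF.zero H h)]
    refine Finset.sum_nbij (sl (ι γ)) (fun H h => mm.2 (hF.sl_mem H (mm.1 h) γ)) (fun H h H' h' e => ?_) (fun H h => ?_) (fun H h => ?_)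
    · rw [← hs γ H (mm.1 h), e, hs γ H' (mm.1 h')]
    · exact ⟨_, mm.2 (hF.sl_mem H (mm.1 h) γ⁻¹), by simpa using hs γ⁻¹ H (mm.1 h)⟩
    · rw [av_inv, bi H (mm.1 h)]
  have key : ∀ w ∈ U3, ∀ X Y, hat 0 2 (fun i => EE (fun T => T 0 * 𝓐 H T i) w) X Y - hat 1 1 (fun i => EE (fun T => T 1 * 𝓐 H T i) w) X Y
      + hat 2 0 (fun i => EE (fun T => T 2 * 𝓐 H T i) w) X Y = 0 := fun w hw X Y => by
    obtain ⟨g, rfl⟩ := trans hw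
    have e := (N_dn g).2
    have n : ∀ i k, N g i 0 * dn g i0 k 0 + N g i 1 * dn g i0 k 1 = (1 : M2) i k := fun i k => by
      rw [← e]; simp [Matrix.mul_apply, Fin.sum_univ_two]
    have := b0 (dn g i0 0 0 * X + dn g i0 1 0 * Y) (dn g i0 0 1 * X + dn g i0 1 1 * Y) g
    have d : N g 0 0 * N g 1 1 - N g 0 1 * N g 1 0 ≠ 0 := by
      have := congrArg Matrix.det e
      rw [det_mul, det_one, det_fin_two] at this
      exact left_ne_zero_of_mul (this ▸ one_ne_zero)
    have d2 : dl g ≠ 0 := inv_ne_zero (dn_ne g i0_mem)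
    have eX : xg (dn g i0 0 0 * X + dn g i0 1 0 * Y) (dn g i0 0 1 * X + dn g i0 1 1 * Y) g = X := by
      have h := n 0 0; have h' := n 0 1; simp at h h'
      unfold xg; linear_combination X * h + Y * h'
    have eY : yg (dn g i0 0 0 * X + dn g i0 1 0 * Y) (dn g i0 0 1 * X + dn g i0 1 1 * Y) g = Y := by
      have h := n 1 0; have h' := n 1 1; simp at h h'
      unfold yg; linear_combination X * h + Y * h'
    rw [bb, eX, eY] at this
    have h2 : (2 * Real.pi * I : ℂ) ≠ 0 := by simp [Real.pi_ne_zero]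
    have := (mul_eq_zero.1 this).resolve_left (mul_ne_zero d2 (pow_ne_zero _ d))
    exact (mul_eq_zero.1 this).resolve_left h2
  have fo : ∀ k : Fin 3, ∀ a b x y, ∀ w ∈ U3, HasSum (fun T => (T k * hat a b (𝓐 H T) x y) * ex T w) (hat a b (fun i => EE (fun T => T k * 𝓐 H T i) w) x y) := fun k a b x y w hw => by
    have : Four (fun T i => T k * 𝓐 H T i) (fun m : M2 => fun i => EE (fun T => T k * 𝓐 H T i) ![m 0 0, m 0 1, m 1 1]) := fun w hw i => by
      have e : ![mt w 0 0, mt w 0 1, mt w 1 1] = w := by ext k; fin_cases k <;> simp [mt, mat]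
      beta_reduce; rw [e]; exact ((((good hH hA i).mul k).2 w hw)).hasSum
    have h := this.hat a b x y hw
    have e : ![mt w 0 0, mt w 0 1, mt w 1 1] = w := by ext k; fin_cases k <;> simp [mt, mat]
    rw [e] at h
    refine h.congr_fun fun T => ?_
    rw [← hat_smul]; rfl
  have := four_uniq (A := fun T => T 0 * hat 0 2 (𝓐 H T) x y - T 1 * hat 1 1 (𝓐 H T) x y + T 2 * hat 2 0 (𝓐 H T) x y) fun w hw => by
    have := ((fo 0 0 2 x y w hw).sub (fo 1 1 1 x y w hw)).add (fo 2 2 0 x y w hw)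
    rw [key w hw x y] at this
    exact this.congr_fun fun T => by ring
  exact congrFun this T
end SS

namespace SS
open MeasureTheory
variable {j : ℕ}

def Ws (p q : ℝ) (c τ : ℂ) : Fin 3 → ℂ := ![τ, p*τ+q, p^2*τ+c]
def eta (w : Fin 3 → ℂ) : ℝ := (w 2).im - (w 1).im^2/(w 0).im
def hh (m : ℤ) (k : ℕ) (a : Z3 → ℂ) (w : Fin 3 → ℂ) : ℝ := ‖EE a w‖ * √((w 0).im)^k * Real.exp (Real.pi * m * eta w)
def En (p : ℝ) (T : Z3) : ℝ := T 0 + T 1 * p + T 2 * p^2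

lemma Ws_im (p q : ℝ) (c τ : ℂ) : (Ws p q c τ 0).im = τ.im ∧ (Ws p q c τ 1).im = p*τ.im ∧ (Ws p q c τ 2).im = p^2*τ.im + c.im := by
  refine ⟨rfl, by simp [Ws], ?_⟩
  have : (p:ℂ)^2 = ((p^2:ℝ):ℂ) := by push_cast; rfl
  simp only [Ws, Fin.isValue, cons_val, this, add_im, re_ofReal_mul, im_ofReal_mul]

lemma Ws_mem {p q : ℝ} {c τ : ℂ} (hτ : 0 < τ.im) (hc : 0 < c.im) : Ws p q c τ ∈ U3 := by
  obtain ⟨h0, h1, h2⟩ := Ws_im p q c τ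
  refine U3_iff.2 ⟨?_, ?_⟩ <;> beta_reduce <;> simp only [h0, h1, h2]
  · exact hτ
  · have := mul_pos hτ hc; nlinarith

lemma Ws_eta {p q : ℝ} {c τ : ℂ} (hτ : 0 < τ.im) : eta (Ws p q c τ) = c.im := by
  obtain ⟨h0, h1, h2⟩ := Ws_im p q c τ
  rw [eta, h0, h1, h2]; field_simp; ring

lemma Ws_ex (p q : ℝ) (c τ : ℂ) (T : Z3) : ‖ex T (Ws p q c τ)‖ = Real.exp (-Real.pi * (En p T * τ.im + T 2 * c.im)) := by
  obtain ⟨h0, h1, h2⟩ := Ws_im p q c τ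
  rw [norm_ex, dt]; beta_reduce; rw [h0, h1, h2, En]; congr 1; ring

lemma Ws_of {w : Fin 3 → ℂ} (hw : w ∈ U3) : ∃ p q : ℝ, ∃ c : ℂ, w = Ws p q c (w 0) ∧ 0 < c.im ∧ 0 < (w 0).im ∧ p = (w 1).im / (w 0).im := by
  obtain ⟨h0, h1⟩ := U3_iff.1 hw
  beta_reduce at h0 h1
  refine ⟨(w 1).im/(w 0).im, (w 1).re - (w 1).im/(w 0).im * (w 0).re, w 2 - (((w 1).im/(w 0).im : ℝ):ℂ)^2 * w 0, ?_, ?_, h0, rfl⟩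
  · funext i; fin_cases i
    · rfl
    · apply Complex.ext <;> simp only [Ws, Fin.mk_one, Fin.isValue, cons_val, add_re, add_im, re_ofReal_mul, im_ofReal_mul, ofReal_re, ofReal_im]
      · ring
      · field_simp; ring
    · simp only [Ws, Fin.reduceFinMk, Fin.isValue, cons_val]; ring
  · rw [← ofReal_pow, sub_im, im_ofReal_mul, sub_pos]
    field_simp; linarith

lemma En_ge {m : ℤ} (hm : 1 ≤ m) {T : Z3} (h : T 2 = m ∧ m ≤ T 0 ∧ 3*m^2 ≤ 4*T 0*m - T 1^2) (p : ℝ) :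
    3/4 ≤ En p T ∧ (|p| ≤ 1/2 → (T 0 - m : ℝ)/2 ≤ En p T) := by
  obtain ⟨h2, h0, h1⟩ := h
  have m1 : (1:ℝ) ≤ m := by exact_mod_cast hm
  have n1 : (m:ℝ) ≤ T 0 := by exact_mod_cast h0
  have d1 : 3*(m:ℝ)^2 ≤ 4*T 0*m - T 1^2 := by exact_mod_cast h1
  rw [En, h2]
  constructor
  · have : 0 ≤ m * ((T 0:ℝ) + T 1 * p + m * p^2 - 3/4*m) := by nlinarith [sq_nonneg (2*m*p+T 1)]
    have := nonneg_of_mul_nonneg_right this (by linarith)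
    linarith
  · intro hp
    have hr : |(T 1:ℝ)| ≤ T 0 + m := abs_le_of_sq_le_sq (by nlinarith [sq_nonneg ((T 0:ℝ) - m)]) (by linarith)
    have : |T 1 * p| ≤ (T 0 + m) * (1/2) := by rw [abs_mul]; gcongr; linarith
    have := (abs_le.1 this).1
    nlinarith [mul_nonneg (by linarith : (0:ℝ) ≤ m) (sq_nonneg p)]

lemma kill_bd {m : ℤ} (hm : 1 ≤ m) {k : ℕ} (hk : k ≤ 2) {a : Z3 → ℂ} (hg : Good a)
    (hs : ∀ T, a T ≠ 0 → T 2 = m ∧ m ≤ T 0 ∧ 3*m^2 ≤ 4*T 0*m - T 1^2) :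
    ∃ C : ℝ, ∀ w ∈ U3, 3 ≤ 4*(w 0).im^2 → |(w 1).im| ≤ (w 0).im/2 → hh m k a w ≤ C := by
  have hst : (![I/4, 0, I/4] : Fin 3 → ℂ) ∈ U3 := U3_iff.2 ⟨by simp, by simp⟩
  have sS := (hg.2 _ hst).norm
  refine ⟨(∑' T, ‖a T * ex T ![I/4, 0, I/4]‖) * Real.exp (Real.pi*m/2 + 3*Real.pi/8), fun w hw h3 h1 => ?_⟩
  obtain ⟨p, q, c, e, hc, h0, hp⟩ := Ws_of hw
  have hp' : |p| ≤ 1/2 := by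
    rw [hp, abs_div, abs_of_pos h0, div_le_iff₀ h0]; linarith
  generalize w 0 = τ at *
  subst e
  rw [hh, Ws_eta h0]
  set y := τ.im
  have hy : 1/2 ≤ y := by nlinarith
  have hk : √y^k ≤ Real.exp y := by
    have := Real.add_one_le_exp y
    have := Real.sq_sqrt h0.le
    interval_cases k
    · simp; linarith
    · rw [pow_one]; nlinarith [sq_nonneg (√y - 1)]
    · linarith
  have hpi := Real.pi_gt_three
  have key : ‖EE a (Ws p q c τ)‖ ≤ (∑' T, ‖a T * ex T ![I/4, 0, I/4]‖) * Real.exp (Real.pi*m/2 + 3*Real.pi/8 - y - Real.pi*m*c.im) := by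
    rw [EE, ← tsum_mul_right]
    refine (norm_tsum_le_tsum_norm (hg.2 _ hw).norm).trans ((hg.2 _ hw).norm.tsum_le_tsum (fun T => ?_) (sS.mul_right _))
    by_cases hT : a T = 0
    · simp [hT]
    obtain ⟨b1, b2⟩ := En_ge hm (hs T hT) p
    have b2 := b2 hp'
    rw [norm_mul, norm_mul, Ws_ex, norm_ex, mul_assoc, ← Real.exp_add, (hs T hT).1]
    gcongr
    simp [dt, (hs T hT).1]
    have u1 : (En p T) * y ≥ (T 0 - m : ℝ)/4 + 3/4*(y-1/2) := by nlinarith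
    nlinarith
  calc _ ≤ ((∑' T, ‖a T * ex T ![I/4, 0, I/4]‖) * Real.exp (Real.pi*m/2 + 3*Real.pi/8 - y - Real.pi*m*c.im)) * Real.exp y * Real.exp (Real.pi*m*c.im) := by
        gcongr; exact hk
    _ = _ := by rw [mul_assoc, mul_assoc, ← Real.exp_add, ← Real.exp_add]; congr 2; ring

lemma kill_pl {m : ℤ} (hm : 1 ≤ m) {k : ℕ} (hk : k ≤ 2) {a : Z3 → ℂ} (hg : Good a)
    (hs : ∀ T, a T ≠ 0 → T 2 = m ∧ m ≤ T 0 ∧ 3*m^2 ≤ 4*T 0*m - T 1^2) {M : ℝ} (hM : ∀ w ∈ U3, hh m k a w ≤ M)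
    {w : Fin 3 → ℂ} (hw : w ∈ U3) (h3 : 3 ≤ 4*(w 0).im^2) : hh m k a w ≤ 9/10 * M := by
  obtain ⟨p, q, c, e, hc, h0, -⟩ := Ws_of hw
  generalize w 0 = τ at *
  subst e
  have hM' : ∀ σ : ℂ, σ.im = τ.im/2 → ‖EE a (Ws p q c σ)‖ ≤ M / (√(τ.im/2)^k * Real.exp (Real.pi*m*c.im)) := fun σ hσ => by
    have h := hM _ (Ws_mem (p := p) (q := q) (by rw [hσ]; positivity) hc)
    rw [hh, Ws_eta (by rw [hσ]; positivity), (Ws_im p q c σ).1, hσ] at h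
    rw [le_div_iff₀ (by positivity), ← mul_assoc]; exact h
  set C := M / (√(τ.im/2)^k * Real.exp (Real.pi*m*c.im)) with hC
  set s : ℂ → ℂ := fun ζ => τ - (τ.im/2:ℝ)*I + I*ζ with hsd
  have sim : ∀ ζ, (s ζ).im = τ.im/2 + ζ.re := fun ζ => by simp [hsd]; ring
  set g : ℂ → ℂ := fun ζ => EE a (Ws p q c (s ζ)) * cexp ((3*Real.pi/4:ℝ)*ζ) with hgd
  have nexp : ∀ ζ, ‖cexp ((3*Real.pi/4:ℝ)*ζ)‖ = Real.exp (3*Real.pi/4*ζ.re) := fun ζ => by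
    rw [Complex.norm_exp, re_ofReal_mul]
  have mem : ∀ ζ : ℂ, 0 ≤ ζ.re → Ws p q c (s ζ) ∈ U3 := fun ζ hζ => Ws_mem (by rw [sim]; positivity) hc
  have bd : ∀ ζ : ℂ, 0 ≤ ζ.re → ‖g ζ‖ ≤ ∑' T, ‖a T * ex T (Ws p q c (s 0))‖ := fun ζ hζ => by
    rw [hgd]; beta_reduce
    rw [norm_mul, nexp, EE, ← le_div_iff₀ (Real.exp_pos _), div_eq_mul_inv, ← tsum_mul_right]
    refine (norm_tsum_le_tsum_norm (hg.2 _ (mem ζ hζ)).norm).trans ((hg.2 _ (mem ζ hζ)).norm.tsum_le_tsum (fun T => ?_) ((hg.2 _ (mem 0 le_rfl)).norm.mul_right _))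
    by_cases hT : a T = 0
    · simp [hT]
    obtain ⟨b1, -⟩ := En_ge hm (hs T hT) p
    rw [norm_mul, norm_mul, Ws_ex, Ws_ex, mul_assoc, ← Real.exp_neg, ← Real.exp_add, sim, sim, zero_re]
    gcongr
    have := mul_nonneg (mul_nonneg Real.pi_pos.le hζ) (sub_nonneg.2 b1)
    nlinarith
  have hd : DifferentiableOn ℂ g {z | 0 ≤ z.re} := fun ζ hζ => by
    have d1 := (hg.deriv (mem ζ hζ)).differentiableAt
    have d2 : DifferentiableAt ℂ (fun ζ => Ws p q c (s ζ)) ζ := by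
      rw [differentiableAt_pi]; intro i
      fin_cases i <;> simp only [Ws, hsd] <;> simp <;> fun_prop
    exact ((d1.comp ζ d2).mul (by fun_prop)).differentiableWithinAt
  have pl := PhragmenLindelof.right_half_plane_of_bounded_on_real (f := g) (C := C) (z := ((τ.im/2:ℝ):ℂ))
    (DifferentiableOn.diffContOnCl (by rwa [Complex.closure_setOfPred_lt_re]))
    ⟨1, by norm_num, 0, by
      refine Asymptotics.IsBigO.of_bound (∑' T, ‖a T * ex T (Ws p q c (s 0))‖) ?_
      filter_upwards [mem_inf_of_right (mem_principal_self _)] with z hz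
      simpa using bd z (le_of_lt hz)⟩
    ⟨_, Filter.eventually_map.2 ((eventually_ge_atTop 0).mono fun x hx => bd x (by simpa using hx))⟩
    (fun x => by
      rw [hgd]; beta_reduce
      rw [norm_mul, nexp]
      simpa using hM' (s (x*I)) (by rw [sim]; simp)) (by simp; positivity)
  have s1 : s ((τ.im/2:ℝ):ℂ) = τ := by rw [hsd]; ring
  rw [hgd] at pl; beta_reduce at pl
  rw [s1, norm_mul, nexp, ofReal_re, ← le_div_iff₀ (Real.exp_pos _)] at pl
  have M0 : 0 ≤ M := le_trans (by rw [hh]; positivity) (hM _ hw)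
  rw [hh, Ws_eta h0]
  show _ * √(τ.im)^k * _ ≤ _
  set y := τ.im
  have e2 : √y = √2 * √(y/2) := by rw [← Real.sqrt_mul (by norm_num)]; congr 1; ring
  have k2 : √2^k ≤ 2 := by
    have := Real.sq_sqrt (show (0:ℝ) ≤ 2 by norm_num)
    have h1 := Real.one_le_sqrt.2 (show (1:ℝ) ≤ 2 by norm_num)
    calc _ ≤ √2^2 := pow_le_pow_right₀ h1 hk
      _ = 2 := this
  have e3 : 20/9 ≤ Real.exp (3*Real.pi/4*(y/2)) := by
    have hy : 4/5 ≤ y := by nlinarith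
    have := Real.pi_gt_three
    have h1 : (9/10:ℝ) ≤ 3*Real.pi/4*(y/2) := by nlinarith
    have h2 := Real.quadratic_le_exp_of_nonneg (show (0:ℝ) ≤ 9/10 by norm_num)
    have := Real.exp_le_exp.2 h1
    linarith
  have hq : 0 < √(y/2) := Real.sqrt_pos.2 (by positivity)
  calc _ ≤ C / Real.exp (3*Real.pi/4*(y/2)) * √y^k * Real.exp (Real.pi*m*c.im) := by gcongr
    _ = M * (√2^k / Real.exp (3*Real.pi/4*(y/2))) := by
      rw [e2, mul_pow, hC]; field_simp
    _ ≤ M * (9/10) := by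
      refine mul_le_mul_of_nonneg_left ?_ M0
      rw [div_le_iff₀ (Real.exp_pos _)]; linarith
    _ = _ := by ring

lemma kill {κ : Type*} [Finite κ] {m : ℤ} (hm : 1 ≤ m) {k : ℕ} (hk : k ≤ 2) {a : κ → Z3 → ℂ} (hg : ∀ H, Good (a H))
    (hs : ∀ H T, a H T ≠ 0 → T 2 = m ∧ m ≤ T 0 ∧ 3*m^2 ≤ 4*T 0*m - T 1^2)
    (red : ∀ H, ∀ w ∈ U3, ∃ H' w', w' ∈ U3 ∧ hh m k (a H) w = hh m k (a H') w' ∧ 3 ≤ 4*(w' 0).im^2 ∧ |(w' 1).im| ≤ (w' 0).im/2) (H : κ) :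
    a H = 0 := by
  choose C hC using fun H => kill_bd hm hk (hg H) (hs H)
  obtain ⟨M, hM⟩ := Set.finite_range C |>.bddAbove
  have all : ∀ n : ℕ, ∀ H, ∀ w ∈ U3, hh m k (a H) w ≤ (9/10)^n * M := fun n => by
    induction n with
    | zero => 
      intro H w hw
      obtain ⟨H', w', h1, h2, h3, h4⟩ := red H w hw
      rw [h2, pow_zero, one_mul]
      exact (hC H' w' h1 h3 h4).trans (hM ⟨H', rfl⟩)
    | succ n ih =>
      intro H w hw
      obtain ⟨H', w', h1, h2, h3, h4⟩ := red H w hw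
      rw [h2, pow_succ', mul_assoc]
      exact kill_pl hm hk (hg H') (hs H') (ih H') h1 h3
  refine four_uniq fun w hw => ?_
  have h0 : hh m k (a H) w ≤ 0 := by
    refine ge_of_tendsto' (x := atTop) ?_ fun n => all n H w hw
    simpa using (tendsto_pow_atTop_nhds_zero_of_lt_one (by norm_num) (by norm_num : (9/10:ℝ) < 1)).mul_const M
  have y0 : 0 < √((w 0).im)^k := pow_pos (Real.sqrt_pos.2 (U3_iff.1 hw).1) _
  have h1 : ‖EE (a H) w‖ ≤ 0 := by
    rw [hh, mul_assoc] at h0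
    exact nonpos_of_mul_nonpos_left h0 (by positivity)
  rw [← norm_le_zero_iff.1 h1]
  exact ((hg H).2 w hw).hasSum

end SS

namespace SS
open MeasureTheory
variable {j : ℕ}

def sh (w : Fin 3 → ℂ) (t : ℝ) : Fin 3 → ℂ := ![w 0, w 1, w 2 + t * I]
def rs (m : ℤ) (B : Z3 → ℂ) (T : Z3) : ℂ := if T 2 = m then B T else 0

lemma U3_eta {w : Fin 3 → ℂ} : w ∈ U3 ↔ 0 < (w 0).im ∧ 0 < eta w := by
  rw [U3_iff]
  refine and_congr_right fun h => ?_
  beta_reduce at h ⊢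
  rw [eta, sub_pos, div_lt_iff₀ h, mul_comm]

lemma sh_mem {w : Fin 3 → ℂ} (hw : w ∈ U3) {t : ℝ} (ht : 0 ≤ t) : sh w t ∈ U3 := by
  obtain ⟨h0, h1⟩ := U3_eta.1 hw
  refine U3_eta.2 ⟨h0, ?_⟩
  simp [eta, sh] at h1 ⊢; linarith

lemma lim {B : Z3 → ℂ} (hB : Good B) {m : ℤ} (hm : ∀ T, B T ≠ 0 → m ≤ T 2) {w} (hw : w ∈ U3) :
    Tendsto (fun t : ℝ => (Real.exp (Real.pi * m * t) : ℂ) * EE B (sh w t)) atTop (𝓝 (EE (rs m B) w)) := by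
  have e : ∀ t : ℝ, (Real.exp (Real.pi * m * t) : ℂ) * EE B (sh w t) = ∑' T, B T * ex T w * (Real.exp (-Real.pi * (T 2 - m) * t) : ℂ) := fun t => by
    rw [EE, ← tsum_mul_left]
    refine tsum_congr fun T => ?_
    have : ex T (sh w t) = ex T w * (Real.exp (-Real.pi * T 2 * t) : ℂ) := by
      rw [ex, ex, Complex.ofReal_exp, ← Complex.exp_add]; congr 1
      simp [sh]; linear_combination (Real.pi * T 2 * t : ℂ) * I_sq
    rw [this, show -Real.pi * (T 2 - m) * t = Real.pi * m * t + -Real.pi * T 2 * t by ring, Real.exp_add]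
    push_cast; ring
  simp only [e]
  have key : ∀ T, B T ≠ 0 → ∀ t : ℝ, 0 ≤ t → Real.exp (-Real.pi * (T 2 - m) * t) ≤ 1 := fun T hT t ht => by
    rw [Real.exp_le_one_iff]
    have : (m:ℝ) ≤ T 2 := by exact_mod_cast hm T hT
    have := mul_nonneg (mul_nonneg Real.pi_pos.le (sub_nonneg.2 this)) ht
    linarith
  refine tendsto_tsum_of_dominated_convergence (bound := fun T => ‖B T * ex T w‖) (hB.2 w hw).norm (fun T => ?_) ?_
  · by_cases hT : B T = 0
    · simp [hT, rs]
    by_cases h2 : T 2 = m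
    · simp [rs, h2]
    · rw [rs, if_neg h2, zero_mul, ← mul_zero (B T * ex T w)]
      refine Tendsto.const_mul _ ?_
      rw [← Complex.ofReal_zero]
      refine (Complex.continuous_ofReal.tendsto 0).comp (Real.tendsto_exp_atBot.comp ?_)
      have : (m:ℝ) < T 2 := by exact_mod_cast lt_of_le_of_ne (hm T hT) (Ne.symm h2)
      exact tendsto_id.const_mul_atTop_of_neg (by nlinarith [Real.pi_pos])
  · filter_upwards [eventually_ge_atTop 0] with t ht T
    by_cases hT : B T = 0
    · simp [hT]
    rw [norm_mul, Complex.norm_real, Real.norm_eq_abs, abs_of_pos (Real.exp_pos _)]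
    exact mul_le_of_le_one_right (norm_nonneg _) (key T hT t ht)

lemma hat_tri {f : ℕ} (hf : f ≤ 1) (γ : GZ) (H : M2 → Fin (j+1) → ℂ) (δ e : ℂ) : ∃ d, (f = 0 → d = 0) ∧ ∀ τ ∈ HH, dn (ι γ) τ = !![δ,e;0,1] →
    hat f 0 (sl (ι γ) H τ) 0 1 = δ⁻¹^(f+1) * hat f 0 (H (act (ι γ) τ)) 0 1 + d * hat 0 1 (H (act (ι γ) τ)) 0 1 := by
  have inv : δ ≠ 0 → (!![δ,e;0,1] : M2)⁻¹ = !![δ⁻¹, -e/δ; 0, 1] := fun h => Matrix.inv_eq_right_inv (by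
    ext i k; fin_cases i <;> fin_cases k <;> simp [h]; field_simp; ring)
  refine ⟨if f = 0 then 0 else δ⁻¹*(-e/δ), fun h => by simp [h], fun τ hτ hd => ?_⟩
  have h0 := dn_ne (ι γ) hτ
  rw [hd, det_fin_two] at h0
  have h0 : δ ≠ 0 := by simpa using h0
  rw [sl_of _ _ hτ, hat_smul, hd, inv h0, det_fin_two]
  interval_cases f
  · rw [hat_symAct]; simp
  · rw [hat_symAct_s]; simp; ring

def Stp (γ : GZ) (δ e : ℂ) (w w' : Fin 3 → ℂ) : Prop :=
  ∀ t : ℝ, 0 ≤ t → act (ι γ) (mt (sh w t)) = mt (sh w' t) ∧ dn (ι γ) (mt (sh w t)) = !![δ,e;0,1]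

lemma Fam.good {𝓕 : Set (M2 → Fin (j+1) → ℂ)} (hF : Fam 𝓕) {H} (hH : H ∈ 𝓕) {A} (hA : Four A H) (a b : ℕ) :
    Good (fun T => hat a b (A T) 0 1) ∧ ∀ w ∈ U3, EE (fun T => hat a b (A T) 0 1) w = hat a b (H (mt w)) 0 1 :=
  ⟨⟨fun T hT => K4 hF hH hA fun h => hT (by beta_reduce; rw [h, hat_zero]), fun w hw => (hA.hat a b 0 1 hw).summable⟩,
    fun w hw => (hA.hat a b 0 1 hw).tsum_eq⟩

lemma rs_good {B : Z3 → ℂ} (hB : Good B) (m : ℤ) : Good (rs m B) := by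
  refine ⟨fun T hT => hB.1 T fun h => hT (by simp [rs, h]), fun w hw => .of_norm_bounded (hB.2 w hw).norm fun T => ?_⟩
  by_cases h : T 2 = m <;> simp [rs, h]
  positivity

lemma law {𝓕 : Set (M2 → Fin (j+1) → ℂ)} (hF : Fam 𝓕) {A : 𝓕 → Z3 → Fin (j+1) → ℂ} (hA : ∀ H : 𝓕, Four (A H) H.1) {m : ℤ}
    (hm : ∀ H T, A H T ≠ 0 → m ≤ T 2) {f : ℕ} (hf : f ≤ 1) (hz : f = 1 → ∀ H, rs m (fun T => hat 0 1 (A H T) 0 1) = 0)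
    {γ : GZ} {δ e : ℂ} {w w' : Fin 3 → ℂ} (hw : w ∈ U3) (hw' : w' ∈ U3) (st : Stp γ δ e w w') (hy : (w' 0).im * ‖δ‖^2 = (w 0).im)
    (he : eta w' = eta w) (H : 𝓕) : ∃ H' : 𝓕, hh m (f+1) (rs m fun T => hat f 0 (A H T) 0 1) w = hh m (f+1) (rs m fun T => hat f 0 (A H' T) 0 1) w' := by
  refine ⟨⟨_, hF.sl_mem H.1 H.2 γ⁻¹⟩, ?_⟩
  set H' : 𝓕 := ⟨_, hF.sl_mem H.1 H.2 γ⁻¹⟩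
  have hH : H.1 = sl (ι γ) H'.1 := by
    show _ = sl (ι γ) (sl (ι γ⁻¹) H.1)
    rw [sl_mul, ← map_mul, inv_mul_cancel, map_one, sl_one _ (hF.zero H.1 H.2)]
  have nz : ∀ H a b T, hat a b (A H T) 0 1 ≠ 0 → m ≤ T 2 := fun H a b T h => hm H T fun h' => h (by rw [h', hat_zero])
  have gd := fun (H : 𝓕) a b => hF.good H.2 (hA H) a b
  obtain ⟨d, hd0, hd⟩ := hat_tri hf γ H'.1 δ e
  have l1 := lim (gd H f 0).1 (nz H f 0) hw
  have l2 := ((lim (gd H' f 0).1 (nz H' f 0) hw').const_mul (δ⁻¹^(f+1))).add ((lim (gd H' 0 1).1 (nz H' 0 1) hw').const_mul d)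
  have d0 : d * EE (rs m fun T => hat 0 1 (A H' T) 0 1) w' = 0 := by
    rcases Nat.le_one_iff_eq_zero_or_eq_one.1 hf with h | h
    · rw [hd0 h, zero_mul]
    · rw [hz h, EE]; simp
  rw [d0, add_zero] at l2
  have E := tendsto_nhds_unique l1 (l2.congr' (by
    filter_upwards [eventually_ge_atTop 0] with t ht
    obtain ⟨s1, s2⟩ := st t ht
    rw [(gd H f 0).2 _ (sh_mem hw ht), hH, hd (mt (sh w t)) (sh_mem hw ht) s2, s1, (gd H' f 0).2 _ (sh_mem hw' ht), (gd H' 0 1).2 _ (sh_mem hw' ht)]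
    ring))
  have δ0 : 0 < ‖δ‖ := by
    refine norm_pos_iff.2 fun h => ?_
    have := (U3_eta.1 hw).1
    simp [h] at hy; linarith
  rw [hh, hh, E, he, ← hy, norm_mul, norm_pow, norm_inv, Real.sqrt_mul (U3_eta.1 hw').1.le, Real.sqrt_sq δ0.le, mul_pow, inv_pow]
  field_simp

lemma stp_J (a b c d : ℤ) (h : a * d - b * c = 1) {w : Fin 3 → ℂ} (hw : w ∈ U3) : ∃ w', w' ∈ U3 ∧ w' 0 = (a*w 0+b)/(c*w 0+d) ∧
    Stp (J1 a b c d h) (c*w 0+d) (c*w 1) w w' ∧ (w' 0).im * ‖c*w 0+d‖^2 = (w 0).im ∧ eta w' = eta w := by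
  have y0 := (U3_eta.1 hw).1
  have hdn : ∀ w, num (ι (J1 a b c d h)) (mt w) = !![a*w 0+b, a*w 1; w 1, w 2] ∧ dn (ι (J1 a b c d h)) (mt w) = !![c*w 0+d, c*w 1; 0, 1] := fun w => by
    have e : num (ι (J1 a b c d h)) (mt w) = _ ∧ dn (ι (J1 a b c d h)) (mt w) = _ := mkZ_dn _ _ _ _ (SymplecticGroup.fromBlocks_mem_iff.1 (J1 a b c d h).2) (mt w)
    rw [e.1, e.2]
    constructor <;> ext i k <;> fin_cases i <;> fin_cases k <;> simp [cz, mt, mat, Matrix.mul_apply, Fin.sum_univ_two]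
  have δ0 : c*w 0+d ≠ 0 := by
    have := dn_ne (ι (J1 a b c d h)) (τ := mt w) hw
    rw [(hdn w).2, det_fin_two] at this; simpa using this
  have hc : (a*d-b*c:ℂ) = 1 := by exact_mod_cast h
  set N := Complex.normSq (c*w 0+d) with hN
  have N0 : 0 < N := Complex.normSq_pos.2 δ0
  have Ne : N = (c*(w 0).re+d)^2 + (c*(w 0).im)^2 := by rw [hN, Complex.normSq_apply]; simp; ring
  have hr : (a*d-b*c:ℝ) = 1 := by exact_mod_cast h
  have i0 : ((a*w 0+b)/(c*w 0+d)).im = (w 0).im / N := by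
    rw [Complex.div_im, ← hN]; simp
    field_simp; linear_combination hr
  have et : eta ![(a*w 0+b)/(c*w 0+d), w 1/(c*w 0+d), w 2 - c*w 1^2/(c*w 0+d)] = eta w := by
    have i1 : (w 1/(c*w 0+d)).im = ((w 1).im*(c*(w 0).re+d) - (w 1).re*(c*(w 0).im))/N := by
      rw [Complex.div_im, ← hN]; simp; ring
    have i2 : (c*w 1^2/(c*w 0+d)).im = c*(2*(w 1).re*(w 1).im*(c*(w 0).re+d) - ((w 1).re^2-(w 1).im^2)*(c*(w 0).im))/N := by
      rw [Complex.div_im, ← hN, pow_two]; simp; ring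
    rw [eta, eta]
    simp only [Fin.isValue, cons_val, sub_im]
    rw [i0, i1, i2]
    field_simp
    rw [Ne]; ring
  refine ⟨![(a*w 0+b)/(c*w 0+d), w 1/(c*w 0+d), w 2 - c*w 1^2/(c*w 0+d)], U3_eta.2 ⟨?_, ?_⟩, rfl, fun t ht => ⟨?_, (hdn _).2⟩, ?_, et⟩
  · show 0 < ((a*w 0+b)/(c*w 0+d)).im
    rw [i0]; positivity
  · rw [et]; exact (U3_eta.1 hw).2
  · rw [act, (hdn _).1, (hdn _).2]
    have u : IsUnit (!![c*sh w t 0+d, c*sh w t 1; 0, 1] : M2).det := by rw [det_fin_two]; simpa [sh] using δ0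
    refine Eq.trans ?_ (Matrix.mul_nonsing_inv_cancel_right _ _ u)
    congr 1
    ext i k; fin_cases i <;> fin_cases k <;> simp [mt, mat, sh, Matrix.mul_apply, Fin.sum_univ_two] <;> field_simp
    · exact (mul_div_cancel_right₀ _ (by rwa [mul_comm])).symm
    · apply mul_right_cancel₀ δ0; field_simp; linear_combination w 1 * hc
    · ring
  · show ((a*w 0+b)/(c*w 0+d)).im * _ = _
    rw [i0, ← Complex.normSq_eq_norm_sq, ← hN]; field_simp

lemma stp_S (l : ℤ) {w : Fin 3 → ℂ} (hw : w ∈ U3) (h) : uw 1 0 l 1 w ∈ U3 ∧ Stp (lvZ 1 0 l 1 h) 1 (-l) w (uw 1 0 l 1 w) ∧ eta (uw 1 0 l 1 w) = eta w := by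
  have y0 := (U3_eta.1 hw).1
  refine ⟨uw_mem 1 0 l 1 h hw, fun t ht => ?_, ?_⟩
  · obtain ⟨h1, h2, -, -⟩ := lv_dn 1 0 l 1 h (sh w t)
    refine ⟨?_, by simpa using h1⟩
    rw [h2]; congr 1
    funext i; fin_cases i <;> simp [uw, sh]; ring
  · have : (l:ℂ)^2 = ((l^2:ℝ):ℂ) := by push_cast; rfl
    simp [eta, uw, this, -ofReal_pow]
    field_simp; ring

lemma red {𝓕 : Set (M2 → Fin (j+1) → ℂ)} (hF : Fam 𝓕) {A : 𝓕 → Z3 → Fin (j+1) → ℂ} (hA : ∀ H : 𝓕, Four (A H) H.1) {m : ℤ}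
    (hm : ∀ H T, A H T ≠ 0 → m ≤ T 2) {f : ℕ} (hf : f ≤ 1) (hz : f = 1 → ∀ H, rs m (fun T => hat 0 1 (A H T) 0 1) = 0)
    (H : 𝓕) (w) (hw : w ∈ U3) : ∃ (H' : 𝓕) (w' : Fin 3 → ℂ), w' ∈ U3 ∧ hh m (f+1) (rs m fun T => hat f 0 (A H T) 0 1) w = hh m (f+1) (rs m fun T => hat f 0 (A H' T) 0 1) w'
      ∧ 3 ≤ 4*(w' 0).im^2 ∧ |(w' 1).im| ≤ (w' 0).im/2 := by
  obtain ⟨g, hg⟩ := ModularGroup.exists_smul_mem_fd ⟨w 0, (U3_eta.1 hw).1⟩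
  have h3 := ModularGroup.three_le_four_mul_im_sq_of_mem_fd hg
  obtain ⟨v, v1, v2, v3, v4, v5⟩ := stp_J (g 0 0) (g 0 1) (g 1 0) (g 1 1) (by rw [← Matrix.det_fin_two]; exact g.2) hw
  obtain ⟨H1, e1⟩ := law hF hA hm hf hz hw v1 v3 v4 v5 H
  have y0 := (U3_eta.1 v1).1
  obtain ⟨u1, u2, u3⟩ := stp_S (-round ((v 1).im/(v 0).im)) v1 (by ring)
  have uy : (uw 1 0 (-round ((v 1).im/(v 0).im)) 1 v 0).im = (v 0).im := by simp [uw]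
  obtain ⟨H2, e2⟩ := law hF hA hm hf hz v1 u1 u2 (by simp [uy]) u3 H1
  refine ⟨H2, _, u1, e1.trans e2, ?_, ?_⟩
  · rw [uy, v2]
    rw [← UpperHalfPlane.coe_im, UpperHalfPlane.specialLinearGroup_apply] at h3
    simpa using h3
  · rw [uy]
    have := abs_sub_round ((v 1).im/(v 0).im)
    have e : (uw 1 0 (-round ((v 1).im/(v 0).im)) 1 v 1).im = ((v 1).im/(v 0).im - round ((v 1).im/(v 0).im)) * (v 0).im := by
      simp [uw]; field_simp; ring
    rw [e, abs_mul, abs_of_pos y0]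
    nlinarith
end SS

namespace SS
open MeasureTheory
variable {j : ℕ}

lemma hat01 {v : Fin (j+1) → ℂ} {a : ℕ} (b : ℕ) (h : ∀ i : Fin (j+1), j - (i:ℕ) = a → v i = 0) : hat a b v 0 1 = 0 := by
  rw [hat]
  refine Finset.sum_eq_zero fun i _ => ?_
  rcases lt_trichotomy (j - (i:ℕ)) a with h1 | h1 | h1
  · simp [Nat.descFactorial_of_lt h1]
  · simp [h i h1]
  · rw [zero_pow (by omega)]; simp

lemma hat01' {v : Fin (j+1) → ℂ} {a : ℕ} (h : hat a 0 v 0 1 = 0) : ∀ i : Fin (j+1), j - (i:ℕ) = a → v i = 0 := fun i hi => by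
  rw [hat, Finset.sum_eq_single i] at h
  · rw [hi, Nat.descFactorial_self] at h
    simpa [Nat.factorial_ne_zero] using h
  · intro k _ hk
    rcases lt_trichotomy (j - (k:ℕ)) a with h1 | h1 | h1
    · simp [Nat.descFactorial_of_lt h1]
    · exact absurd (Fin.ext (by omega)) hk
    · rw [zero_pow (by omega)]; simp
  · simp

lemma alg {v : Fin (j+1) → ℂ} {r0 r1 r2 : ℂ} (h2 : r2 ≠ 0) (D : ∀ x y, r0 * hat 0 2 v x y - r1 * hat 1 1 v x y + r2 * hat 2 0 v x y = 0)
    (z0 : hat 0 0 v 0 1 = 0) (z1 : hat 1 0 v 0 1 = 0) : v = 0 := by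
  have D' : ∀ a x y, r0 * hat a 2 v x y - r1 * hat (a+1) 1 v x y + r2 * hat (a+2) 0 v x y = 0 := fun a => by
    induction a with
    | zero => exact D
    | succ a ih =>
      intro x y
      have h := (((hat_deriv_s a 2 v x y 1 0).const_mul r0).sub ((hat_deriv_s (a+1) 1 v x y 1 0).const_mul r1)).add ((hat_deriv_s (a+2) 0 v x y 1 0).const_mul r2)
      have := h.unique (hdc (hasDerivAt_const (0:ℝ) (0:ℂ)) (fun r => ih _ _) rfl)
      simpa [add_right_comm] using this
  have P : ∀ a, (∀ i : Fin (j+1), j - (i:ℕ) = a → v i = 0) ∧ (∀ i : Fin (j+1), j - (i:ℕ) = a + 1 → v i = 0) := fun a => by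
    induction a with
    | zero => exact ⟨hat01' z0, hat01' z1⟩
    | succ a ih =>
      refine ⟨ih.2, hat01' ?_⟩
      have := D' a 0 1
      rw [hat01 2 ih.1, hat01 1 ih.2] at this
      simpa [h2] using this
  funext i; exact (P _).1 i rfl

lemma K3m {𝓕 : Set (M2 → Fin (j+1) → ℂ)} (hF : Fam 𝓕) {A : 𝓕 → Z3 → Fin (j+1) → ℂ} (hA : ∀ H : 𝓕, Four (A H) H.1) {m : ℤ}
    (hm : ∀ H T, A H T ≠ 0 → m ≤ T 2) (H : 𝓕) {T : Z3} (hT : A H T ≠ 0) (s : ℤ) : m ≤ T 0 + T 1*s + T 2 * s^2 := by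
  have h' : (0:ℤ) * s - 1 * (-1) = 1 := by ring
  have hA' := hA ⟨_, hF.sl_mem H.1 H.2 (lvZ 0 1 (-1) s h')⟩
  have := hm _ (Tu 0 1 (-1) s T) (fun h0 => hT (hat_inj fun x y => by
    have := coef_lv h' (hA H) hA' T (s * x - y) x
    rw [h0, hat_zero] at this
    push_cast at this
    rw [hat_zero, this]; congr 1 <;> ring))
  simpa [Tu] using this

lemma main {𝓕 : Set (M2 → Fin (j+1) → ℂ)} (hF : Fam 𝓕) {H} (hH : H ∈ 𝓕) {w} (hw : w ∈ U3) : H (mt w) = 0 := by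
  choose A hA using fun H : 𝓕 => hF.four H.2
  suffices h : ∀ H T, A H T = 0 by
    funext i
    refine (hA ⟨H, hH⟩ w hw i).unique ?_
    simp only [h, Pi.zero_apply, zero_mul]; exact hasSum_zero
  by_contra hc
  push Not at hc
  have hc : ∃ n : ℕ, ∃ H T, A H T ≠ 0 ∧ (T 2).toNat = n := let ⟨H, T, h⟩ := hc; ⟨_, H, T, h, rfl⟩
  classical
  obtain ⟨H0, T0, h0, e0⟩ := Nat.find_spec hc
  have pos : ∀ H T, A H T ≠ 0 → Pos T := fun H T h => K4 hF H.2 (hA H) h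
  have hm : ∀ H T, A H T ≠ 0 → T0 2 ≤ T 2 := fun H T h => by
    have := Nat.find_min' hc ⟨H, T, h, rfl⟩
    have := (pos H T h).2.1
    omega
  have m1 : 1 ≤ T0 2 := (pos H0 T0 h0).2.1
  generalize hT0 : T0 2 = m at hm m1
  have sup : ∀ H T, A H T ≠ 0 → T 2 = m → T 2 = m ∧ m ≤ T 0 ∧ 3*m^2 ≤ 4*T 0*m - T 1^2 := fun H T h h2 => by
    refine ⟨h2, by simpa using K3m hF hA hm H h 0, ?_⟩
    have k1 := K3m hF hA hm H h (-((T 1 + m)/(2*m)))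
    rw [h2] at k1
    have k2 := Int.emod_add_mul_ediv (T 1 + m) (2*m)
    have k3 := Int.emod_nonneg (T 1 + m) (show 2*m ≠ 0 by omega)
    have k4 := Int.emod_lt_of_pos (T 1 + m) (show 0 < 2*m by omega)
    generalize (T 1 + m)/(2*m) = k at *
    generalize (T 1 + m)%(2*m) = r at *
    have e : T 1 = r + 2*m*k - m := by linarith
    have k5 : 0 ≤ r * (2*m - r) := mul_nonneg k3 (by linarith)
    have k6 := mul_le_mul_of_nonneg_left k1 (show 0 ≤ 4*m by omega)
    rw [e] at k6 ⊢
    nlinarith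
  have sup' : ∀ f H T, rs m (fun T => hat f 0 (A H T) 0 1) T ≠ 0 → T 2 = m ∧ m ≤ T 0 ∧ 3*m^2 ≤ 4*T 0*m - T 1^2 := fun f H T h => by
    by_cases h2 : T 2 = m
    · exact sup H T (fun h' => h (by simp [rs, h', hat_zero])) h2
    · exact absurd (by simp [rs, h2]) h
  have fin : Finite 𝓕 := hF.fin
  have gd := fun f (H : 𝓕) => rs_good (hF.good H.2 (hA H) f 0).1 m
  have Z0 := kill m1 (k := 0+1) (by norm_num) (gd 0) (sup' 0) (red hF hA hm (f := 0) (by norm_num) (by norm_num))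
  have z0 : ∀ H T, T 2 = m → hat 0 0 (A H T) 0 1 = 0 := fun H T h => by
    have := congrFun (Z0 H) T
    simpa [rs, h] using this
  have Z1 := kill m1 (k := 1+1) (by norm_num) (gd 1) (sup' 1) (red hF hA hm (f := 1) (by norm_num) (fun _ H => by
    funext T
    by_cases h : T 2 = m
    · simp only [rs, h, if_true]; exact hat01 1 (hat01' (z0 H T h))
    · simp [rs, h]))
  have z1 : hat 1 0 (A H0 T0) 0 1 = 0 := by
    have := congrFun (Z1 H0) T0
    simpa [rs, hT0] using this
  refine h0 (alg (r2 := T0 2) ?_ (DF hF H0.2 (hA H0) T0) (z0 H0 T0 hT0) z1)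
  rw [hT0]; exact_mod_cast (show m ≠ 0 by omega)

lemma last {F : M2 → Fin (j+1) → ℂ} (hF : IsSiegelCuspForm j 1 Sp4Z2 (fun _ => 1) F) {τ : M2} (h' : τ ∈ HH) : F τ = 0 := by
  have e := HH_mat h'.1
  have hw : ![τ 0 0, τ 0 1, τ 1 1] ∈ U3 := by
    show mat (τ 0 0) (τ 0 1) (τ 1 1) ∈ HH
    rwa [← e]
  have hm : F ∈ Set.range fun γ : GZ => sl (ι γ) F := ⟨1, by
    beta_reduce
    rw [map_one]; exact sl_one F fun σ hσ => hF.2.2.2 σ fun h => hσ ((H2_iff σ).1 h)⟩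
  have := main (fam_of hF) hm hw
  rwa [show mt ![τ 0 0, τ 0 1, τ 1 1] = τ from e.symm] at this
end SS

/-- For every integer `j ≥ 0`, the space `S_{j,1}(Γ₂[2])` of Siegel cusp forms of degree 2
and weight `(j,1)` on the principal congruence subgroup of level 2 is zero. -/
theorem vanishing_Sj1_level_two (j : ℕ) :
    SiegelCusp j 1 Sp4Z2 (fun _ => 1) = ⊥ := by
  rw [eq_bot_iff]
  intro F hF
  rw [Submodule.mem_bot]
  funext τ
  by_cases hτ : τ ∈ H2
  · exact SS.last hF ((SS.H2_iff τ).1 hτ)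
  · exact hF.2.2.2 τ hτ
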